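/- arXiv:1907.05003 — 6 statements merged into one kernel-verified Lean document; each statement's English description precedes it below -/
import Mathlib

section
/- If V is a complex vector space of dimension n ≥ 3, then no alternating bilinear map μ : V × V → V has an open GL(V)-orbit under the transport action in the space A(V) of all alternating bilinear maps V × V → V. -/
/-- `A(V)`: an alternating (continuous) bilinear map `μ : V × V → V`. -/
def IsAltBil {V : Type*} [NormedAddCommGroup V] [NormedSpace ℂ V]
    (μ : V →L[ℂ] V →L[ℂ] V) : Prop :=
  ∀ x : V, μ x x = 0

/-- The `GL(V)`-orbit of `μ` under the transport action
`(f · μ)(X,Y) = f⁻¹ (μ (f X) (f Y))`. -/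
def transportOrbit {V : Type*} [NormedAddCommGroup V] [NormedSpace ℂ V]
    (μ : V →L[ℂ] V →L[ℂ] V) : Set (V →L[ℂ] V →L[ℂ] V) :=
  {ν | ∃ f : V ≃L[ℂ] V, ∀ x y : V, ν x y = f.symm (μ (f x) (f y))}

section TransportInvariants

variable {V : Type*} [NormedAddCommGroup V] [NormedSpace ℂ V] [FiniteDimensional ℂ V]

/-- The trace on the space of continuous endomorphisms of `V`. -/
noncomputable def traceCLM : (V →L[ℂ] V) →L[ℂ] ℂ :=
  LinearMap.toContinuousLinearMap
    (LinearMap.trace ℂ V ∘ₗ ContinuousLinearMap.coeLM ℂ)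

theorem traceCLM_apply (g : V →L[ℂ] V) :
    traceCLM g = LinearMap.trace ℂ V (g : V →ₗ[ℂ] V) := rfl

/-- The Killing form of the algebra `(V, ν)`, shifted by `t` times the square of the linear form
`x ↦ tr (ν x)`. -/
noncomputable def shiftedKilling (t : ℂ) (ν : V →L[ℂ] V →L[ℂ] V) : LinearMap.BilinForm ℂ V :=
  LinearMap.mk₂ ℂ (fun x y => traceCLM (ν x ∘L ν y) + t * (traceCLM (ν x) * traceCLM (ν y)))
    (fun x x' y => by simp only [map_add, ContinuousLinearMap.add_comp]; ring)
    (fun c x y => by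
      simp only [map_smul, ContinuousLinearMap.smul_comp, smul_eq_mul]; ring)
    (fun x y y' => by simp only [map_add, ContinuousLinearMap.comp_add]; ring)
    (fun c x y => by
      simp only [map_smul, ContinuousLinearMap.comp_smul, smul_eq_mul]; ring)

theorem shiftedKilling_apply (t : ℂ) (ν : V →L[ℂ] V →L[ℂ] V) (x y : V) :
    shiftedKilling t ν x y =
      traceCLM (ν x ∘L ν y) + t * (traceCLM (ν x) * traceCLM (ν y)) := rfl

theorem shiftedKilling_of_transport (t : ℂ) {μ ν : V →L[ℂ] V →L[ℂ] V} (f : V ≃L[ℂ] V)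
    (h : ∀ x y : V, ν x y = f.symm (μ (f x) (f y))) :
    shiftedKilling t ν =
      (shiftedKilling t μ).comp (f : V →ₗ[ℂ] V) (f : V →ₗ[ℂ] V) := by
  have hconj (g : V →L[ℂ] V) :
      traceCLM ((f.symm : V →L[ℂ] V) ∘L g ∘L (f : V →L[ℂ] V)) = traceCLM g := by
    rw [traceCLM_apply, traceCLM_apply,
      ← LinearMap.trace_conj' (g : V →ₗ[ℂ] V) f.symm.toLinearEquiv]
    congr 1
  have hν (x : V) : ν x = (f.symm : V →L[ℂ] V) ∘L μ (f x) ∘L (f : V →L[ℂ] V) := by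
    ext y; simp [h]
  have hcomp (x y : V) : ν x ∘L ν y =
      (f.symm : V →L[ℂ] V) ∘L (μ (f x) ∘L μ (f y)) ∘L (f : V →L[ℂ] V) := by
    ext z; simp [h]
  ext x y
  rw [shiftedKilling_apply, hcomp, hν x, hν y, hconj, hconj, hconj]
  rfl

variable {ι : Type*} [Fintype ι] [DecidableEq ι]

/-- The discriminant of `shiftedKilling t ν` in the basis `b`. -/
noncomputable def killingDiscr (b : Module.Basis ι ℂ V) (t : ℂ) (ν : V →L[ℂ] V →L[ℂ] V) : ℂ :=
  (LinearMap.BilinForm.toMatrix b (shiftedKilling t ν)).det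

theorem differentiable_killingDiscr_line (b : Module.Basis ι ℂ V) (t : ℂ)
    (μ δ : V →L[ℂ] V →L[ℂ] V) : Differentiable ℂ fun s : ℂ => killingDiscr b t (μ + s • δ) := by
  simp only [killingDiscr, Matrix.det_apply', LinearMap.BilinForm.toMatrix_apply,
    shiftedKilling_apply, add_apply, smul_apply,
    ContinuousLinearMap.add_comp, ContinuousLinearMap.comp_add, ContinuousLinearMap.smul_comp,
    ContinuousLinearMap.comp_smul, map_add, map_smul, smul_eq_mul]
  fun_prop

theorem killingDiscr_of_transport (b : Module.Basis ι ℂ V) (t : ℂ) {μ ν : V →L[ℂ] V →L[ℂ] V}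
    (f : V ≃L[ℂ] V) (h : ∀ x y : V, ν x y = f.symm (μ (f x) (f y))) :
    killingDiscr b t ν = LinearMap.det (f : V →ₗ[ℂ] V) ^ 2 * killingDiscr b t μ := by
  rw [killingDiscr, shiftedKilling_of_transport t f h, LinearMap.BilinForm.toMatrix_comp b b,
    Matrix.det_mul, Matrix.det_mul, Matrix.det_transpose, LinearMap.det_toMatrix, killingDiscr]
  ring

omit [FiniteDimensional ℂ V] in
theorem eq_zero_of_eq_zero_on_orbit {μ : V →L[ℂ] V →L[ℂ] V} (hμ : IsAltBil μ)
    (hopen : IsOpen {ν : {ν : V →L[ℂ] V →L[ℂ] V // IsAltBil ν} |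
        (ν : V →L[ℂ] V →L[ℂ] V) ∈ transportOrbit μ})
    {Φ : (V →L[ℂ] V →L[ℂ] V) → ℂ}
    (hΦ : ∀ μ δ, Differentiable ℂ fun s : ℂ => Φ (μ + s • δ))
    (hzero : ∀ ν ∈ transportOrbit μ, Φ ν = 0)
    {ν : V →L[ℂ] V →L[ℂ] V} (hν : IsAltBil ν) : Φ ν = 0 := by
  have hline (s : ℂ) : IsAltBil (μ + s • (ν - μ)) := fun x => by simp [hμ x, hν x]
  let γ (s : ℂ) : {ν : V →L[ℂ] V →L[ℂ] V // IsAltBil ν} := ⟨μ + s • (ν - μ), hline s⟩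
  have hγ : Continuous γ := Continuous.subtype_mk (by fun_prop) _
  have hmem : ∀ᶠ s in nhds (0 : ℂ), γ s ∈ {ν : {ν : V →L[ℂ] V →L[ℂ] V // IsAltBil ν} |
      (ν : V →L[ℂ] V →L[ℂ] V) ∈ transportOrbit μ} := by
    refine hγ.continuousAt.eventually (hopen.mem_nhds ?_)
    exact ⟨ContinuousLinearEquiv.refl ℂ V, fun x y => by simp [γ]⟩
  have heq := AnalyticOnNhd.eq_of_eventuallyEq
    (f := fun s : ℂ => Φ (μ + s • (ν - μ))) (g := fun _ => 0) (z₀ := 0)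
    (fun s _ => (hΦ μ (ν - μ)).analyticAt s) analyticOnNhd_const (hmem.mono fun s hs => hzero _ hs)
  simpa using congrFun heq 1

omit [DecidableEq ι] in
theorem exists_isAltBil_of_structureConstants (b : Module.Basis ι ℂ V) (c : ι → ι → ι → ℂ)
    (hc : ∀ i j k, c i j k = -c j i k) :
    ∃ ν : V →L[ℂ] V →L[ℂ] V, IsAltBil ν ∧ ∀ i j k, b.repr (ν (b i) (b j)) k = c i j k := by
  classical
  let B : V →ₗ[ℂ] V →ₗ[ℂ] V := b.constr ℂ fun i => b.constr ℂ fun j => ∑ k, c i j k • b k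
  have hB (i j : ι) : B (b i) (b j) = ∑ k, c i j k • b k := by
    simp [B]
  have hskew : B = -B.flip := by
    refine b.ext fun i => b.ext fun j => ?_
    simp only [LinearMap.neg_apply, LinearMap.flip_apply, hB, ← Finset.sum_neg_distrib, ← neg_smul]
    exact Finset.sum_congr rfl fun k _ => by rw [hc]
  refine ⟨LinearMap.toContinuousLinearMap
    ((LinearMap.toContinuousLinearMap : (V →ₗ[ℂ] V) ≃ₗ[ℂ] V →L[ℂ] V).toLinearMap ∘ₗ B),
    fun x => ?_, fun i j k => ?_⟩
  · change B x x = 0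
    have h : B x x = -B x x := congrArg (fun F : V →ₗ[ℂ] V →ₗ[ℂ] V => F x x) hskew
    have h2 : (2 : ℂ) • B x x = 0 := by rw [two_smul]; exact add_eq_zero_iff_eq_neg.mpr h
    exact (smul_eq_zero.mp h2).resolve_left two_ne_zero
  · change b.repr (B (b i) (b j)) k = _
    rw [hB]
    simp [Finsupp.single_apply]

theorem shiftedKilling_basis (b : Module.Basis ι ℂ V) (t : ℂ) {ν : V →L[ℂ] V →L[ℂ] V}
    {c : ι → ι → ι → ℂ} (h : ∀ i j k, b.repr (ν (b i) (b j)) k = c i j k) (i j : ι) :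
    shiftedKilling t ν (b i) (b j) =
      ∑ k, ∑ l, c i l k * c j k l + t * ((∑ k, c i k k) * ∑ k, c j k k) := by
  have hM (i : ι) : LinearMap.toMatrix b b (ν (b i) : V →ₗ[ℂ] V) =
      Matrix.of fun k l => c i l k := by
    ext k l; simp [LinearMap.toMatrix_apply, h]
  rw [shiftedKilling_apply, traceCLM_apply, traceCLM_apply, traceCLM_apply,
    ContinuousLinearMap.toLinearMap_comp, LinearMap.trace_eq_matrix_trace ℂ b,
    LinearMap.trace_eq_matrix_trace ℂ b, LinearMap.trace_eq_matrix_trace ℂ b,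
    LinearMap.toMatrix_comp b b b, hM, hM]
  simp [Matrix.trace, Matrix.mul_apply]

/-- Structure constants of the algebra with products `e₀ eᵢ = lᵢ eᵢ` and
`eᵢ eⱼ = (lᵢ - lⱼ)⁻¹ e₀` (which is zero if `i = j`). -/
noncomputable def weightConstants (l : ι → ℂ) : Unit ⊕ ι → Unit ⊕ ι → Unit ⊕ ι → ℂ
  | .inl _, .inr i, .inr k => if k = i then l i else 0
  | .inr i, .inl _, .inr k => if k = i then -l i else 0
  | .inr i, .inr j, .inl _ => (l i - l j)⁻¹
  | _, _, _ => 0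

omit [Fintype ι] in
theorem weightConstants_antisymm (l : ι → ℂ) (i j k : Unit ⊕ ι) :
    weightConstants l i j k = -weightConstants l j i k := by
  rcases i with i | i <;> rcases j with j | j <;> rcases k with k | k <;>
    simp only [weightConstants, neg_zero]
  · split_ifs <;> simp
  · split_ifs <;> simp
  · rw [← inv_neg, neg_sub]

theorem exists_killingDiscr_eq (b : Module.Basis (Unit ⊕ ι) ℂ V) {l : ι → ℂ}
    (hl : Function.Injective l) :
    ∃ ν : V →L[ℂ] V →L[ℂ] V, IsAltBil ν ∧ ∀ t, killingDiscr b t ν =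
      (∑ i, l i ^ 2 + t * (∑ i, l i) ^ 2) *
        ((-1) ^ Fintype.card ι * (1 - (Fintype.card ι : ℂ))) := by
  obtain ⟨ν, hν, hc⟩ := exists_isAltBil_of_structureConstants b _ (weightConstants_antisymm l)
  refine ⟨ν, hν, fun t => ?_⟩
  have hblocks : LinearMap.BilinForm.toMatrix b (shiftedKilling t ν) =
      Matrix.fromBlocks (Matrix.of fun _ _ => ∑ i, l i ^ 2 + t * (∑ i, l i) ^ 2) 0 0
        (-(1 + Matrix.replicateCol Unit (fun _ : ι => (-1 : ℂ)) *
          Matrix.replicateRow Unit (fun _ : ι => (1 : ℂ)))) := by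
    ext i j
    rw [LinearMap.BilinForm.toMatrix_apply, shiftedKilling_basis b t hc]
    rcases i with i | i <;> rcases j with j | j
    · simp [weightConstants, Fintype.sum_sum_type, sq]
    · simp [weightConstants, Fintype.sum_sum_type]
    · simp [weightConstants, Fintype.sum_sum_type]
    · rcases eq_or_ne i j with rfl | hij
      · simp [weightConstants, Fintype.sum_sum_type, Matrix.mul_apply]
      · have h0 : l i - l j ≠ 0 := sub_ne_zero.mpr (hl.ne hij)
        have h1 : l j - l i ≠ 0 := sub_ne_zero.mpr (hl.ne hij.symm)
        simp [weightConstants, Fintype.sum_sum_type, Matrix.mul_apply, hij]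
        field_simp
        ring
  rw [killingDiscr, hblocks, Matrix.det_fromBlocks_zero₁₂, Matrix.det_neg,
    Matrix.det_one_add_replicateCol_mul_replicateRow]
  simp [dotProduct, sub_eq_add_neg]

omit [DecidableEq ι] in
theorem sum_intCast_sq_ne_zero [Nontrivial ι] {l : ι → ℤ} (hl : Function.Injective l) :
    ∑ i, (l i : ℂ) ^ 2 ≠ 0 := by
  intro h
  have h' : ∑ i, l i ^ 2 = 0 := by exact_mod_cast h
  rw [Finset.sum_eq_zero_iff_of_nonneg fun i _ => sq_nonneg _] at h'
  obtain ⟨i, j, hij⟩ := exists_pair_ne ι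
  have hz (k : ι) : l k = 0 := by simpa using h' k (Finset.mem_univ k)
  exact hij (hl ((hz i).trans (hz j).symm))

end TransportInvariants

/-- If `dim V ≥ 3`, no alternating bilinear map `μ : V × V → V` has an open
`GL(V)`-orbit in the space `A(V)` of alternating bilinear maps. -/
theorem no_open_orbit_of_three_le_finrank
    (V : Type*) [NormedAddCommGroup V] [NormedSpace ℂ V] [FiniteDimensional ℂ V]
    (hdim : 3 ≤ Module.finrank ℂ V)
    (μ : V →L[ℂ] V →L[ℂ] V) (hμ : IsAltBil μ) :
    ¬ IsOpen {ν : {ν : V →L[ℂ] V →L[ℂ] V // IsAltBil ν} |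
        (ν : V →L[ℂ] V →L[ℂ] V) ∈ transportOrbit μ} := by
  intro hopen
  obtain ⟨m, hm⟩ : ∃ m, Module.finrank ℂ V = m + 3 := ⟨_, (Nat.sub_add_cancel hdim).symm⟩
  let b : Module.Basis (Unit ⊕ Fin (m + 2)) ℂ V :=
    (Module.finBasis ℂ V).reindex (Fintype.equivOfCardEq (by simp [hm]; ring))
  let l : Fin (m + 2) → ℤ := fun i => i
  have hl : Function.Injective l := fun i j h => by simpa [l, Fin.ext_iff] using h
  let l' : Fin (m + 2) → ℤ := fun i => (m + 2) * l i - ∑ j, l j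
  have hl' : Function.Injective l' := fun i j h => by
    have hm2 : (m : ℤ) + 2 ≠ 0 := by positivity
    exact hl (mul_left_cancel₀ hm2 (sub_left_injective h))
  have hsum : (∑ i, (l i : ℂ)) ≠ 0 := by
    have : 0 < ∑ i, l i :=
      Finset.sum_pos' (fun i _ => by simp [l]) ⟨1, Finset.mem_univ _, by simp [l]⟩
    exact_mod_cast this.ne'
  have hsum' : (∑ i, (l' i : ℂ)) = 0 := by
    have : ∑ i, l' i = 0 := by simp [l', Finset.sum_sub_distrib, ← Finset.mul_sum]
    exact_mod_cast this
  have hcard : (-1 : ℂ) ^ Fintype.card (Fin (m + 2)) *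
      (1 - (Fintype.card (Fin (m + 2)) : ℂ)) ≠ 0 := by
    refine mul_ne_zero (pow_ne_zero _ (by norm_num)) (sub_ne_zero.mpr ?_)
    rw [Fintype.card_fin]
    exact_mod_cast (by omega : 1 ≠ m + 2)
  obtain ⟨ν, hν, hνd⟩ := exists_killingDiscr_eq b (Int.cast_injective.comp hl)
  obtain ⟨ν', hν', hνd'⟩ := exists_killingDiscr_eq b (Int.cast_injective.comp hl')
  have hsq' := sum_intCast_sq_ne_zero hl'
  simp only [Function.comp_apply] at hνd hνd'
  rw [hsum'] at hνd'
  have hprop {ρ : V →L[ℂ] V →L[ℂ] V} (hρ : IsAltBil ρ) :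
      killingDiscr b 0 μ * killingDiscr b 1 ρ - killingDiscr b 1 μ * killingDiscr b 0 ρ = 0 := by
    refine eq_zero_of_eq_zero_on_orbit hμ hopen
      (Φ := fun ρ => killingDiscr b 0 μ * killingDiscr b 1 ρ
        - killingDiscr b 1 μ * killingDiscr b 0 ρ)
      (fun σ δ => ((differentiable_killingDiscr_line b 1 σ δ).const_mul _).sub
        ((differentiable_killingDiscr_line b 0 σ δ).const_mul _)) ?_ hρ
    rintro σ ⟨f, hf⟩
    simp only [killingDiscr_of_transport b _ f hf]
    ring
  have heq : killingDiscr b 0 μ = killingDiscr b 1 μ := by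
    have h := hprop hν'
    rw [hνd', hνd'] at h
    refine mul_right_cancel₀ (mul_ne_zero hsq' hcard) ?_
    linear_combination h
  have hμ0 : killingDiscr b 0 μ = 0 := by
    have h := hprop hν
    rw [hνd, hνd, ← heq] at h
    have : killingDiscr b 0 μ * ((∑ i, (l i : ℂ)) ^ 2 *
        ((-1 : ℂ) ^ Fintype.card (Fin (m + 2)) * (1 - (Fintype.card (Fin (m + 2)) : ℂ)))) = 0 := by
      linear_combination h
    exact (mul_eq_zero.mp this).resolve_right (mul_ne_zero (pow_ne_zero _ hsum) hcard)
  have h := eq_zero_of_eq_zero_on_orbit hμ hopen (differentiable_killingDiscr_line b 0)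
    (by rintro σ ⟨f, hf⟩; rw [killingDiscr_of_transport b _ f hf, hμ0, mul_zero]) hν'
  rw [hνd'] at h
  exact mul_ne_zero (by simpa using hsq') hcard h
end

section
/- Let V be a 2-dimensional complex vector space. For every nonzero alternating bilinear map μ : V × V → V, the GL(V)-orbit of μ under the transport action is exactly the set of all nonzero alternating bilinear maps V × V → V; in particular this orbit is open in A(V). -/
namespace IsAltBil

variable {V : Type*} [NormedAddCommGroup V] [NormedSpace ℂ V] {μ : V →L[ℂ] V →L[ℂ] V}

theorem neg_apply (hμ : IsAltBil μ) (x y : V) : -μ x y = μ y x :=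
  LinearMap.IsAlt.neg (B := μ.toLinearMap₁₂) hμ x y

theorem apply_add_smul (hμ : IsAltBil μ) (u v : V) (a b c d : ℂ) :
    μ (a • u + b • v) (c • u + d • v) = (a * d - b * c) • μ u v := by
  simp only [map_add, map_smul, add_apply, smul_apply,
    hμ u, hμ v, ← hμ.neg_apply u v]
  module

theorem linearIndependent_of_apply_ne_zero (hμ : IsAltBil μ) {u v : V} (h : μ u v ≠ 0) :
    LinearIndependent ℂ ![u, v] := by
  rw [LinearIndependent.pair_iff]
  intro s t hst
  have hs : s • μ u v = 0 := by
    simpa [hst] using (hμ.apply_add_smul u v s t 0 1).symm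
  have ht : t • μ u v = 0 := by
    simpa [hst] using (hμ.apply_add_smul u v s t (-1) 0).symm
  exact ⟨(smul_eq_zero.mp hs).resolve_right h, (smul_eq_zero.mp ht).resolve_right h⟩

theorem exists_basis_of_apply_ne_zero (hμ : IsAltBil μ) (hdim : Module.finrank ℂ V = 2) {u v : V}
    (h : μ u v ≠ 0) : ∃ b : Module.Basis (Fin 2) ℂ V, b 0 = u ∧ b 1 = v :=
  ⟨basisOfLinearIndependentOfCardEqFinrank (hμ.linearIndependent_of_apply_ne_zero h)
    (by simp [hdim]), by simp, by simp⟩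

theorem exists_basis_apply_eq (hμ : IsAltBil μ) (hdim : Module.finrank ℂ V = 2) (hne : μ ≠ 0) :
    ∃ b : Module.Basis (Fin 2) ℂ V, μ (b 0) (b 1) = b 0 := by
  obtain ⟨x, y, hxy⟩ : ∃ x y, μ x y ≠ 0 := by
    by_contra! h
    exact hne (by ext x y; simpa using h x y)
  obtain ⟨b, rfl, rfl⟩ := hμ.exists_basis_of_apply_ne_zero hdim hxy
  obtain ⟨z, hz⟩ : ∃ z, μ (μ (b 0) (b 1)) z = μ (b 0) (b 1) := by
    have hw := b.sum_repr (μ (b 0) (b 1))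
    rw [Fin.sum_univ_two] at hw
    set p := b.repr (μ (b 0) (b 1)) 0
    set q := b.repr (μ (b 0) (b 1)) 1
    have key (c d : ℂ) : μ (μ (b 0) (b 1)) (c • b 0 + d • b 1) =
        (p * d - q * c) • μ (b 0) (b 1) := by
      rw [← hμ.apply_add_smul, hw]
    by_cases hp : p = 0
    · have hq : q ≠ 0 := by
        intro hq
        exact hxy (by rw [← hw, hp, hq]; simp)
      exact ⟨(-q⁻¹) • b 0 + (0 : ℂ) • b 1, by rw [key]; simp [hq]⟩
    · exact ⟨(0 : ℂ) • b 0 + p⁻¹ • b 1, by rw [key]; simp [hp]⟩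
  obtain ⟨b', h0, h1⟩ := hμ.exists_basis_of_apply_ne_zero hdim (hz.symm ▸ hxy)
  exact ⟨b', by rw [h0, h1, hz]⟩

theorem mem_transportOrbit [FiniteDimensional ℂ V] {ν : V →L[ℂ] V →L[ℂ] V} (hμ : IsAltBil μ)
    (hν : IsAltBil ν) (hdim : Module.finrank ℂ V = 2) (hμ0 : μ ≠ 0) (hν0 : ν ≠ 0) :
    ν ∈ transportOrbit μ := by
  obtain ⟨b, hb⟩ := hμ.exists_basis_apply_eq hdim hμ0
  obtain ⟨b', hb'⟩ := hν.exists_basis_apply_eq hdim hν0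
  have hf (i : Fin 2) : b'.equiv b (Equiv.refl _) (b' i) = b i := by simp
  refine ⟨(b'.equiv b (Equiv.refl _)).toContinuousLinearEquiv, fun x y => ?_⟩
  rw [ContinuousLinearEquiv.eq_symm_apply, ← b'.sum_repr x, ← b'.sum_repr y]
  simp only [Fin.sum_univ_two, hν.apply_add_smul, hb', LinearEquiv.coe_toContinuousLinearEquiv',
    map_add (b'.equiv b (Equiv.refl _)), map_smul (b'.equiv b (Equiv.refl _)), hf,
    hμ.apply_add_smul, hb]

theorem of_mem_transportOrbit {ν : V →L[ℂ] V →L[ℂ] V} (hμ : IsAltBil μ)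
    (hν : ν ∈ transportOrbit μ) : IsAltBil ν := by
  obtain ⟨f, hf⟩ := hν
  intro x
  rw [hf, hμ, map_zero]

end IsAltBil

theorem ne_zero_of_mem_transportOrbit {V : Type*} [NormedAddCommGroup V] [NormedSpace ℂ V]
    {μ ν : V →L[ℂ] V →L[ℂ] V} (hμ : μ ≠ 0) (hν : ν ∈ transportOrbit μ) : ν ≠ 0 := by
  obtain ⟨f, hf⟩ := hν
  rintro rfl
  refine hμ (ContinuousLinearMap.ext fun x => ContinuousLinearMap.ext fun y => ?_)
  simpa using (hf (f.symm x) (f.symm y)).symm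

/-- If `dim V = 2` and `μ` is a nonzero alternating bilinear map on `V`, then the
`GL(V)`-orbit of `μ` is exactly the set of nonzero alternating bilinear maps, and in
particular this orbit is open in `A(V)`. -/
theorem orbit_eq_nonzero_of_finrank_two
    (V : Type*) [NormedAddCommGroup V] [NormedSpace ℂ V] [FiniteDimensional ℂ V]
    (hdim : Module.finrank ℂ V = 2)
    (μ : V →L[ℂ] V →L[ℂ] V) (hμ : IsAltBil μ) (hne : μ ≠ 0) :
    transportOrbit μ = {ν : V →L[ℂ] V →L[ℂ] V | IsAltBil ν ∧ ν ≠ 0} ∧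
    IsOpen {ν : {ν : V →L[ℂ] V →L[ℂ] V // IsAltBil ν} |
        (ν : V →L[ℂ] V →L[ℂ] V) ∈ transportOrbit μ} := by
  have horbit : transportOrbit μ = {ν : V →L[ℂ] V →L[ℂ] V | IsAltBil ν ∧ ν ≠ 0} := by
    ext ν
    exact ⟨fun h => ⟨hμ.of_mem_transportOrbit h, ne_zero_of_mem_transportOrbit hne h⟩,
      fun h => hμ.mem_transportOrbit h.1 hdim hne h.2⟩
  refine ⟨horbit, ?_⟩
  have hset : {ν : {ν : V →L[ℂ] V →L[ℂ] V // IsAltBil ν} |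
      (ν : V →L[ℂ] V →L[ℂ] V) ∈ transportOrbit μ} = Subtype.val ⁻¹' {0}ᶜ := by
    ext ν
    simp [horbit, ν.2]
  rw [hset]
  exact isOpen_compl_singleton.preimage continuous_subtype_val
end

section
/- The Lie bracket μ on ℂ² defined on the standard basis by μ(e₁,e₂) = e₂ is rigid: its GL(2,ℂ)-orbit under the transport action is open in the set of all Lie brackets on ℂ². -/
/-- A Lie bracket on `V`: an alternating bilinear map satisfying the Jacobi identity. -/
def IsLieBracket {V : Type*} [NormedAddCommGroup V] [NormedSpace ℂ V]
    (μ : V →L[ℂ] V →L[ℂ] V) : Prop :=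
  IsAltBil μ ∧ ∀ x y z : V, μ (μ x y) z + μ (μ y z) x + μ (μ z x) y = 0

/-- An alternating bilinear map on `ℂ²` is the determinant times its value on the standard basis. -/
theorem IsAltBil.apply_eq_det_smul {ν : (Fin 2 → ℂ) →L[ℂ] (Fin 2 → ℂ) →L[ℂ] (Fin 2 → ℂ)}
    (hν : IsAltBil ν) (x y : Fin 2 → ℂ) :
    ν x y = (x 0 * y 1 - x 1 * y 0) • ν (Pi.single 0 1) (Pi.single 1 1) := by
  have decomp (v : Fin 2 → ℂ) :
      v = v 0 • (Pi.single 0 1 : Fin 2 → ℂ) + v 1 • (Pi.single 1 1 : Fin 2 → ℂ) := by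
    ext i
    fin_cases i <;> simp
  have swap : ν (Pi.single 1 1) (Pi.single 0 1) = -ν (Pi.single 0 1) (Pi.single 1 1) := by
    have h := hν (Pi.single 0 1 + Pi.single 1 1)
    simp only [map_add, add_apply, hν (Pi.single 0 1),
      hν (Pi.single 1 1), zero_add, add_zero] at h
    exact eq_neg_of_add_eq_zero_left h
  conv_lhs => rw [decomp x, decomp y]
  simp only [map_add, map_smul, add_apply, smul_apply,
    hν (Pi.single 0 1), hν (Pi.single 1 1), swap]
  module

/-- For `w ≠ 0` in `ℂ²`, the linear automorphism with rows `(w 1, -w 0)` and `conj w`. It maps `w`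
to its determinant times the second standard basis vector. -/
noncomputable def rotateEquiv (w : Fin 2 → ℂ) (hw : w 0 * star (w 0) + w 1 * star (w 1) ≠ 0) :
    (Fin 2 → ℂ) ≃ₗ[ℂ] (Fin 2 → ℂ) where
  toFun x := ![w 1 * x 0 - w 0 * x 1, star (w 0) * x 0 + star (w 1) * x 1]
  invFun y := (w 0 * star (w 0) + w 1 * star (w 1))⁻¹ •
    ![star (w 1) * y 0 + w 0 * y 1, w 1 * y 1 - star (w 0) * y 0]
  map_add' x y := by
    ext i
    fin_cases i <;> simp <;> ring
  map_smul' c x := by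
    ext i
    fin_cases i <;> simp <;> ring
  left_inv x := by
    rw [inv_smul_eq_iff₀ hw]
    ext i
    fin_cases i <;> simp <;> ring
  right_inv y := by
    ext i
    fin_cases i <;> simp only [Pi.smul_apply, smul_eq_mul, Fin.zero_eta, Fin.mk_one,
      Matrix.cons_val_zero, Matrix.cons_val_one]
    · linear_combination y 0 * mul_inv_cancel₀ hw
    · linear_combination y 1 * mul_inv_cancel₀ hw

theorem rotateEquiv_apply (w : Fin 2 → ℂ) (hw : w 0 * star (w 0) + w 1 * star (w 1) ≠ 0)
    (x : Fin 2 → ℂ) :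
    rotateEquiv w hw x = ![w 1 * x 0 - w 0 * x 1, star (w 0) * x 0 + star (w 1) * x 1] :=
  rfl

open scoped ComplexOrder in
/-- The orbit of the nonabelian bracket on `ℂ²` contains exactly the alternating maps that do not
vanish on the standard basis. -/
theorem IsAltBil.mem_transportOrbit_iff
    {μ ν : (Fin 2 → ℂ) →L[ℂ] (Fin 2 → ℂ) →L[ℂ] (Fin 2 → ℂ)} (hν : IsAltBil ν) (hμ : IsAltBil μ)
    (hdef : μ (Pi.single 0 1) (Pi.single 1 1) = Pi.single 1 1) :
    ν ∈ transportOrbit μ ↔ ν (Pi.single 0 1) (Pi.single 1 1) ≠ 0 := by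
  constructor
  · rintro ⟨f, hf⟩ h0
    have h := hf (f.symm (Pi.single 0 1)) (f.symm (Pi.single 1 1))
    rw [hν.apply_eq_det_smul, h0, smul_zero, f.apply_symm_apply, f.apply_symm_apply, hdef,
      eq_comm, map_eq_zero_iff f.symm f.symm.injective] at h
    simpa using congrFun h 1
  · intro h0
    set w := ν (Pi.single 0 1) (Pi.single 1 1) with hw
    have hdet : w 0 * star (w 0) + w 1 * star (w 1) ≠ 0 := by
      have h := (dotProduct_star_self_eq_zero (v := w)).not.mpr h0
      simpa [dotProduct, Fin.sum_univ_two, mul_comm] using h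
    refine ⟨(rotateEquiv w hdet).toContinuousLinearEquiv, fun x y => ?_⟩
    rw [ContinuousLinearEquiv.eq_symm_apply, hμ.apply_eq_det_smul, hdef,
      hν.apply_eq_det_smul x y, ← hw]
    simp only [LinearEquiv.coe_toContinuousLinearEquiv', rotateEquiv_apply]
    ext i
    fin_cases i <;> simp <;> ring

/-- The Lie bracket `μ` on `ℂ²` defined on the standard basis by `μ(e₁,e₂) = e₂`
is rigid: its `GL(2,ℂ)`-orbit under the transport action is open in the set of Lie
brackets on `ℂ²`. -/
theorem rigid_two_dim_solvable
    (μ : (Fin 2 → ℂ) →L[ℂ] (Fin 2 → ℂ) →L[ℂ] (Fin 2 → ℂ))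
    (halt : IsAltBil μ)
    (hdef : μ (Pi.single 0 1) (Pi.single 1 1) = Pi.single 1 1) :
    IsOpen {ν : {ν : (Fin 2 → ℂ) →L[ℂ] (Fin 2 → ℂ) →L[ℂ] (Fin 2 → ℂ) // IsLieBracket ν} |
        (ν : (Fin 2 → ℂ) →L[ℂ] (Fin 2 → ℂ) →L[ℂ] (Fin 2 → ℂ)) ∈ transportOrbit μ} := by
  have heq : {ν : {ν : (Fin 2 → ℂ) →L[ℂ] (Fin 2 → ℂ) →L[ℂ] (Fin 2 → ℂ) // IsLieBracket ν} |
      (ν : (Fin 2 → ℂ) →L[ℂ] (Fin 2 → ℂ) →L[ℂ] (Fin 2 → ℂ)) ∈ transportOrbit μ} =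
      {ν | ν.1 (Pi.single 0 1) (Pi.single 1 1) ≠ 0} :=
    Set.ext fun ν => ν.2.1.mem_transportOrbit_iff halt hdef
  rw [heq]
  exact isOpen_ne_fun (by fun_prop) continuous_const
end

section
/- (Nijenhuis–Richardson) Let μ be a Lie bracket on a finite-dimensional complex vector space V. Suppose that every 2-cocycle of μ is a 2-coboundary, i.e. for every alternating bilinear map φ : V × V → V satisfying μ(X,φ(Y,Z)) + μ(Y,φ(Z,X)) + μ(Z,φ(X,Y)) − φ(μ(X,Y),Z) − φ(μ(Y,Z),X) − φ(μ(Z,X),Y) = 0 for all X,Y,Z ∈ V, there exists a linear map f : V → V with φ(X,Y) = μ(f(X),Y) + μ(X,f(Y)) − f(μ(X,Y)) for all X,Y ∈ V. Then μ is rigid. -/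
namespace AltBil

set_option maxSynthPendingDepth 10

variable {V : Type*} [NormedAddCommGroup V] [NormedSpace ℂ V]

/-- The bilinear map `(x, y) ↦ h (ν (g x) (g y))`. -/
noncomputable def conj (h g : V →L[ℂ] V) (ν : V →L[ℂ] V →L[ℂ] V) : V →L[ℂ] V →L[ℂ] V :=
  ((ContinuousLinearMap.compL ℂ V V V h).comp ((ContinuousLinearMap.compL ℂ V V V).flip g)).comp
    (ν.comp g)

@[simp]
theorem conj_apply (h g : V →L[ℂ] V) (ν : V →L[ℂ] V →L[ℂ] V) (x y : V) :
    conj h g ν x y = h (ν (g x) (g y)) := rfl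

theorem continuous_conj (h g : V →L[ℂ] V) : Continuous (conj h g) := by
  unfold conj
  fun_prop

theorem conj_conj {h g h' g' : V →L[ℂ] V} (hh : ∀ x, h' (h x) = x) (hg : ∀ x, g (g' x) = x)
    (ν : V →L[ℂ] V →L[ℂ] V) : conj h' g' (conj h g ν) = ν := by
  ext x y
  simp [hh, hg]

theorem isLieBracket_conj {h g : V →L[ℂ] V} (hgh : ∀ x, g (h x) = x) {ν : V →L[ℂ] V →L[ℂ] V}
    (hν : IsLieBracket ν) : IsLieBracket (conj h g ν) := by
  refine ⟨fun x => by simp [hν.1 (g x)], fun x y z => ?_⟩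
  simp only [conj_apply, hgh, ← map_add, hν.2, map_zero]

/-- The bilinear operation `(φ, ψ) ↦ ((x, y, z) ↦ φ (ψ x y) z)`. -/
noncomputable def insertion : (V →L[ℂ] V →L[ℂ] V) →L[ℂ] (V →L[ℂ] V →L[ℂ] V) →L[ℂ]
    (V →L[ℂ] V →L[ℂ] V →L[ℂ] V) :=
  (ContinuousLinearMap.compL ℂ V (V →L[ℂ] V) (V →L[ℂ] V →L[ℂ] V)).comp
    (ContinuousLinearMap.compL ℂ V V (V →L[ℂ] V))

@[simp]
theorem insertion_apply (φ ψ : V →L[ℂ] V →L[ℂ] V) (x y z : V) :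
    insertion φ ψ x y z = φ (ψ x y) z := rfl

/-- The operation taking a trilinear map `T` to `(x, y, z) ↦ T y z x`. -/
noncomputable def rotation : (V →L[ℂ] V →L[ℂ] V →L[ℂ] V) →L[ℂ] (V →L[ℂ] V →L[ℂ] V →L[ℂ] V) :=
  ((ContinuousLinearMap.flipₗᵢ ℂ V V (V →L[ℂ] V)).toContinuousLinearEquiv.toContinuousLinearMap).comp
    (ContinuousLinearMap.compL ℂ V (V →L[ℂ] V →L[ℂ] V) (V →L[ℂ] V →L[ℂ] V)
      (ContinuousLinearMap.flipₗᵢ ℂ V V V).toContinuousLinearEquiv.toContinuousLinearMap)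

@[simp]
theorem rotation_apply (T : V →L[ℂ] V →L[ℂ] V →L[ℂ] V) (x y z : V) :
    rotation T x y z = T y z x := rfl

/-- The sum of a trilinear map over the cyclic permutations of its arguments. -/
noncomputable def cyclicSum :
    (V →L[ℂ] V →L[ℂ] V →L[ℂ] V) →L[ℂ] (V →L[ℂ] V →L[ℂ] V →L[ℂ] V) :=
  ContinuousLinearMap.id ℂ _ + rotation + rotation.comp rotation

@[simp]
theorem cyclicSum_apply (T : V →L[ℂ] V →L[ℂ] V →L[ℂ] V) (x y z : V) :
    cyclicSum T x y z = T x y z + T y z x + T z x y := rfl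

/-- The linearization at `μ` of the Jacobiator; on alternating maps it is minus the
Chevalley–Eilenberg differential. -/
noncomputable def jacobiDeriv (μ : V →L[ℂ] V →L[ℂ] V) :
    (V →L[ℂ] V →L[ℂ] V) →L[ℂ] (V →L[ℂ] V →L[ℂ] V →L[ℂ] V) :=
  cyclicSum.comp (insertion μ + insertion.flip μ)

@[simp]
theorem jacobiDeriv_apply (μ φ : V →L[ℂ] V →L[ℂ] V) (x y z : V) :
    jacobiDeriv μ φ x y z = μ (φ x y) z + φ (μ x y) z + (μ (φ y z) x + φ (μ y z) x) +
      (μ (φ z x) y + φ (μ z x) y) := rfl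

theorem _root_.IsAltBil.neg_swap {φ : V →L[ℂ] V →L[ℂ] V} (hφ : IsAltBil φ) (x y : V) :
    -φ x y = φ y x := by
  have h := hφ (x + y)
  simp only [map_add, add_apply, hφ x, hφ y, zero_add, add_zero] at h
  exact neg_eq_of_add_eq_zero_left h

theorem jacobiDeriv_eq_neg_of_isLieBracket_add {μ φ : V →L[ℂ] V →L[ℂ] V} (hμ : IsLieBracket μ)
    (h : IsLieBracket (μ + φ)) : jacobiDeriv μ φ = -cyclicSum (insertion φ φ) := by
  ext x y z
  have h₁ := hμ.2 x y z
  have h₂ := h.2 x y z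
  simp only [add_apply, map_add] at h₂
  simp only [jacobiDeriv_apply, neg_apply, cyclicSum_apply, insertion_apply]
  rw [eq_neg_iff_add_eq_zero, ← sub_eq_zero.mpr (h₂.trans h₁.symm)]
  abel

theorem jacobiDeriv_cocycle {μ φ : V →L[ℂ] V →L[ℂ] V} (hμ : IsAltBil μ)
    (h : jacobiDeriv μ φ = 0) (x y z : V) :
    μ x (φ y z) + μ y (φ z x) + μ z (φ x y) - φ (μ x y) z - φ (μ y z) x - φ (μ z x) y = 0 := by
  have h' : jacobiDeriv μ φ x y z = 0 := by simp [h]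
  rw [jacobiDeriv_apply] at h'
  rw [← hμ.neg_swap _ x, ← hμ.neg_swap _ y, ← hμ.neg_swap _ z, ← neg_eq_zero, ← h']
  abel

/-- A linear map that is injective on a finite-dimensional subspace is bounded below there. -/
theorem exists_norm_le_mul_norm_of_injOn {E F : Type*} [NormedAddCommGroup E] [NormedSpace ℂ E]
    [NormedAddCommGroup F] [NormedSpace ℂ F] (S : Submodule ℂ E) [FiniteDimensional ℂ S]
    (d : E →L[ℂ] F) (hd : ∀ w ∈ S, d w = 0 → w = 0) :
    ∃ K : ℝ, 0 ≤ K ∧ ∀ w ∈ S, ‖w‖ ≤ K * ‖d w‖ := by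
  obtain ⟨K, -, hK⟩ := (d.toLinearMap.domRestrict S).exists_antilipschitzWith <| by
    rw [LinearMap.ker_eq_bot']
    exact fun w hw => Subtype.ext (hd w w.2 hw)
  refine ⟨K, K.2, fun w hw => ?_⟩
  simpa using hK.le_mul_dist (⟨w, hw⟩ : S) 0

/-- The alternating bilinear maps, as a subspace. -/
def altSubmodule (V : Type*) [NormedAddCommGroup V] [NormedSpace ℂ V] :
    Submodule ℂ (V →L[ℂ] V →L[ℂ] V) where
  carrier := {φ | IsAltBil φ}
  zero_mem' _ := rfl
  add_mem' hφ hψ x := by simp [hφ x, hψ x]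
  smul_mem' c φ hφ x := by simp [hφ x]

theorem exists_norm_cyclicSum_insertion_le :
    ∃ C : ℝ, ∀ φ : V →L[ℂ] V →L[ℂ] V, ‖cyclicSum (insertion φ φ)‖ ≤ C * ‖φ‖ * ‖φ‖ := by
  refine ⟨‖cyclicSum (V := V)‖ * ‖insertion (V := V)‖, fun φ => ?_⟩
  have h₁ : ‖cyclicSum (insertion φ φ)‖ ≤ ‖cyclicSum (V := V)‖ * ‖insertion φ φ‖ :=
    ContinuousLinearMap.le_opNorm _ _
  have h₂ : ‖insertion φ φ‖ ≤ ‖insertion (V := V)‖ * ‖φ‖ * ‖φ‖ :=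
    ContinuousLinearMap.le_opNorm₂ _ _ _
  have h₃ := mul_le_mul_of_nonneg_left h₂ (norm_nonneg (cyclicSum (V := V)))
  linarith

/-- In a subspace of alternating maps on which the linearized Jacobiator is injective, a small
`φ` such that `μ + φ` is a Lie bracket vanishes. -/
theorem eventually_eq_zero_of_isLieBracket_add [FiniteDimensional ℂ V] {μ : V →L[ℂ] V →L[ℂ] V}
    (hμ : IsLieBracket μ) (S : Submodule ℂ (V →L[ℂ] V →L[ℂ] V))
    (hS : ∀ φ ∈ S, jacobiDeriv μ φ = 0 → φ = 0) :
    ∀ᶠ φ in nhds (0 : V →L[ℂ] V →L[ℂ] V), φ ∈ S → IsLieBracket (μ + φ) → φ = 0 := by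
  obtain ⟨K, hK0, hK⟩ := exists_norm_le_mul_norm_of_injOn S (jacobiDeriv μ) hS
  obtain ⟨C, hC⟩ := exists_norm_cyclicSum_insertion_le (V := V)
  have hlim : Filter.Tendsto (fun φ : V →L[ℂ] V →L[ℂ] V => K * C * ‖φ‖) (nhds 0) (nhds 0) := by
    have : Continuous fun φ : V →L[ℂ] V →L[ℂ] V => K * C * ‖φ‖ := by fun_prop
    simpa using this.tendsto 0
  filter_upwards [hlim.eventually (gt_mem_nhds one_pos)] with φ hφ hφS hLie
  have hle : ‖φ‖ ≤ K * C * ‖φ‖ * ‖φ‖ := calc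
    ‖φ‖ ≤ K * ‖cyclicSum (insertion φ φ)‖ := by
      simpa [jacobiDeriv_eq_neg_of_isLieBracket_add hμ hLie] using hK φ hφS
    _ ≤ K * (C * ‖φ‖ * ‖φ‖) := mul_le_mul_of_nonneg_left (hC φ) hK0
    _ = K * C * ‖φ‖ * ‖φ‖ := by ring
  by_contra hne
  have := norm_pos_iff.mpr hne
  nlinarith

/-- The 2-coboundary of a linear map, with values in bilinear maps. -/
noncomputable def coboundary (μ : V →L[ℂ] V →L[ℂ] V) :
    (V →L[ℂ] V) →ₗ[ℂ] (V →L[ℂ] V →L[ℂ] V) where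
  toFun f := μ.comp f + (μ.flip.comp f).flip - (ContinuousLinearMap.compL ℂ V V V f).comp μ
  map_add' f g := by ext; simp; abel
  map_smul' c f := by ext; simp [smul_sub]

@[simp]
theorem coboundary_apply (μ : V →L[ℂ] V →L[ℂ] V) (f : V →L[ℂ] V) (x y : V) :
    coboundary μ f x y = μ (f x) y + μ x (f y) - f (μ x y) := rfl

theorem exp_neg_apply_exp [FiniteDimensional ℂ V] (f : V →L[ℂ] V) (x : V) :
    NormedSpace.exp (-f) (NormedSpace.exp f x) = x := by
  have : CompleteSpace V := FiniteDimensional.complete ℂ V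
  let : NormedAlgebra ℚ (V →L[ℂ] V) := NormedAlgebra.restrictScalars ℚ ℂ _
  have h := NormedSpace.exp_add_of_commute ((Commute.refl f).neg_left)
  rw [neg_add_cancel, NormedSpace.exp_zero] at h
  exact (DFunLike.congr_fun h x).symm

theorem exp_apply_exp_neg [FiniteDimensional ℂ V] (f : V →L[ℂ] V) (x : V) :
    NormedSpace.exp f (NormedSpace.exp (-f) x) = x := by
  simpa using exp_neg_apply_exp (-f) x

/-- Conjugating `μ + φ` by `exp f`, for `f` small and `φ` small in a subspace complementing the
coboundaries, yields a neighbourhood of `μ` in the space of bilinear maps. -/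
theorem map_conj_exp_nhds [FiniteDimensional ℂ V] (μ : V →L[ℂ] V →L[ℂ] V)
    (W : Submodule ℂ (V →L[ℂ] V →L[ℂ] V)) (hW : (coboundary μ).range ⊔ W = ⊤) :
    Filter.map (fun p : (V →L[ℂ] V) × W =>
      conj (NormedSpace.exp (-p.1)) (NormedSpace.exp p.1) (μ + p.2)) (nhds 0) = nhds μ := by
  have : CompleteSpace V := FiniteDimensional.complete ℂ V
  have : CompleteSpace W := FiniteDimensional.complete ℂ W
  have hexp : HasStrictFDerivAt (fun p : (V →L[ℂ] V) × W => NormedSpace.exp p.1)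
      (ContinuousLinearMap.fst ℂ (V →L[ℂ] V) W) 0 := by
    have h0 : HasStrictFDerivAt NormedSpace.exp (1 : (V →L[ℂ] V) →L[ℂ] (V →L[ℂ] V))
        (0 : (V →L[ℂ] V) × W).1 := hasStrictFDerivAt_exp_zero
    exact h0.comp (0 : (V →L[ℂ] V) × W) hasStrictFDerivAt_fst
  have hexpneg : HasStrictFDerivAt (fun p : (V →L[ℂ] V) × W => NormedSpace.exp (-p.1))
      (-ContinuousLinearMap.fst ℂ (V →L[ℂ] V) W) 0 := by
    have h0 : HasStrictFDerivAt NormedSpace.exp (1 : (V →L[ℂ] V) →L[ℂ] (V →L[ℂ] V))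
        (-(0 : (V →L[ℂ] V) × W).1) := by
      simpa using hasStrictFDerivAt_exp_zero (𝕂 := ℂ) (𝔸 := V →L[ℂ] V)
    exact h0.comp (0 : (V →L[ℂ] V) × W) hasStrictFDerivAt_fst.neg
  have hadd : HasStrictFDerivAt (fun p : (V →L[ℂ] V) × W => μ + (p.2 : V →L[ℂ] V →L[ℂ] V))
      (W.subtypeL.comp (ContinuousLinearMap.snd ℂ (V →L[ℂ] V) W)) 0 :=
    (W.subtypeL.hasStrictFDerivAt.comp (0 : (V →L[ℂ] V) × W) hasStrictFDerivAt_snd).const_add μ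
  have hF := (((ContinuousLinearMap.compL ℂ V V V).hasStrictFDerivAt.comp _ hexpneg).clm_comp
    ((ContinuousLinearMap.compL ℂ V V V).flip.hasStrictFDerivAt.comp _ hexp)).clm_comp
      (hadd.clm_comp hexp)
  have hmap := hF.map_nhds_eq_of_surj <| by
    rw [eq_top_iff, ← hW, sup_le_iff]
    constructor
    · rintro _ ⟨f, rfl⟩
      refine ⟨(f, 0), ?_⟩
      ext x y
      simp
      abel
    · intro w hw
      refine ⟨(0, ⟨w, hw⟩), ?_⟩
      ext x y
      simp
  have h0 : conj (NormedSpace.exp (-(0 : (V →L[ℂ] V) × W).1))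
      (NormedSpace.exp (0 : (V →L[ℂ] V) × W).1) (μ + (0 : (V →L[ℂ] V) × W).2) = μ := by
    ext x y
    simp
  exact hmap.trans (congrArg nhds h0)

theorem mem_transportOrbit_of_eq_conj {μ ν : V →L[ℂ] V →L[ℂ] V} {h g : V →L[ℂ] V}
    (hhg : ∀ x, h (g x) = x) (hgh : ∀ x, g (h x) = x) (hν : ν = conj h g μ) :
    ν ∈ transportOrbit μ :=
  ⟨ContinuousLinearEquiv.equivOfInverse g h hhg hgh, fun x y => by rw [hν]; rfl⟩

/-- If every cocycle is a coboundary, all Lie brackets close to `μ` lie in the orbit of `μ`. -/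
theorem eventually_mem_transportOrbit [FiniteDimensional ℂ V] {μ : V →L[ℂ] V →L[ℂ] V}
    (hμ : IsLieBracket μ)
    (hH2 : ∀ φ, IsAltBil φ → jacobiDeriv μ φ = 0 → φ ∈ (coboundary μ).range) :
    ∀ᶠ ν in nhds μ, IsLieBracket ν → ν ∈ transportOrbit μ := by
  obtain ⟨W, hW⟩ := (coboundary μ).range.exists_isCompl
  rw [← map_conj_exp_nhds μ W hW.sup_eq_top, Filter.eventually_map]
  have hzero := eventually_eq_zero_of_isLieBracket_add hμ (W ⊓ altSubmodule V) fun φ hφ hd =>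
    (Submodule.disjoint_def.mp hW.disjoint) φ (hH2 φ hφ.2 hd) hφ.1
  have hsnd : Filter.Tendsto (fun p : (V →L[ℂ] V) × W => (p.2 : V →L[ℂ] V →L[ℂ] V))
      (nhds 0) (nhds 0) :=
    (continuous_subtype_val.comp continuous_snd).tendsto' _ _ rfl
  filter_upwards [hsnd.eventually hzero] with p hp hLie
  have hadd : IsLieBracket (μ + (p.2 : V →L[ℂ] V →L[ℂ] V)) := by
    rw [← conj_conj (exp_apply_exp_neg p.1) (exp_apply_exp_neg p.1) (μ + _)]
    exact isLieBracket_conj (exp_neg_apply_exp p.1) hLie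
  have halt : IsAltBil (p.2 : V →L[ℂ] V →L[ℂ] V) := by
    have h := (altSubmodule V).sub_mem hadd.1 hμ.1
    rwa [add_sub_cancel_left] at h
  rw [hp ⟨p.2.2, halt⟩ hadd, add_zero]
  exact mem_transportOrbit_of_eq_conj (exp_neg_apply_exp p.1) (exp_apply_exp_neg p.1) rfl

/-- Nearness to any point of the orbit can be transported to nearness to `μ`. -/
theorem eventually_mem_transportOrbit_of_mem {μ ν : V →L[ℂ] V →L[ℂ] V}
    (hμ : ∀ᶠ ξ in nhds μ, IsLieBracket ξ → ξ ∈ transportOrbit μ) (hν : ν ∈ transportOrbit μ) :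
    ∀ᶠ ξ in nhds ν, IsLieBracket ξ → ξ ∈ transportOrbit μ := by
  obtain ⟨f, hf⟩ := hν
  have hνμ : conj (f : V →L[ℂ] V) (f.symm : V →L[ℂ] V) ν = μ := by
    ext x y
    simp [hf]
  have hlim := (continuous_conj (f : V →L[ℂ] V) (f.symm : V →L[ℂ] V)).tendsto ν
  rw [hνμ] at hlim
  filter_upwards [hlim.eventually hμ] with ξ hξ hLie
  obtain ⟨g, hg⟩ := hξ (isLieBracket_conj f.symm_apply_apply hLie)
  refine ⟨f.trans g, fun x y => ?_⟩
  simpa using congrArg f.symm (hg (f x) (f y))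

end AltBil

/-- (Nijenhuis–Richardson) If every 2-cocycle of a Lie bracket `μ` on a
finite-dimensional complex vector space is a 2-coboundary (i.e. `H²(μ,μ) = 0`),
then `μ` is rigid: its `GL(V)`-orbit is open in `Lie(V)`. -/
theorem nijenhuis_richardson
    (V : Type*) [NormedAddCommGroup V] [NormedSpace ℂ V] [FiniteDimensional ℂ V]
    (μ : V →L[ℂ] V →L[ℂ] V) (hLie : IsLieBracket μ)
    (hH2 : ∀ φ : V →L[ℂ] V →L[ℂ] V, IsAltBil φ →
      (∀ x y z : V,
        μ x (φ y z) + μ y (φ z x) + μ z (φ x y)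
          - φ (μ x y) z - φ (μ y z) x - φ (μ z x) y = 0) →
      ∃ f : V →L[ℂ] V, ∀ x y : V, φ x y = μ (f x) y + μ x (f y) - f (μ x y)) :
    IsOpen {ν : {ν : V →L[ℂ] V →L[ℂ] V // IsLieBracket ν} |
        (ν : V →L[ℂ] V →L[ℂ] V) ∈ transportOrbit μ} := by
  have hnear := AltBil.eventually_mem_transportOrbit hLie fun φ hφ hd => by
    obtain ⟨f, hf⟩ := hH2 φ hφ (AltBil.jacobiDeriv_cocycle hLie.1 hd)
    exact ⟨f, by ext x y; simp [hf]⟩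
  rw [isOpen_iff_mem_nhds]
  intro ν hν
  filter_upwards [continuous_subtype_val.continuousAt.eventually
    (AltBil.eventually_mem_transportOrbit_of_mem hnear hν)] with ξ hξ
  exact hξ ξ.2
end

section
/- Let μ be a rigid Lie bracket on a finite-dimensional complex vector space V. Then for every X ∈ V, the semisimple part and the nilpotent part of the Jordan–Chevalley decomposition of the endomorphism ad_μ X : Y ↦ μ(X,Y) are themselves inner derivations: there exist X_s, X_n ∈ V with (ad_μ X)_s = ad_μ X_s and (ad_μ X)_n = ad_μ X_n. In other words, the linear Lie algebra Ad_μ = {ad_μ X : X ∈ V} ⊆ gl(V) contains the semisimple and nilpotent Jordan parts of each of its elements. -/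
open Module Polynomial

universe u

section LinearAlgebra

variable {E F : Type*} [AddCommGroup E] [Module ℂ E] [AddCommGroup F] [Module ℂ F]

/-- A stable subspace of a semisimple endomorphism is the sum of the parts of it that lie in the
kernel and in the image. -/
theorem exists_eq_add_apply_of_isSemisimple [FiniteDimensional ℂ E] {T : End ℂ E}
    (hT : T.IsSemisimple) (Y : Submodule ℂ E) (hY : ∀ y ∈ Y, T y ∈ Y) {f : E} (hf : f ∈ Y) :
    ∃ a ∈ Y, ∃ b ∈ Y, T a = 0 ∧ f = a + T b := by
  have hr : End.IsSemisimple (T.restrict hY) := hT.restrict (p := Y) hY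
  set U := T.restrict hY with hU
  obtain ⟨C, hC, hcompl⟩ := End.isSemisimple_iff.mp hr (LinearMap.ker U) (by
    intro x hx
    simp only [LinearMap.mem_ker, Submodule.mem_comap] at hx ⊢
    rw [hx, map_zero])
  have hinj : Function.Injective (U.restrict hC) := by
    rw [← LinearMap.ker_eq_bot, LinearMap.ker_eq_bot']
    rintro ⟨x, hx⟩ h0
    have hk : x ∈ LinearMap.ker U := congrArg Subtype.val h0
    exact Subtype.ext ((Submodule.disjoint_def.mp hcompl.disjoint) x hk hx)
  have hsurj := LinearMap.injective_iff_surjective.mp hinj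
  obtain ⟨k, hk, c, hc, hkc⟩ := Submodule.mem_sup.mp
    (hcompl.sup_eq_top ▸ Submodule.mem_top : (⟨f, hf⟩ : Y) ∈ LinearMap.ker U ⊔ C)
  obtain ⟨⟨b, hb⟩, hbc⟩ := hsurj ⟨c, hc⟩
  have hbc' : U b = c := congrArg Subtype.val hbc
  refine ⟨k, k.2, b, b.2, ?_, ?_⟩
  · simpa [U, Subtype.ext_iff] using hk
  · have h1 : (k : E) + c = f := by simpa using congrArg Subtype.val hkc
    have h2 : T b = c := congrArg Subtype.val hbc'
    rw [h2, h1]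

/-- A semisimple endomorphism has the same kernel as its square. -/
theorem apply_eq_zero_of_isSemisimple [FiniteDimensional ℂ E] {T : End ℂ E}
    (hT : T.IsSemisimple) {x : E} (h : T (T x) = 0) : T x = 0 := by
  obtain ⟨a, -, b, hb, ha, hab⟩ := exists_eq_add_apply_of_isSemisimple hT (LinearMap.ker (T * T))
    (fun y hy => by
      simp only [LinearMap.mem_ker, End.mul_apply] at hy ⊢
      rw [hy, map_zero]) (f := x) (by simpa using h)
  rw [hab, map_add, ha, zero_add]
  simpa using hb

/-- The kernel of an endomorphism is killed by its semisimple part. -/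
theorem semisimple_part_apply_eq_zero [FiniteDimensional ℂ E] {S N : End ℂ E}
     (hS : S.IsSemisimple) (hN : IsNilpotent N)
    (hSN : Commute S N) {x : E} (h : S x + N x = 0) : S x = 0 := by
  obtain ⟨k, hk⟩ := hN
  have key : ∀ m : ℕ, (S ^ m) x = ((-N) ^ m) x := by
    intro m
    induction m with
    | zero => simp
    | succ m ih =>
      rw [pow_succ, End.mul_apply, eq_neg_of_add_eq_zero_left h, ← LinearMap.neg_apply,
        pow_succ', End.mul_apply, ← ih, ← End.mul_apply, ← End.mul_apply,
        (hSN.neg_right.pow_left m).eq]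
  have hk' : (S ^ k) x = 0 := by rw [key, neg_pow, hk]; simp
  clear key hk
  induction k with
  | zero => rw [show x = 0 by simpa using hk', map_zero]
  | succ k ih =>
    rcases Nat.eq_zero_or_pos k with rfl | hpos
    · simpa using hk'
    · apply ih
      obtain ⟨j, rfl⟩ := Nat.exists_eq_succ_of_ne_zero hpos.ne'
      rw [pow_succ', End.mul_apply]
      apply apply_eq_zero_of_isSemisimple hS
      rw [← hk', pow_succ', pow_succ', End.mul_apply, End.mul_apply]

theorem isSemisimple_compRight [FiniteDimensional ℂ F] {B : End ℂ F} (hB : B.IsSemisimple) :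
    End.IsSemisimple (LinearMap.compRight ℂ B : End ℂ (E →ₗ[ℂ] F)) := by
  refine End.isSemisimple_of_squarefree_aeval_eq_zero hB.minpoly_squarefree ?_
  have : ∀ p : ℂ[X], aeval (LinearMap.compRight ℂ B : End ℂ (E →ₗ[ℂ] F)) p =
      LinearMap.compRight ℂ (aeval B p) := by
    intro p
    induction p using Polynomial.induction_on' with
    | add p q hp hq => ext; simp [hp, hq]
    | monomial n a =>
      rw [aeval_monomial, aeval_monomial]
      have : ∀ n : ℕ, (LinearMap.compRight ℂ B : End ℂ (E →ₗ[ℂ] F)) ^ n =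
          LinearMap.compRight ℂ (B ^ n) := by
        intro n
        induction n with
        | zero => rfl
        | succ n ih => rw [pow_succ, ih, pow_succ]; rfl
      rw [this]
      ext; simp [End.mul_apply]
  rw [this, minpoly.aeval]
  ext; simp

theorem isSemisimple_lcomp [FiniteDimensional ℂ E] {A : End ℂ E} (hA : A.IsSemisimple) :
    End.IsSemisimple (LinearMap.lcomp ℂ F A : End ℂ (E →ₗ[ℂ] F)) := by
  refine End.isSemisimple_of_squarefree_aeval_eq_zero hA.minpoly_squarefree ?_
  have : ∀ p : ℂ[X], aeval (LinearMap.lcomp ℂ F A : End ℂ (E →ₗ[ℂ] F)) p =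
      LinearMap.lcomp ℂ F (aeval A p) := by
    intro p
    induction p using Polynomial.induction_on' with
    | add p q hp hq => ext; simp [hp, hq]
    | monomial n a =>
      rw [aeval_monomial, aeval_monomial]
      have : ∀ n : ℕ, (LinearMap.lcomp ℂ F A : End ℂ (E →ₗ[ℂ] F)) ^ n =
          LinearMap.lcomp ℂ F (A ^ n) := by
        intro n
        induction n with
        | zero => rfl
        | succ n ih => rw [pow_succ', ih, pow_succ]; rfl
      rw [this]
      ext; simp [End.mul_apply]
  rw [this, minpoly.aeval]
  ext; simp

/-- Jordan decompositions are natural: a map intertwining two endomorphisms intertwines their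
semisimple parts. -/
theorem semisimple_part_intertwines [FiniteDimensional ℂ E] [FiniteDimensional ℂ F]
    {SA NA : End ℂ E} {SB NB : End ℂ F}
    (hSA : SA.IsSemisimple) (hNA : IsNilpotent NA) (hA : Commute SA NA)
    (hSB : SB.IsSemisimple) (hNB : IsNilpotent NB) (hB : Commute SB NB)
    {f : E →ₗ[ℂ] F} (hf : ∀ x, f (SA x + NA x) = SB (f x) + NB (f x)) (x : E) :
    f (SA x) = SB (f x) := by
  set LSB : End ℂ (E →ₗ[ℂ] F) := LinearMap.compRight ℂ SB with hLSB
  set LNB : End ℂ (E →ₗ[ℂ] F) := LinearMap.compRight ℂ NB with hLNB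
  set RSA : End ℂ (E →ₗ[ℂ] F) := LinearMap.lcomp ℂ F SA with hRSA
  set RNA : End ℂ (E →ₗ[ℂ] F) := LinearMap.lcomp ℂ F NA with hRNA
  have c0 : ∀ (B : End ℂ F) (A : End ℂ E), Commute
      (LinearMap.compRight ℂ B : End ℂ (E →ₗ[ℂ] F)) (LinearMap.lcomp ℂ F A) := fun B A => by
    ext; simp [End.mul_apply]
  have c1 : Commute LSB LNB := by
    ext g y
    simpa [LSB, LNB, End.mul_apply] using LinearMap.congr_fun hB.eq (g y)
  have c2 : Commute RSA RNA := by
    ext g y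
    simpa [RSA, RNA, End.mul_apply] using congrArg g (LinearMap.congr_fun hA.eq y).symm
  have nB : IsNilpotent LNB := by
    obtain ⟨k, hk⟩ := hNB
    refine ⟨k, ?_⟩
    have : ∀ n : ℕ, LNB ^ n = LinearMap.compRight ℂ (NB ^ n) := by
      intro n
      induction n with
      | zero => rfl
      | succ n ih => rw [pow_succ, ih, pow_succ]; rfl
    rw [this, hk]; ext; simp
  have nA : IsNilpotent RNA := by
    obtain ⟨k, hk⟩ := hNA
    refine ⟨k, ?_⟩
    have : ∀ n : ℕ, RNA ^ n = LinearMap.lcomp ℂ F (NA ^ n) := by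
      intro n
      induction n with
      | zero => rfl
      | succ n ih => rw [pow_succ', ih, pow_succ]; rfl
    rw [this, hk]; ext; simp
  have hs : (LSB - RSA).IsSemisimple :=
    (isSemisimple_compRight hSB).sub_of_commute (c0 SB SA) (isSemisimple_lcomp hSA)
  have hn : IsNilpotent (LNB - RNA) := (c0 NB NA).isNilpotent_sub nB nA
  have hc : Commute (LSB - RSA) (LNB - RNA) :=
    (c1.sub_right (c0 SB NA)).sub_left ((c0 NB SA).symm.sub_right c2)
  have h0 := semisimple_part_apply_eq_zero hs hn hc (x := f) (by
    ext y
    have := hf y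
    rw [map_add] at this
    simp only [LSB, LNB, RSA, RNA, LinearMap.add_apply, LinearMap.sub_apply,
      LinearMap.compRight_apply, LinearMap.lcomp_apply', LinearMap.comp_apply,
      LinearMap.zero_apply]
    rw [sub_add_sub_comm, ← map_add, map_add, this, sub_self])
  have := LinearMap.congr_fun h0 x
  simp only [LSB, RSA, LinearMap.sub_apply, LinearMap.compRight_apply, LinearMap.lcomp_apply',
    LinearMap.comp_apply, LinearMap.zero_apply] at this
  exact (sub_eq_zero.mp this).symm

attribute [local instance] LieRing.ofAssociativeRing

/-- A map into endomorphisms that intertwines `A` with the commutator by `B` intertwines the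
semisimple part of `A` with the commutator by the semisimple part of `B`. -/
theorem semisimple_part_intertwines_commutator [FiniteDimensional ℂ E] [FiniteDimensional ℂ F]
    {SA NA : End ℂ E} {SB NB : End ℂ F}
    (hSA : SA.IsSemisimple) (hNA : IsNilpotent NA) (hA : Commute SA NA)
    (hSB : SB.IsSemisimple) (hNB : IsNilpotent NB) (hB : Commute SB NB)
    {f : E →ₗ[ℂ] End ℂ F}
    (hf : ∀ x, f (SA x + NA x) = (SB + NB) * f x - f x * (SB + NB)) (x : E) :
    f (SA x) = SB * f x - f x * SB := by
  have := semisimple_part_intertwines hSA hNA hA (LieAlgebra.ad_isSemisimple_of_isSemisimple hSB)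
    (LieAlgebra.ad_nilpotent_of_nilpotent (R := ℂ) hNB) (LieAlgebra.commute_ad_of_commute hB)
    (f := f) (fun x => by
      rw [hf, LieAlgebra.ad_apply, LieAlgebra.ad_apply, LieRing.of_associative_ring_bracket,
        LieRing.of_associative_ring_bracket]
      noncomm_ring) x
  rwa [LieAlgebra.ad_apply, LieRing.of_associative_ring_bracket] at this

end LinearAlgebra

section Nil

attribute [local instance] LieRing.ofAssociativeRing

variable {k : Type*} [LieRing k] [LieAlgebra ℂ k] {V : Type*} [AddCommGroup V] [Module ℂ V]
  [LieRingModule k V] [LieModule ℂ k V] [FiniteDimensional ℂ V]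

open LieModule in
/-- If an ideal `I` is solvable, then `⁅⊤, I⁆` does not act surjectively on a nonzero module. -/
theorem lie_top_solvable_ne_top [Nontrivial V]
    (I : LieIdeal ℂ k) [LieAlgebra.IsSolvable I] :
    ⁅⁅(⊤ : LieIdeal ℂ k), I⁆, (⊤ : LieSubmodule ℂ k V)⁆ ≠ ⊤ := by
  obtain ⟨M, hM, -⟩ := (eq_top_or_exists_le_coatom (⊥ : LieSubmodule ℂ k V)).resolve_left
    bot_ne_top
  suffices h : ⁅⁅(⊤ : LieIdeal ℂ k), I⁆, (⊤ : LieSubmodule ℂ k V)⁆ ≤ M from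
    fun h' => hM.1 (top_le_iff.mp (h' ▸ h))
  have hnt : Nontrivial (V ⧸ M) := by
    obtain ⟨v, -, hv⟩ := SetLike.exists_of_lt (hM.lt_top)
    exact nontrivial_of_ne (LieSubmodule.Quotient.mk' M v) 0
      (fun h => hv ((LieSubmodule.Quotient.mk_eq_zero _).mp h))
  obtain ⟨χ, hχ⟩ := exists_nontrivial_weightSpace_of_isSolvable ℂ I (V ⧸ M)
  set W := weightSpaceOfIsLieTower (L := k) ℂ (V ⧸ M) χ with hWdef
  have hWmem : ∀ v, v ∈ W ↔ v ∈ weightSpace (V ⧸ M) χ := fun v => Iff.rfl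
  have hW : W = ⊤ := by
    have hle : M ≤ W.comap (LieSubmodule.Quotient.mk' M) := fun m hm => by
      rw [LieSubmodule.mem_comap, (LieSubmodule.Quotient.mk_eq_zero _).mpr hm]
      exact zero_mem _
    rcases hM.le_iff.mp hle with h | h
    · rw [eq_top_iff]
      intro v _
      obtain ⟨w, rfl⟩ := LieSubmodule.Quotient.surjective_mk' M v
      exact LieSubmodule.mem_comap.mp (h ▸ LieSubmodule.mem_top _)
    · obtain ⟨⟨v, hv⟩, hv0⟩ := exists_ne (0 : weightSpace (V ⧸ M) χ)
      obtain ⟨w, rfl⟩ := LieSubmodule.Quotient.surjective_mk' M v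
      have hw : w ∈ M := by
        rw [← h]
        exact LieSubmodule.mem_comap.mpr hv
      exact absurd (Subtype.ext ((LieSubmodule.Quotient.mk_eq_zero _).mpr hw)) hv0
  have hact : ∀ (y : I) (v : V ⧸ M), ⁅y, v⁆ = χ y • v := fun y v =>
    (mem_weightSpace _ v).mp ((hWmem v).mp (hW ▸ LieSubmodule.mem_top _)) y
  have hχ0 : ∀ (x : k) (y : I), χ ⁅x, y⁆ = 0 := by
    intro x y
    have h1 : LinearMap.trace ℂ (V ⧸ M) (toEnd ℂ k (V ⧸ M) ⁅x, (y : k)⁆) = 0 := by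
      rw [LieHom.map_lie, LinearMap.trace_lie]
    have h2 : toEnd ℂ k (V ⧸ M) ⁅x, (y : k)⁆ = χ ⁅x, y⁆ • 1 :=
      LinearMap.ext fun v => hact ⁅x, y⁆ v
    rw [h2, map_smul, LinearMap.trace_one, smul_eq_mul, mul_eq_zero] at h1
    exact h1.resolve_right (Nat.cast_ne_zero.mpr Module.finrank_pos.ne')
  rw [LieSubmodule.lie_le_iff]
  intro x hx v _
  rw [← LieSubmodule.Quotient.mk_eq_zero, LieModuleHom.map_lie]
  have hle : ⁅(⊤ : LieIdeal ℂ k), I⁆ ≤ (toEnd ℂ k (V ⧸ M)).ker := by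
    rw [LieSubmodule.lie_le_iff]
    intro x _ y hy
    rw [LieHom.mem_ker]
    ext v
    exact (hact ⁅x, (⟨y, hy⟩ : I)⁆ v).trans (by rw [hχ0, zero_smul]; rfl)
  exact LinearMap.congr_fun ((toEnd ℂ k (V ⧸ M)).mem_ker.mp (hle hx)) _

/-- The iterated images of `⁅⊤, I⁆` for a solvable ideal `I` reach `0`. -/
theorem exists_lcs_eq_bot (I : LieIdeal ℂ k) [LieAlgebra.IsSolvable I] :
    ∃ G : ℕ → LieSubmodule ℂ k V, G 0 = ⊤ ∧ (∃ n, G n = ⊥) ∧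
      ∀ i, ∀ x ∈ ⁅(⊤ : LieIdeal ℂ k), I⁆, ∀ v ∈ G i, ⁅x, v⁆ ∈ G (i + 1) := by
  set J := ⁅(⊤ : LieIdeal ℂ k), I⁆ with hJ
  set G : ℕ → LieSubmodule ℂ k V := fun i => (fun U => ⁅J, U⁆)^[i] ⊤ with hG
  have hsucc : ∀ i, G (i + 1) = ⁅J, G i⁆ := fun i => Function.iterate_succ_apply' _ _ _
  refine ⟨G, rfl, ?_, fun i x hx v hv => hsucc i ▸ LieSubmodule.lie_mem_lie hx hv⟩
  have hanti : Antitone G := antitone_nat_of_succ_le fun i => by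
    rw [hsucc]; exact LieSubmodule.lie_le_right _ _
  have : WellFoundedLT (LieSubmodule ℂ k V) := LieSubmodule.wellFoundedLT_of_isArtinian ℂ k V
  obtain ⟨n, hn⟩ := WellFoundedGT.monotone_chain_condition
    (⟨G, hanti⟩ : ℕ →o (LieSubmodule ℂ k V)ᵒᵈ)
  refine ⟨n, ?_⟩
  by_contra hne
  have hstab : ⁅J, G n⁆ = G n := (hsucc n).symm.trans (hn (n + 1) (Nat.le_succ n)).symm
  have : Nontrivial (G n) := (LieSubmodule.nontrivial_iff_ne_bot ℂ k V).mpr hne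
  refine lie_top_solvable_ne_top (V := G n) I ?_
  have hinj : Function.Injective (LieSubmodule.map (G n).incl) :=
    LieSubmodule.map_injective_of_injective (G n).injective_incl
  apply hinj
  rw [LieSubmodule.map_bracket_eq, ← hJ]
  simpa using hstab

/-- A product of an element of `⁅⊤, I⁆`, for a solvable ideal `I`, and an endomorphism
preserving all submodules has trace zero. -/
theorem trace_mul_eq_zero_of_mem_lie_top_solvable (I : LieIdeal ℂ k) [LieAlgebra.IsSolvable I]
    {x : k} (hx : x ∈ ⁅(⊤ : LieIdeal ℂ k), I⁆) (u : End ℂ V)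
    (hu : ∀ U : LieSubmodule ℂ k V, ∀ v ∈ U, u v ∈ U) :
    LinearMap.trace ℂ V (u * LieModule.toEnd ℂ k V x) = 0 := by
  obtain ⟨G, h0, ⟨n, hn⟩, hG⟩ := exists_lcs_eq_bot (V := V) I
  refine (LinearMap.isNilpotent_trace_of_isNilpotent ⟨n, ?_⟩).eq_zero
  have key : ∀ i v, ((u * LieModule.toEnd ℂ k V x) ^ i) v ∈ G i := by
    intro i v
    induction i with
    | zero => rw [h0]; trivial
    | succ i ih =>
      rw [pow_succ', End.mul_apply, End.mul_apply]
      exact hu _ _ (hG _ _ hx _ ih)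
  ext v
  have := key n v
  rw [hn] at this
  simpa using this

/-- If `N` is nilpotent, preserves all submodules, and `⁅d, N⁆` acts as an element of `⁅⊤, I⁆` for
a solvable ideal `I`, then all `d ^ m * N` have trace zero. -/
theorem trace_pow_mul_eq_zero_of_commutator_mem (I : LieIdeal ℂ k) [LieAlgebra.IsSolvable I]
    {d x : k} (hx : x ∈ ⁅(⊤ : LieIdeal ℂ k), I⁆) (N : End ℂ V) (hN : IsNilpotent N)
    (hNU : ∀ U : LieSubmodule ℂ k V, ∀ v ∈ U, N v ∈ U)
    (hdN : ∀ v, ⁅d, N v⁆ - N ⁅d, v⁆ = ⁅x, v⁆) (m : ℕ) :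
    LinearMap.trace ℂ V (LieModule.toEnd ℂ k V d ^ m * N) = 0 := by
  obtain ⟨G, h0, ⟨n, hn⟩, hG⟩ := exists_lcs_eq_bot (V := V) I
  obtain ⟨l, hl⟩ := hN
  set D := LieModule.toEnd ℂ k V d with hD
  have hDN : ∀ v, D (N v) = N (D v) + ⁅x, v⁆ := fun v => by
    rw [← hdN v]; simp [D]
  have hDU : ∀ (U : LieSubmodule ℂ k V) (i : ℕ), ∀ v ∈ U, (D ^ i) v ∈ U := by
    intro U i v hv
    induction i with
    | zero => simpa using hv
    | succ i ih => rw [pow_succ', End.mul_apply]; exact U.lie_mem ih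
  have hNU' : ∀ (U : LieSubmodule ℂ k V) (i : ℕ), ∀ v ∈ U, (N ^ i) v ∈ U := by
    intro U i v hv
    induction i with
    | zero => simpa using hv
    | succ i ih => rw [pow_succ', End.mul_apply]; exact hNU _ _ ih
  have hcomm : ∀ i j v, v ∈ G i → (D ^ j) (N v) - N ((D ^ j) v) ∈ G (i + 1) := by
    intro i j v hv
    induction j with
    | zero => simp
    | succ j ih =>
      have e : (D ^ (j + 1)) (N v) - N ((D ^ (j + 1)) v) =
          D ((D ^ j) (N v) - N ((D ^ j) v)) + ⁅x, (D ^ j) v⁆ := by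
        rw [pow_succ', End.mul_apply, End.mul_apply, map_sub, hDN ((D ^ j) v)]; abel
      rw [e]
      exact add_mem ((G (i + 1)).lie_mem ih) (hG _ _ hx _ (hDU _ _ _ hv))
  have hcomm' : ∀ i j a v, v ∈ G i → (D ^ j) ((N ^ a) v) - (N ^ a) ((D ^ j) v) ∈ G (i + 1) := by
    intro i j a v hv
    induction a with
    | zero => simp
    | succ a ih =>
      have e : (D ^ j) ((N ^ (a + 1)) v) - (N ^ (a + 1)) ((D ^ j) v) =
          ((D ^ j) (N ((N ^ a) v)) - N ((D ^ j) ((N ^ a) v))) +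
          N ((D ^ j) ((N ^ a) v) - (N ^ a) ((D ^ j) v)) := by
        rw [pow_succ', End.mul_apply, End.mul_apply, map_sub]; abel
      rw [e]
      exact add_mem (hcomm _ _ _ (hNU' _ _ _ hv)) (hNU _ _ ih)
  have hpow : ∀ i a v, v ∈ G i →
      ((D ^ m * N) ^ a) v - (N ^ a) ((D ^ (m * a)) v) ∈ G (i + 1) := by
    intro i a v hv
    induction a with
    | zero => simp
    | succ a ih =>
      have e : ((D ^ m * N) ^ (a + 1)) v - (N ^ (a + 1)) ((D ^ (m * (a + 1))) v) =
          (D ^ m) (N (((D ^ m * N) ^ a) v - (N ^ a) ((D ^ (m * a)) v))) +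
          ((D ^ m) ((N ^ (a + 1)) ((D ^ (m * a)) v)) -
            (N ^ (a + 1)) ((D ^ m) ((D ^ (m * a)) v))) := by
        rw [pow_succ' (D ^ m * N), End.mul_apply, End.mul_apply, mul_add, mul_one, add_comm (m * a),
          pow_add D, End.mul_apply, map_sub, map_sub, pow_succ' N a, End.mul_apply, End.mul_apply]
        abel
      rw [e]
      exact add_mem (hDU _ _ _ (hNU _ _ ih)) (hcomm' _ _ _ _ (hDU _ _ _ hv))
  refine (LinearMap.isNilpotent_trace_of_isNilpotent ⟨l * n, ?_⟩).eq_zero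
  have key : ∀ i v, ((D ^ m * N) ^ (l * i)) v ∈ G i := by
    intro i v
    induction i with
    | zero => rw [h0]; trivial
    | succ i ih =>
      rw [mul_add, mul_one, add_comm (l * i), pow_add, End.mul_apply]
      simpa [hl] using hpow i l _ ih
  ext v
  have := key n v
  rw [hn] at this
  simpa using this

end Nil

section Derivations

attribute [local instance] LieRing.ofAssociativeRing

/-- An endomorphism of a Lie algebra satisfying the Leibniz rule. -/
def IsLieDer {g : Type*} [LieRing g] [LieAlgebra ℂ g] (D : End ℂ g) : Prop :=
  ∀ x y : g, D ⁅x, y⁆ = ⁅D x, y⁆ + ⁅x, D y⁆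

variable {g : Type*} [LieRing g] [LieAlgebra ℂ g]

theorem isLieDer_ad (x : g) : IsLieDer (LieAlgebra.ad ℂ g x) := fun y z =>
  leibniz_lie x y z

theorem IsLieDer.sub {D E : End ℂ g} (hD : IsLieDer D) (hE : IsLieDer E) : IsLieDer (D - E) :=
  fun x y => by
    simp only [LinearMap.sub_apply, hD x y, hE x y, sub_lie, lie_sub]; abel

theorem IsLieDer.commutator_ad {D : End ℂ g} (hD : IsLieDer D) (x : g) :
    D * LieAlgebra.ad ℂ g x - LieAlgebra.ad ℂ g x * D = LieAlgebra.ad ℂ g (D x) := by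
  ext y
  simp only [LinearMap.sub_apply, End.mul_apply, LieAlgebra.ad_apply, hD x y, add_sub_cancel_right]

variable (g) in
/-- The Lie algebra of all derivations, acting on `g`. -/
def derivationAlgebra : LieSubalgebra ℂ (End ℂ g) where
  carrier := {D | IsLieDer D}
  add_mem' {D E} hD hE x y := by
    simp only [LinearMap.add_apply, show D ⁅x, y⁆ = _ from hD x y, show E ⁅x, y⁆ = _ from hE x y,
      add_lie, lie_add]
    abel
  zero_mem' x y := by simp
  smul_mem' c D hD x y := by
    simp only [LinearMap.smul_apply, show D ⁅x, y⁆ = _ from hD x y, smul_add, smul_lie, lie_smul]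
  lie_mem' {D E} hD hE x y := by
    simp only [LieRing.of_associative_ring_bracket, LinearMap.sub_apply, End.mul_apply,
      show ∀ x y, D ⁅x, y⁆ = _ from hD, show ∀ x y, E ⁅x, y⁆ = _ from hE, map_add, sub_lie, lie_sub]
    abel

/-- The semisimple part of a derivation is a derivation. -/
theorem IsLieDer.semisimple_part [FiniteDimensional ℂ g] {S N : End ℂ g} (hS : S.IsSemisimple)
    (hN : IsNilpotent N) (hSN : Commute S N) (h : IsLieDer (S + N)) : IsLieDer S := by
  intro x y
  have := semisimple_part_intertwines_commutator hS hN hSN hS hN hSN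
    (f := (LieAlgebra.ad ℂ g : g →ₗ[ℂ] End ℂ g))
    (fun x => (h.commutator_ad x).symm) x
  have := LinearMap.congr_fun this y
  simp only [LieHom.coe_toLinearMap, LinearMap.sub_apply, End.mul_apply,
    LieAlgebra.ad_apply] at this
  rw [this]; abel

open LieAlgebra in
theorem killingForm_radical_lie_eq_zero [FiniteDimensional ℂ g] {x : g} (hx : x ∈ radical ℂ g)
    (y z : g) : killingForm ℂ g x ⁅y, z⁆ = 0 := by
  rw [← LieModule.traceForm_apply_lie_apply, LieModule.traceForm_comm]
  refine trace_mul_eq_zero_of_mem_lie_top_solvable (V := g) (radical ℂ g) (x := ⁅x, y⁆) ?_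
    (LieModule.toEnd ℂ g g z) (fun U v hv => U.lie_mem hv)
  rw [← lie_skew]
  exact neg_mem (LieSubmodule.lie_mem_lie (LieSubmodule.mem_top y) hx)

open LieAlgebra in
theorem mem_radical_of_killingForm_lie_eq_zero [FiniteDimensional ℂ g] {x : g}
    (hx : ∀ y z : g, killingForm ℂ g x ⁅y, z⁆ = 0) : x ∈ radical ℂ g := by
  let I : LieIdeal ℂ g :=
    { carrier := {x | ∀ y z : g, killingForm ℂ g x ⁅y, z⁆ = 0}
      add_mem' := fun {a b} ha hb y z => by
        rw [map_add, LinearMap.add_apply, ha, hb, add_zero]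
      zero_mem' := fun y z => by simp
      smul_mem' := fun c a ha y z => by rw [map_smul, LinearMap.smul_apply, ha, smul_zero]
      lie_mem := fun {w a} ha y z => by
        rw [← lie_skew, map_neg, LinearMap.neg_apply, LieModule.traceForm_apply_lie_apply]
        simpa using ha w ⁅y, z⁆ }
  have hI : IsSolvable I := by
    refine LieIdeal.isSolvable_of_killingForm_apply_lie_eq_zero I fun a ha y hy => ?_
    have hle : LieSubmodule.toSubmodule ⁅I, I⁆ ≤ LinearMap.ker (killingForm ℂ g a) := by
      rw [LieSubmodule.lieIdeal_oper_eq_linear_span', Submodule.span_le]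
      rintro _ ⟨y, -, z, -, rfl⟩
      exact ha y z
    exact hle hy
  exact (LieIdeal.solvable_iff_le_radical ℂ g I).mp hI (show x ∈ I from hx)

/-- The radical is stable under derivations. -/
theorem IsLieDer.map_radical [FiniteDimensional ℂ g] {D : End ℂ g} (hD : IsLieDer D) {x : g}
    (hx : x ∈ LieAlgebra.radical ℂ g) : D x ∈ LieAlgebra.radical ℂ g := by
  refine mem_radical_of_killingForm_lie_eq_zero fun y z => ?_
  have key : ∀ w, killingForm ℂ g (D x) w = - killingForm ℂ g x (D w) := by
    intro w
    have e : ∀ a b : g, killingForm ℂ g a b =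
        LinearMap.trace ℂ g (LieAlgebra.ad ℂ g a * LieAlgebra.ad ℂ g b) := fun a b => rfl
    rw [e, e, ← hD.commutator_ad x, ← hD.commutator_ad w, sub_mul, mul_sub, map_sub, map_sub,
      mul_assoc D, LinearMap.trace_mul_comm ℂ D]
    simp only [mul_assoc]
    ring
  rw [key, hD y z, map_add, killingForm_radical_lie_eq_zero hx, killingForm_radical_lie_eq_zero hx]
  simp

open LieAlgebra in
/-- The inner derivations by elements of the radical, as an ideal of all derivations. -/
def adRadical (g : Type*) [LieRing g] [LieAlgebra ℂ g] [FiniteDimensional ℂ g] :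
    LieIdeal ℂ (derivationAlgebra g) where
  carrier := {D | ∃ x ∈ radical ℂ g, (D : End ℂ g) = ad ℂ g x}
  add_mem' := by
    rintro D E ⟨x, hx, hD⟩ ⟨y, hy, hE⟩
    exact ⟨x + y, add_mem hx hy, by simp [hD, hE]⟩
  zero_mem' := ⟨0, zero_mem _, by simp⟩
  smul_mem' := by
    rintro c D ⟨x, hx, hD⟩
    exact ⟨c • x, (radical ℂ g).smul_mem c hx, by simp [hD]⟩
  lie_mem := by
    rintro D E ⟨x, hx, hE⟩
    refine ⟨(D : End ℂ g) x, IsLieDer.map_radical D.2 hx, ?_⟩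
    rw [LieSubalgebra.coe_bracket, hE, LieRing.of_associative_ring_bracket,
      IsLieDer.commutator_ad D.2]

open LieAlgebra in
instance [FiniteDimensional ℂ g] : IsSolvable (adRadical g) := by
  let f : radical ℂ g →ₗ⁅ℂ⁆ adRadical g :=
    { toFun := fun x => ⟨⟨ad ℂ g (x : g), isLieDer_ad _⟩, x, x.2, rfl⟩
      map_add' := fun x y => by ext; simp
      map_smul' := fun c x => by ext; simp
      map_lie' := fun {x y} => by
        ext z
        simp [LieRing.of_associative_ring_bracket] }
  have hf : Function.Surjective f := by
    rintro ⟨⟨D, hD⟩, x, hx, h⟩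
    exact ⟨⟨x, hx⟩, Subtype.ext (Subtype.ext h.symm)⟩
  exact hf.lieAlgebra_isSolvable

theorem ad_mem_lie_top_adRadical [FiniteDimensional ℂ g] {D : End ℂ g} (hD : IsLieDer D) {x : g}
    (hx : x ∈ LieAlgebra.radical ℂ g) :
    (⟨LieAlgebra.ad ℂ g (D x), isLieDer_ad _⟩ : derivationAlgebra g) ∈
      ⁅(⊤ : LieIdeal ℂ (derivationAlgebra g)), adRadical g⁆ := by
  have e : (⟨LieAlgebra.ad ℂ g (D x), isLieDer_ad _⟩ : derivationAlgebra g) =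
      ⁅(⟨D, hD⟩ : derivationAlgebra g),
        (⟨LieAlgebra.ad ℂ g x, isLieDer_ad _⟩ : derivationAlgebra g)⁆ := by
    apply Subtype.ext
    rw [LieSubalgebra.coe_bracket, LieRing.of_associative_ring_bracket]
    exact (hD.commutator_ad x).symm
  rw [e]
  exact LieSubmodule.lie_mem_lie (LieSubmodule.mem_top _) ⟨x, hx, rfl⟩

theorem trace_mul_ad_eq_zero [FiniteDimensional ℂ g] {D : End ℂ g} (hD : IsLieDer D) {x : g}
    (hx : x ∈ LieAlgebra.radical ℂ g) (u : End ℂ g)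
    (hu : ∀ U : Submodule ℂ g, (∀ E, IsLieDer E → ∀ v ∈ U, E v ∈ U) →
      ∀ v ∈ U, u v ∈ U) :
    LinearMap.trace ℂ g (u * LieAlgebra.ad ℂ g (D x)) = 0 :=
  trace_mul_eq_zero_of_mem_lie_top_solvable (V := g) (adRadical g)
    (ad_mem_lie_top_adRadical hD hx) u
    (fun U v hv => hu U (fun E hE _ hw => U.lie_mem (x := (⟨E, hE⟩ : derivationAlgebra g)) hw) v hv)

theorem trace_pow_mul_eq_zero_of_commutator_eq_ad [FiniteDimensional ℂ g] {D D' N : End ℂ g}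
    (hD : IsLieDer D) (hD' : IsLieDer D') {x : g} (hx : x ∈ LieAlgebra.radical ℂ g)
    (hN : IsLieDer N) (hN0 : IsNilpotent N)
    (h : D * N - N * D = LieAlgebra.ad ℂ g (D' x)) (m : ℕ) :
    LinearMap.trace ℂ g (D ^ m * N) = 0 :=
  trace_pow_mul_eq_zero_of_commutator_mem (V := g) (adRadical g) (d := ⟨D, hD⟩)
    (ad_mem_lie_top_adRadical hD' hx) N hN0
    (fun U _ hv => U.lie_mem (x := (⟨N, hN⟩ : derivationAlgebra g)) hv)
    (fun v => LinearMap.congr_fun h v) m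

end Derivations

section CompleteReducibility

attribute [local instance] LieRing.ofAssociativeRing

/-- A Lie algebra acting faithfully with zero trace form is solvable. -/
theorem isSolvable_of_traceForm_eq_zero {K M : Type*} [LieRing K] [LieAlgebra ℂ K]
    [FiniteDimensional ℂ K] [AddCommGroup M] [Module ℂ M] [FiniteDimensional ℂ M]
    [LieRingModule K M] [LieModule ℂ K M] (h : LieModule.traceForm ℂ K M = 0)
    (hf : ∀ x : K, LieModule.toEnd ℂ K M x = 0 → x = 0) : LieAlgebra.IsSolvable K := by
  have nilp : LieModule.IsNilpotent (LieAlgebra.derivedSeries ℂ K 1) M :=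
    LieModule.isNilpotent_derivedSeries_of_traceForm_eq_zero h
  set P := LieAlgebra.derivedSeries ℂ K 1 with hP
  have hnil : LieRing.IsNilpotent P := by
    rw [LieAlgebra.isNilpotent_iff_forall (R := ℂ)]
    intro x
    have hx := (LieModule.isNilpotent_iff_forall' (R := ℂ)).mp nilp x
    obtain ⟨n, hn⟩ := LieAlgebra.ad_nilpotent_of_nilpotent (R := ℂ) hx
    refine ⟨n, LinearMap.ext fun y => ?_⟩
    have key : ∀ k : ℕ, LieModule.toEnd ℂ K M ((LieAlgebra.ad ℂ P x ^ k) y : P) =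
        (LieAlgebra.ad ℂ (End ℂ M) (LieModule.toEnd ℂ P M x) ^ k)
          (LieModule.toEnd ℂ K M (y : K)) := by
      intro k
      induction k with
      | zero => simp
      | succ k ih =>
        rw [pow_succ', pow_succ', End.mul_apply, End.mul_apply, ← ih, LieAlgebra.ad_apply,
          LieAlgebra.ad_apply]
        exact LieHom.map_lie (LieModule.toEnd ℂ K M) (x : K) _
    have := key n
    rw [hn, LinearMap.zero_apply] at this
    exact Subtype.ext (hf _ this)
  obtain ⟨k, hk⟩ := LieAlgebra.IsSolvable.solvable ℂ P
  rw [LieIdeal.derivedSeries_eq_bot_iff] at hk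
  refine LieAlgebra.IsSolvable.mk (R := ℂ) (k := k + 1) ?_
  rw [LieAlgebra.derivedSeries_def, LieAlgebra.derivedSeriesOfIdeal_add]
  exact hk

variable {s M : Type*} [LieRing s] [LieAlgebra ℂ s] [FiniteDimensional ℂ s]
  [AddCommGroup M] [Module ℂ M] [LieRingModule s M] [LieModule ℂ s M]

/-- The trace form of a module is nondegenerate on an ideal acting faithfully. -/
theorem eq_zero_of_traceForm_eq_zero_of_faithful [FiniteDimensional ℂ M]
    [LieAlgebra.IsKilling ℂ s] (I : LieIdeal ℂ s)
    (hI : ∀ x ∈ I, LieModule.toEnd ℂ s M x = 0 → x = 0) {x : s} (hx : x ∈ I)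
    (h : ∀ y ∈ I, LieModule.traceForm ℂ s M x y = 0) : x = 0 := by
  let J : LieIdeal ℂ s := LieAlgebra.InvariantForm.orthogonal (LieModule.traceForm ℂ s M)
    (LieModule.traceForm_lieInvariant ℂ s M) I
  let K : LieIdeal ℂ s := I ⊓ J
  have hxK : x ∈ K := by
    refine (LieSubmodule.mem_inf _ _ _).2 ⟨hx, ?_⟩
    refine (LieAlgebra.InvariantForm.mem_orthogonal _ _ _ _).2 fun y hy => ?_
    rw [LieModule.traceForm_comm]; exact h y hy
  have : LieAlgebra.IsSolvable K := by
    refine isSolvable_of_traceForm_eq_zero (M := M) ?_ ?_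
    · ext ⟨a, ha⟩ ⟨b, hb⟩
      have ha := ((LieSubmodule.mem_inf _ _ _).1 ha)
      have hb := ((LieSubmodule.mem_inf _ _ _).1 hb)
      exact (LieAlgebra.InvariantForm.mem_orthogonal _ _ _ _).1 hb.2 a ha.1
    · rintro ⟨a, ha⟩ h0
      exact Subtype.ext (hI a ((LieSubmodule.mem_inf _ _ _).1 ha).1 h0)
  rw [LieAlgebra.LieIdeal.solvable_iff_le_radical,
    LieAlgebra.HasTrivialRadical.radical_eq_bot] at this
  simpa using this hxK

/-- The Casimir operator of a module attached to an ideal on which the trace form is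
nondegenerate. -/
theorem exists_casimir (I : LieIdeal ℂ s)
    (hI : ∀ x ∈ I, (∀ y ∈ I, LieModule.traceForm ℂ s M x y = 0) → x = 0) :
    ∃ Ω : End ℂ M, (∀ z : s, Commute (LieModule.toEnd ℂ s M z) Ω) ∧
      LinearMap.trace ℂ M Ω = finrank ℂ I ∧
      ∀ U : Submodule ℂ M, (∀ (z : s) (m : M), ⁅z, m⁆ ∈ U) → ∀ m, Ω m ∈ U := by
  classical
  set ρ := LieModule.toEnd ℂ s M
  let B : LinearMap.BilinForm ℂ I :=
    (LieModule.traceForm ℂ s M).restrict I.toSubmodule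
  have hBdef : ∀ a b : I, B a b = LieModule.traceForm ℂ s M a b := fun _ _ => rfl
  have hsymm : B.IsSymm := ⟨fun a b => LieModule.traceForm_comm ℂ s M _ _⟩
  have hB : B.Nondegenerate := by
    refine hsymm.isRefl.nondegenerate_iff_separatingLeft.2 ?_
    intro a ha
    exact Subtype.ext (hI a a.2 fun y hy => ha ⟨y, hy⟩)
  let e := Module.finBasis ℂ I
  let e' := B.dualBasis hB e
  have expand : ∀ a : I, a = ∑ j, B (e' j) a • e j := by
    intro a
    conv_lhs => rw [← e.sum_repr a]
    refine Finset.sum_congr rfl fun j _ => ?_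
    congr 1
    conv_rhs => rw [← e.sum_repr a]
    simp [e', LinearMap.BilinForm.apply_dualBasis_left, -Basis.sum_repr]
  have expand' : ∀ a : I, a = ∑ j, B a (e j) • e' j := by
    intro a
    conv_lhs => rw [← e'.sum_repr a]
    simp [e']
  have inv : ∀ (z : s) (a b : I), B ⁅z, a⁆ b = - B a ⁅z, b⁆ := by
    intro z a b
    simp only [hBdef, LieSubmodule.coe_bracket]
    exact LieModule.traceForm_apply_lie_apply' ℂ s M _ _ _
  have hρ : ∀ (z : s) (a : I), ρ z * ρ a = ρ a * ρ z + ρ ((⁅z, a⁆ : I) : s) := by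
    intro z a
    rw [LieSubmodule.coe_bracket, LieHom.map_lie, LieRing.of_associative_ring_bracket]; abel
  refine ⟨∑ i, ρ (e i : s) * ρ (e' i : s), fun z => ?_, ?_, ?_⟩
  · have h1 : ∑ i, ρ ((⁅z, e i⁆ : I) : s) * ρ (e' i : s) =
        ∑ i, ∑ j, B (e' j) ⁅z, e i⁆ • (ρ (e j : s) * ρ (e' i : s)) := by
      refine Finset.sum_congr rfl fun i _ => ?_
      conv_lhs => rw [expand ⁅z, e i⁆]
      simp [Finset.sum_mul]
    have h2 : ∑ i, ρ (e i : s) * ρ ((⁅z, e' i⁆ : I) : s) =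
        ∑ i, ∑ j, B ⁅z, e' i⁆ (e j) • (ρ (e i : s) * ρ (e' j : s)) := by
      refine Finset.sum_congr rfl fun i _ => ?_
      conv_lhs => rw [expand' ⁅z, e' i⁆]
      simp [Finset.mul_sum]
    have h3 : ∑ i, ρ ((⁅z, e i⁆ : I) : s) * ρ (e' i : s) +
        ∑ i, ρ (e i : s) * ρ ((⁅z, e' i⁆ : I) : s) = 0 := by
      rw [h1, h2, Finset.sum_comm, ← Finset.sum_add_distrib]
      refine Finset.sum_eq_zero fun i _ => ?_
      rw [← Finset.sum_add_distrib]
      refine Finset.sum_eq_zero fun j _ => ?_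
      rw [inv, ← add_smul]; simp
    rw [commute_iff_eq, Finset.mul_sum, Finset.sum_mul]
    have : ∀ i, ρ z * (ρ (e i : s) * ρ (e' i : s)) = ρ (e i : s) * ρ (e' i : s) * ρ z +
        (ρ ((⁅z, e i⁆ : I) : s) * ρ (e' i : s) + ρ (e i : s) * ρ ((⁅z, e' i⁆ : I) : s)) := by
      intro i
      rw [← mul_assoc, hρ, add_mul, mul_assoc, hρ, mul_add, mul_assoc]; abel
    rw [Finset.sum_congr rfl fun i _ => this i, Finset.sum_add_distrib, Finset.sum_add_distrib, h3,
      add_zero]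
  · rw [map_sum]
    have : ∀ i, LinearMap.trace ℂ M (ρ (e i : s) * ρ (e' i : s)) = 1 := by
      intro i
      change B (e i) (e' i) = 1
      simp [e', LinearMap.BilinForm.apply_dualBasis_right hB hsymm]
    simp [this]
  · intro U hU m
    rw [LinearMap.sum_apply]
    exact Submodule.sum_mem _ fun i _ => hU _ _


/-- Invariants lift along a quotient of codimension one (or more) on which a semisimple Lie algebra
acts trivially. -/
theorem exists_invariant_sub_mem {s : Type*} [LieRing s] [LieAlgebra ℂ s] [FiniteDimensional ℂ s]
    [LieAlgebra.IsKilling ℂ s] (n : ℕ) : ∀ (M : Type u) [AddCommGroup M] [Module ℂ M]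
    [FiniteDimensional ℂ M] [LieRingModule s M] [LieModule ℂ s M], finrank ℂ M = n →
    ∀ (M₀ : Submodule ℂ M), (∀ (x : s) (m : M), ⁅x, m⁆ ∈ M₀) → ∀ m₀ : M,
    ∃ m : M, (∀ x : s, ⁅x, m⁆ = 0) ∧ m₀ - m ∈ M₀ := by
  induction n using Nat.strong_induction_on with
  | _ n ih =>
  intro M _ _ _ _ _ hn M₀ hM m₀
  let I : LieIdeal ℂ s := (LieModule.toEnd ℂ s M).ker
  have hcompl := LieIdeal.isCompl_killingCompl I
  obtain ⟨Ω, hcomm, htr, hrange⟩ := exists_casimir (M := M) I.killingCompl fun x hx h =>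
    eq_zero_of_traceForm_eq_zero_of_faithful (M := M) I.killingCompl (fun x hx h0 => by
      have : x ∈ I ⊓ I.killingCompl :=
        (LieSubmodule.mem_inf _ _ _).2 ⟨LieHom.mem_ker.2 h0, hx⟩
      rw [hcompl.inf_eq_bot] at this
      simpa using this) hx h
  by_cases hbot : I.killingCompl = ⊥
  · refine ⟨m₀, fun x => ?_, by simp⟩
    have : x ∈ I := by
      have := hcompl.sup_eq_top
      rw [hbot, sup_bot_eq] at this
      rw [this]; trivial
    have := LieHom.mem_ker.1 this
    simpa using LinearMap.congr_fun this m₀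
  have hdim : finrank ℂ I.killingCompl ≠ 0 := by
    intro h
    apply hbot
    rw [← LieSubmodule.toSubmodule_eq_bot]
    exact Submodule.finrank_eq_zero.1 h
  obtain ⟨k, hk⟩ := Filter.eventually_atTop.1 (LinearMap.eventually_isCompl_ker_pow_range_pow Ω)
  have hc := hk (k + 1) (by omega)
  let K : LieSubmodule ℂ s M :=
    { LinearMap.ker (Ω ^ (k + 1)) with
      lie_mem := by
        intro x m hm
        change (Ω ^ (k + 1)) ⁅x, m⁆ = 0
        have hm : (Ω ^ (k + 1)) m = 0 := hm
        have := LinearMap.congr_fun ((hcomm x).pow_right (k + 1)).eq m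
        simp only [End.mul_apply, LieModule.toEnd_apply_apply, hm, lie_zero] at this
        exact this.symm }
  have hK : finrank ℂ K < n := by
    rw [← hn]
    refine Submodule.finrank_lt (s := K.toSubmodule) fun htop => hdim ?_
    have hnil : IsNilpotent Ω := ⟨k + 1, LinearMap.ker_eq_top.1 htop⟩
    have := (LinearMap.isNilpotent_trace_of_isNilpotent hnil).eq_zero
    rw [htr] at this
    exact_mod_cast this
  have hm₀ : m₀ ∈ LinearMap.ker (Ω ^ (k + 1)) ⊔ LinearMap.range (Ω ^ (k + 1)) := by
    rw [hc.sup_eq_top]; trivial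
  obtain ⟨a, ha, _, ⟨w, rfl⟩, rfl⟩ := Submodule.mem_sup.1 hm₀
  obtain ⟨m, hm, hm'⟩ := ih _ hK K rfl (M₀.comap K.toSubmodule.subtype)
    (fun x m => hM x m) ⟨a, ha⟩
  refine ⟨m, fun x => by simpa using congrArg Subtype.val (hm x), ?_⟩
  have h1 : a - m ∈ M₀ := hm'
  have h2 : (Ω ^ (k + 1)) w ∈ M₀ := by
    rw [pow_succ', End.mul_apply]; exact hrange _ hM _
  rw [add_sub_right_comm]
  exact add_mem h1 h2

/-- A relative version of `exists_invariant_sub_mem`, for a Lie algebra with a semisimple quotient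
whose kernel acts trivially modulo `P`. -/
theorem exists_lie_mem_and_sub_mem {g s : Type*} {E : Type u} [LieRing g] [LieAlgebra ℂ g]
    [LieRing s] [LieAlgebra ℂ s] [FiniteDimensional ℂ s] [LieAlgebra.IsKilling ℂ s]
    (π : g →ₗ⁅ℂ⁆ s) (hπ : Function.Surjective π)
    [AddCommGroup E] [Module ℂ E] [FiniteDimensional ℂ E] [LieRingModule g E] [LieModule ℂ g E]
    (P M₀ M : Submodule ℂ E) (hPM₀ : P ≤ M₀) (hM₀M : M₀ ≤ M)
    (hP : ∀ (x : g), ∀ m ∈ P, ⁅x, m⁆ ∈ P) (hM : ∀ (x : g), ∀ m ∈ M, ⁅x, m⁆ ∈ M₀)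
    (hker : ∀ x : g, π x = 0 → ∀ m ∈ M, ⁅x, m⁆ ∈ P) {m₀ : E} (hm₀ : m₀ ∈ M) :
    ∃ m ∈ M, m₀ - m ∈ M₀ ∧ ∀ x : g, ⁅x, m⁆ ∈ P := by
  let M' : LieSubmodule ℂ g E := { M with lie_mem := fun {x m} hm => hM₀M (hM x m hm) }
  let P' : LieSubmodule ℂ g M' :=
    { P.comap M.subtype with lie_mem := fun {x m} hm => hP x m hm }
  let Q := M' ⧸ P'
  obtain ⟨σ, hσ⟩ := (π : g →ₗ[ℂ] s).exists_rightInverse_of_surjective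
    (LinearMap.range_eq_top.2 hπ)
  have hσ' : ∀ x, π (σ x) = x := fun x => LinearMap.congr_fun hσ x
  have hQ : ∀ x : g, π x = 0 → LieModule.toEnd ℂ g Q x = 0 := by
    intro x hx
    ext q
    obtain ⟨m, rfl⟩ := LieSubmodule.Quotient.surjective_mk' P' q
    exact (LieSubmodule.Quotient.mk_eq_zero P').2 (hker x hx m m.2)
  let ψ : s →ₗ⁅ℂ⁆ End ℂ Q :=
    { (LieModule.toEnd ℂ g Q : g →ₗ[ℂ] End ℂ Q) ∘ₗ σ with
      map_lie' := by
        intro x y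
        have := hQ (σ ⁅x, y⁆ - ⁅σ x, σ y⁆) (by simp [hσ'])
        rw [map_sub, sub_eq_zero, LieHom.map_lie] at this
        exact this }
  let _ : LieRingModule s Q := LieRingModule.compLieHom Q ψ
  let _ : LieModule ℂ s Q := LieModule.compLieHom Q ψ
  have hact : ∀ (x : s) (m : M'), ⁅x, (LieSubmodule.Quotient.mk m : Q)⁆ =
      LieSubmodule.Quotient.mk ⁅σ x, m⁆ := fun _ _ => rfl
  obtain ⟨q, hq, hq'⟩ := exists_invariant_sub_mem (s := s) _ Q rfl
    ((M₀.comap M.subtype).map P'.toSubmodule.mkQ)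
    (fun x q => by
      obtain ⟨m, rfl⟩ := LieSubmodule.Quotient.surjective_mk' P' q
      exact ⟨⁅σ x, m⁆, hM _ _ m.2, rfl⟩)
    (LieSubmodule.Quotient.mk (⟨m₀, hm₀⟩ : M'))
  obtain ⟨m, rfl⟩ := LieSubmodule.Quotient.surjective_mk' P' q
  refine ⟨m, m.2, ?_, fun x => ?_⟩
  · obtain ⟨a, ha, hab⟩ := hq'
    have : (⟨m₀, hm₀⟩ : M') - m - a ∈ P'.toSubmodule := by
      rw [← Submodule.Quotient.mk_eq_zero]
      exact sub_eq_zero.2 hab.symm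
    have h2 : m₀ - m - a ∈ P := this
    have := add_mem (hPM₀ h2) ha
    simpa using this
  · have h1 : ⁅σ (π x), m⁆ ∈ P' := (LieSubmodule.Quotient.mk_eq_zero P').1 (hq (π x))
    have h2 : ⁅σ (π x), (m : E)⁆ ∈ P := h1
    have h3 := hker (x - σ (π x)) (by simp [hσ']) m m.2
    have := add_mem h2 h3
    simpa using this

end CompleteReducibility

section SemisimpleElements

attribute [local instance] LieRing.ofAssociativeRing

/-- A stable subspace of a module over a semisimple Lie algebra is the image of an equivariant
projection. -/
theorem exists_equivariant_projection {s : Type*} {V : Type u} [LieRing s] [LieAlgebra ℂ s]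
    [FiniteDimensional ℂ s] [LieAlgebra.IsKilling ℂ s] [AddCommGroup V] [Module ℂ V]
    [FiniteDimensional ℂ V] [LieRingModule s V] [LieModule ℂ s V] (U : Submodule ℂ V)
    (hU : ∀ (x : s), ∀ u ∈ U, ⁅x, u⁆ ∈ U) :
    ∃ f : End ℂ V, (∀ v, f v ∈ U) ∧ (∀ u ∈ U, f u = u) ∧
      ∀ x : s, Commute (LieModule.toEnd ℂ s V x) f := by
  let M : Submodule ℂ (V →ₗ[ℂ] V) :=
    { carrier := {f | (∀ v, f v ∈ U) ∧ ∃ c : ℂ, ∀ u ∈ U, f u = c • u}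
      add_mem' := by
        rintro f f' ⟨hf, c, hc⟩ ⟨hf', c', hc'⟩
        exact ⟨fun v => add_mem (hf v) (hf' v), c + c', fun u hu => by
          simp [hc u hu, hc' u hu, add_smul]⟩
      zero_mem' := ⟨fun v => by simp, 0, fun u hu => by simp⟩
      smul_mem' := by
        rintro a f ⟨hf, c, hc⟩
        exact ⟨fun v => U.smul_mem _ (hf v), a * c, fun u hu => by simp [hc u hu, mul_smul]⟩ }
  let M₀ : Submodule ℂ (V →ₗ[ℂ] V) :=
    { carrier := {f | (∀ v, f v ∈ U) ∧ ∀ u ∈ U, f u = 0}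
      add_mem' := by
        rintro f f' ⟨hf, hc⟩ ⟨hf', hc'⟩
        exact ⟨fun v => add_mem (hf v) (hf' v), fun u hu => by simp [hc u hu, hc' u hu]⟩
      zero_mem' := ⟨fun v => by simp, fun u hu => by simp⟩
      smul_mem' := by
        rintro a f ⟨hf, hc⟩
        exact ⟨fun v => U.smul_mem _ (hf v), fun u hu => by simp [hc u hu]⟩ }
  obtain ⟨p, hp⟩ := U.subtype.exists_leftInverse_of_injective U.ker_subtype
  have hp' : ∀ u (hu : u ∈ U), p u = ⟨u, hu⟩ := fun u hu => LinearMap.congr_fun hp ⟨u, hu⟩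
  obtain ⟨f, ⟨hfU, -⟩, ⟨-, hf⟩, hinv⟩ := exists_lie_mem_and_sub_mem (E := V →ₗ[ℂ] V)
    (LieHom.id : s →ₗ⁅ℂ⁆ s) Function.surjective_id ⊥ M₀ M bot_le
    (fun f hf => ⟨hf.1, 0, fun u hu => by simp [hf.2 u hu]⟩)
    (by intro x m hm; simp [(Submodule.mem_bot ℂ).1 hm])
    (by
      rintro x f ⟨hf, c, hc⟩
      refine ⟨fun v => ?_, fun u hu => ?_⟩
      · rw [LieHom.lie_apply]
        exact sub_mem (hU _ _ (hf _)) (hf _)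
      · rw [LieHom.lie_apply, hc u hu, hc _ (hU x u hu), lie_smul, sub_self])
    (by
      intro x hx m _
      have : x = 0 := hx
      simp [this])
    (m₀ := U.subtype ∘ₗ p) ⟨fun v => (p v).2, 1, fun u hu => by simp [hp' u hu]⟩
  refine ⟨f, hfU, fun u hu => ?_, fun x => ?_⟩
  · have := hf u hu
    simp only [LinearMap.sub_apply, LinearMap.comp_apply, hp' u hu, Submodule.subtype_apply] at this
    exact (sub_eq_zero.1 this).symm
  · have h0 : ⁅x, f⁆ = 0 := hinv x
    ext v
    have := LinearMap.congr_fun h0 v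
    rw [LieHom.lie_apply] at this
    exact sub_eq_zero.1 this

/-- In a representation of a semisimple Lie algebra, elements with semisimple adjoint action act
semisimply. -/
theorem isSemisimple_toEnd_of_isSemisimple_ad {s : Type*} {V : Type u} [LieRing s]
    [LieAlgebra ℂ s] [FiniteDimensional ℂ s] [LieAlgebra.IsKilling ℂ s] [AddCommGroup V]
    [Module ℂ V] [FiniteDimensional ℂ V] [LieRingModule s V] [LieModule ℂ s V] {σ : s}
    (hσ : (LieAlgebra.ad ℂ s σ).IsSemisimple) : (LieModule.toEnd ℂ s V σ).IsSemisimple := by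
  obtain ⟨n, hn, S, hS, hnil, hss, hsum⟩ :=
    (LieModule.toEnd ℂ s V σ).exists_isNilpotent_isSemisimple
  have hnS : Commute S n := Algebra.commute_of_mem_adjoin_singleton_of_commute hn
    (Algebra.commute_of_mem_adjoin_self hS).symm
  have hcomm : ∀ x, Commute (LieModule.toEnd ℂ s V x) n := by
    intro x
    have hσx : ∀ x, LieModule.toEnd ℂ s V ⁅σ, x⁆ = (S + n) * LieModule.toEnd ℂ s V x -
        LieModule.toEnd ℂ s V x * (S + n) := by
      intro x
      rw [LieHom.map_lie, LieRing.of_associative_ring_bracket, hsum, add_comm n S]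
    have := semisimple_part_intertwines_commutator hσ IsNilpotent.zero (Commute.zero_right _)
      hss hnil hnS (f := (LieModule.toEnd ℂ s V : s →ₗ[ℂ] End ℂ V))
      (by intro x; simpa using hσx x) x
    rw [LieAlgebra.ad_apply, LieHom.coe_toLinearMap, hσx x] at this
    have h2 : n * LieModule.toEnd ℂ s V x - LieModule.toEnd ℂ s V x * n = 0 := by
      rw [add_mul, mul_add] at this
      rw [← sub_eq_zero] at this
      rw [← this]; abel
    exact (sub_eq_zero.1 h2).symm
  suffices n = 0 by rw [hsum, this, zero_add]; exact hss
  by_contra hn0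
  obtain ⟨f, hfU, hf, hfc⟩ := exists_equivariant_projection (s := s) (LinearMap.ker n) (by
    intro x u hu
    have := LinearMap.congr_fun (hcomm x).eq u
    simp only [End.mul_apply, LieModule.toEnd_apply_apply, LinearMap.mem_ker.1 hu, lie_zero] at this
    exact this.symm)
  have hfn : Commute f n := by
    refine Algebra.commute_of_mem_adjoin_of_forall_mem_commute hn ?_
    rintro _ rfl
    exact (hfc σ).symm
  classical
  obtain ⟨k, hk, hk'⟩ : ∃ k, n ^ (k + 1) = 0 ∧ n ^ k ≠ 0 := by
    have h : ∃ k, n ^ k = 0 := hnil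
    have h1 := Nat.find_spec h
    have h2 : Nat.find h ≠ 0 := by
      intro h0
      rw [h0, pow_zero] at h1
      apply hn0
      rw [← one_mul n, h1, zero_mul]
    obtain ⟨k, hk⟩ := Nat.exists_eq_succ_of_ne_zero h2
    rw [hk] at h1
    exact ⟨k, h1, Nat.find_min h (by omega)⟩
  cases k with
  | zero => exact hn0 (by simpa using hk)
  | succ k =>
    apply hk'
    ext v
    have h1 : (n ^ (k + 1)) v ∈ LinearMap.ker n := by
      rw [LinearMap.mem_ker, ← End.mul_apply, ← pow_succ', hk, LinearMap.zero_apply]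
    have h2 := LinearMap.congr_fun (hfn.pow_right (k + 1)).eq v
    rw [End.mul_apply, End.mul_apply, hf _ h1] at h2
    rw [h2, pow_succ, End.mul_apply, LinearMap.mem_ker.1 (hfU v), map_zero, LinearMap.zero_apply]

end SemisimpleElements

section Levi

attribute [local instance] LieRing.ofAssociativeRing

variable {g : Type u} [LieRing g] [LieAlgebra ℂ g]

theorem IsLieDer.apply_mem_lie {S : End ℂ g} (hS : IsLieDer S) {I : LieIdeal ℂ g}
    (hI : ∀ x ∈ I, S x ∈ I) {x : g} (hx : x ∈ ⁅I, I⁆) : S x ∈ ⁅I, I⁆ := by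
  rw [← LieSubmodule.mem_toSubmodule, LieSubmodule.lieIdeal_oper_eq_linear_span'] at hx
  refine Submodule.span_induction ?_ (by simp) (fun a b _ _ ha hb => ?_) (fun c a _ ha => ?_) hx
  · rintro _ ⟨a, ha, b, hb, rfl⟩
    rw [hS a b]
    exact add_mem (LieSubmodule.lie_mem_lie (hI a ha) hb) (LieSubmodule.lie_mem_lie ha (hI b hb))
  · rw [map_add]; exact add_mem ha hb
  · rw [map_smul]; exact Submodule.smul_mem (⁅I, I⁆ : LieIdeal ℂ g).toSubmodule _ ha

theorem LieIdeal.lie_self_ne_of_isSolvable {I : LieIdeal ℂ g} [LieAlgebra.IsSolvable I]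
    (hI : I ≠ ⊥) : ⁅I, I⁆ ≠ I := by
  intro h
  obtain ⟨k, hk⟩ := LieAlgebra.IsSolvable.solvable ℂ I
  rw [LieIdeal.derivedSeries_eq_bot_iff] at hk
  have : ∀ k, LieAlgebra.derivedSeriesOfIdeal ℂ g k I = I := by
    intro k
    induction k with
    | zero => rfl
    | succ k ih => rw [LieAlgebra.derivedSeriesOfIdeal_succ, ih, h]
  exact hI (this k ▸ hk)

variable [FiniteDimensional ℂ g]

/-- An endomorphism commuting with a given semisimple derivation, which is a projection onto the
kernel of a map to a semisimple Lie algebra and is a `1`-coboundary, modulo the derived ideal. -/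
theorem exists_commuting_cocycle_projection {s : Type*} [LieRing s] [LieAlgebra ℂ s]
    [FiniteDimensional ℂ s] [LieAlgebra.IsKilling ℂ s] (π : g →ₗ⁅ℂ⁆ s)
    (hπ : Function.Surjective π) {S : End ℂ g} (hSder : IsLieDer S) (hSss : S.IsSemisimple)
    (hSR : ∀ x ∈ π.ker, S x ∈ π.ker) :
    ∃ f : g →ₗ[ℂ] g, (∀ x, f (S x) = S (f x)) ∧ (∀ x, f x ∈ π.ker) ∧
      (∀ r ∈ π.ker, f r - r ∈ ⁅π.ker, π.ker⁆) ∧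
      ∀ x : g, ∃ r ∈ π.ker, ∀ y, ⁅x, f⁆ y - ⁅r, y⁆ ∈ ⁅π.ker, π.ker⁆ := by
  set R := π.ker with hR
  have hR'R : ⁅R, R⁆ ≤ R := LieSubmodule.lie_le_left R R
  have hSR' : ∀ x ∈ ⁅R, R⁆, S x ∈ ⁅R, R⁆ := fun x hx => hSder.apply_mem_lie hSR hx
  have hRl : ∀ r ∈ R, ∀ y : g, ⁅r, y⁆ ∈ R := fun r hr y => lie_mem_left ℂ g R r y hr
  have hR'l : ∀ r ∈ ⁅R, R⁆, ∀ y : g, ⁅y, r⁆ ∈ ⁅R, R⁆ := fun r hr y => LieSubmodule.lie_mem _ hr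
  have hR's : ∀ (a : ℂ), ∀ x ∈ ⁅R, R⁆, a • x ∈ ⁅R, R⁆ := fun a x hx =>
    Submodule.smul_mem (⁅R, R⁆ : LieIdeal ℂ g).toSubmodule a hx
  have hRr : ∀ r ∈ R, ∀ y : g, ⁅y, r⁆ ∈ R := fun r hr y => LieSubmodule.lie_mem _ hr
  let M : Submodule ℂ (g →ₗ[ℂ] g) :=
    { carrier := {f | (∀ v, f v ∈ R) ∧ ∃ c : ℂ, ∀ r ∈ R, f r - c • r ∈ ⁅R, R⁆}
      add_mem' := by
        rintro f f' ⟨hf, c, hc⟩ ⟨hf', c', hc'⟩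
        refine ⟨fun v => add_mem (hf v) (hf' v), c + c', fun u hu => ?_⟩
        convert add_mem (hc u hu) (hc' u hu) using 1
        simp only [LinearMap.add_apply, add_smul]; abel
      zero_mem' := ⟨fun v => by simp, 0, fun u hu => by simp⟩
      smul_mem' := by
        rintro a f ⟨hf, c, hc⟩
        refine ⟨fun v => R.toSubmodule.smul_mem _ (hf v), a * c, fun u hu => ?_⟩
        convert hR's a _ (hc u hu) using 1
        simp only [LinearMap.smul_apply, mul_smul, smul_sub] }
  let M₀ : Submodule ℂ (g →ₗ[ℂ] g) :=
    { carrier := {f | (∀ v, f v ∈ R) ∧ ∀ r ∈ R, f r ∈ ⁅R, R⁆}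
      add_mem' := by
        rintro f f' ⟨hf, hc⟩ ⟨hf', hc'⟩
        exact ⟨fun v => add_mem (hf v) (hf' v), fun u hu => add_mem (hc u hu) (hc' u hu)⟩
      zero_mem' := ⟨fun v => by simp, fun u hu => by simp⟩
      smul_mem' := by
        rintro a f ⟨hf, hc⟩
        exact ⟨fun v => R.toSubmodule.smul_mem _ (hf v), fun u hu => hR's a _ (hc u hu)⟩ }
  let P : Submodule ℂ (g →ₗ[ℂ] g) :=
    { carrier := {f | ∃ r ∈ R, ∀ y, f y - ⁅r, y⁆ ∈ ⁅R, R⁆}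
      add_mem' := by
        rintro f f' ⟨r, hr, hc⟩ ⟨r', hr', hc'⟩
        refine ⟨r + r', add_mem hr hr', fun u => ?_⟩
        convert add_mem (hc u) (hc' u) using 1
        simp only [LinearMap.add_apply, add_lie]; abel
      zero_mem' := ⟨0, R.zero_mem, fun u => by simp⟩
      smul_mem' := by
        rintro a f ⟨r, hr, hc⟩
        refine ⟨a • r, R.toSubmodule.smul_mem _ hr, fun u => ?_⟩
        convert hR's a _ (hc u) using 1
        simp only [LinearMap.smul_apply, smul_lie, smul_sub] }
  have hPM₀ : P ≤ M₀ := by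
    rintro f ⟨r, hr, hf⟩
    refine ⟨fun v => ?_, fun u hu => ?_⟩
    · have := add_mem (hR'R (hf v)) (hRl r hr v)
      simpa using this
    · have := add_mem (hf u) (LieSubmodule.lie_mem_lie hr hu)
      simpa using this
  have hM₀M : M₀ ≤ M := by
    rintro f ⟨h1, h2⟩
    exact ⟨h1, 0, fun u hu => by simpa using h2 u hu⟩
  obtain ⟨p, hp⟩ := R.toSubmodule.subtype.exists_leftInverse_of_injective R.toSubmodule.ker_subtype
  have hp' : ∀ u (hu : u ∈ R), p u = ⟨u, hu⟩ := fun u hu => LinearMap.congr_fun hp ⟨u, hu⟩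
  obtain ⟨f₁, hf₁M, hf₁, hf₁P⟩ := exists_lie_mem_and_sub_mem (E := g →ₗ[ℂ] g) π hπ P M₀ M hPM₀ hM₀M
    (by
      rintro x f ⟨r, hr, hf⟩
      refine ⟨⁅x, r⁆, hRr r hr x, fun y => ?_⟩
      convert sub_mem (hR'l _ (hf y) x) (hf ⁅x, y⁆) using 1
      rw [LieHom.lie_apply, lie_sub, leibniz_lie x r y]; abel)
    (by
      rintro x f ⟨hf, c, hc⟩
      refine ⟨fun v => ?_, fun r hr => ?_⟩
      · rw [LieHom.lie_apply]
        exact sub_mem (hRr _ (hf v) x) (hf _)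
      · convert sub_mem (hR'l _ (hc r hr) x) (hc _ (hRr r hr x)) using 1
        rw [LieHom.lie_apply, lie_sub, lie_smul]; abel)
    (by
      rintro x hx f ⟨hf, c, hc⟩
      have hx : x ∈ R := hx
      refine ⟨-c • x, R.toSubmodule.smul_mem _ hx, fun y => ?_⟩
      convert sub_mem (LieSubmodule.lie_mem_lie hx (hf y)) (hc _ (hRl x hx y)) using 1
      rw [LieHom.lie_apply, smul_lie, neg_smul]; abel)
    (m₀ := R.toSubmodule.subtype ∘ₗ p) ⟨fun v => (p v).2, 1, fun u hu => by simp [hp' u hu]⟩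
  have hf₁1 : ∀ r ∈ R, f₁ r - r ∈ ⁅R, R⁆ := by
    intro r hr
    have := neg_mem (hf₁.2 r hr)
    simpa [hp' r hr] using this
  let Y : Submodule ℂ (g →ₗ[ℂ] g) :=
    { carrier := {f | f ∈ M ∧ ∀ x : g, ⁅x, f⁆ ∈ P}
      add_mem' := fun {f f'} hf hf' => ⟨add_mem hf.1 hf'.1, fun x => by
        rw [lie_add]; exact add_mem (hf.2 x) (hf'.2 x)⟩
      zero_mem' := ⟨zero_mem _, fun x => by rw [lie_zero]; exact zero_mem _⟩
      smul_mem' := fun c f hf => ⟨Submodule.smul_mem _ _ hf.1, fun x => by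
        rw [lie_smul]; exact Submodule.smul_mem _ _ (hf.2 x)⟩ }
  have hT : ∀ (f : End ℂ g) x, LieAlgebra.ad ℂ (End ℂ g) S f x = S (f x) - f (S x) := by
    intro f x
    rw [LieAlgebra.ad_apply, LieRing.of_associative_ring_bracket]; rfl
  have hTM : ∀ f ∈ M, LieAlgebra.ad ℂ (End ℂ g) S f ∈ M₀ := by
    rintro f ⟨hf, c, hc⟩
    refine ⟨fun v => ?_, fun r hr => ?_⟩
    · rw [hT]; exact sub_mem (hSR _ (hf v)) (hf _)
    · convert sub_mem (hSR' _ (hc r hr)) (hc _ (hSR r hr)) using 1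
      rw [hT, map_sub, map_smul]; abel
  have hTP : ∀ f ∈ P, LieAlgebra.ad ℂ (End ℂ g) S f ∈ P := by
    rintro f ⟨r, hr, hf⟩
    refine ⟨S r, hSR r hr, fun y => ?_⟩
    convert sub_mem (hSR' _ (hf y)) (hf (S y)) using 1
    rw [hT, map_sub, hSder]; abel
  have hTY : ∀ f ∈ Y, LieAlgebra.ad ℂ (End ℂ g) S f ∈ Y := by
    rintro f ⟨hf, hf'⟩
    refine ⟨hM₀M (hTM f hf), fun x => ?_⟩
    convert sub_mem (hTP _ (hf' x)) (hf' (S x)) using 1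
    ext y
    rw [LieHom.lie_apply, LinearMap.sub_apply, hT, hT, hT, LieHom.lie_apply, LieHom.lie_apply,
      LieHom.lie_apply, map_sub, hSder, hSder, lie_sub, map_add]
    abel
  obtain ⟨a, ha, b, hb, ha0, hab⟩ := exists_eq_add_apply_of_isSemisimple
    (LieAlgebra.ad_isSemisimple_of_isSemisimple hSss) Y hTY (f := f₁) ⟨hf₁M, hf₁P⟩
  refine ⟨a, fun x => ?_, ha.1.1, fun r hr => ?_, fun x => ha.2 x⟩
  · have := hT a x
    rw [ha0] at this
    exact (sub_eq_zero.1 this.symm).symm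
  · have h1 := hf₁1 r hr
    have h2 := (hTM b hb.1).2 r hr
    rw [hab] at h1
    convert sub_mem h1 h2 using 1
    simp only [LinearMap.add_apply]; abel

/-- If the kernel of a map to a semisimple Lie algebra is solvable and nonzero, then there is a
proper subalgebra, stable under a given semisimple derivation, which still surjects. -/
theorem exists_proper_stable_subalgebra {s : Type*} [LieRing s] [LieAlgebra ℂ s]
    [FiniteDimensional ℂ s] [LieAlgebra.IsKilling ℂ s] (π : g →ₗ⁅ℂ⁆ s)
    (hπ : Function.Surjective π) [LieAlgebra.IsSolvable π.ker] (hker : π.ker ≠ ⊥)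
    {S : End ℂ g} (hSder : IsLieDer S) (hSss : S.IsSemisimple)
    (hSR : ∀ x ∈ π.ker, S x ∈ π.ker) :
    ∃ k : LieSubalgebra ℂ g, k ≠ ⊤ ∧ (∀ x ∈ k, S x ∈ k) ∧ ∀ x, ∃ y ∈ k, π y = π x := by
  obtain ⟨f, hfS, hfR, hf1, hf⟩ := exists_commuting_cocycle_projection π hπ hSder hSss hSR
  set R := π.ker with hR
  have hSR' : ∀ x ∈ ⁅R, R⁆, S x ∈ ⁅R, R⁆ := fun x hx => hSder.apply_mem_lie hSR hx
  have hR's : ∀ (a : ℂ), ∀ x ∈ ⁅R, R⁆, a • x ∈ ⁅R, R⁆ := fun a x hx =>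
    Submodule.smul_mem (⁅R, R⁆ : LieIdeal ℂ g).toSubmodule a hx
  have hR'l : ∀ r ∈ ⁅R, R⁆, ∀ y : g, ⁅y, r⁆ ∈ ⁅R, R⁆ := fun r hr y => LieSubmodule.lie_mem _ hr
  have hR'R : ⁅R, R⁆ ≤ R := LieSubmodule.lie_le_left R R
  let k : LieSubalgebra ℂ g :=
    { carrier := {x | ∀ y, ⁅x, f⁆ y ∈ ⁅R, R⁆}
      add_mem' := fun {a b} ha hb y => by
        rw [add_lie]; exact add_mem (ha y) (hb y)
      zero_mem' := fun y => by simp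
      smul_mem' := fun c a ha y => by
        rw [smul_lie]; exact hR's c _ (ha y)
      lie_mem' := fun {a b} ha hb y => by
        have ha : ∀ y, ⁅a, f⁆ y ∈ ⁅R, R⁆ := ha
        have hb : ∀ y, ⁅b, f⁆ y ∈ ⁅R, R⁆ := hb
        rw [lie_lie, LinearMap.sub_apply, LieHom.lie_apply, LieHom.lie_apply]
        exact sub_mem (sub_mem (hR'l _ (hb y) a) (hb _)) (sub_mem (hR'l _ (ha y) b) (ha _)) }
  by_cases hk : k = ⊤
  · have hk' : ∀ x y : g, ⁅x, f y⁆ - f ⁅x, y⁆ ∈ ⁅R, R⁆ := by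
      intro x y
      have : x ∈ k := by rw [hk]; trivial
      exact this y
    refine ⟨{ carrier := {x | f x ∈ ⁅R, R⁆}
              add_mem' := fun {a b} ha hb => by
                change f (a + b) ∈ ⁅R, R⁆
                rw [map_add]; exact add_mem ha hb
              zero_mem' := by simp
              smul_mem' := fun c a ha => by
                change f (c • a) ∈ ⁅R, R⁆
                rw [map_smul]; exact hR's c _ ha
              lie_mem' := fun {a b} _ hb => by
                have := sub_mem (hR'l _ hb a) (hk' a b)
                simpa using this }, ?_, fun x hx => ?_, fun x => ⟨x - f x, ?_, ?_⟩⟩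
    · intro htop
      refine LieIdeal.lie_self_ne_of_isSolvable hker (le_antisymm hR'R fun r hr => ?_)
      have h1 : f r ∈ ⁅R, R⁆ := by
        have : r ∈ (⊤ : LieSubalgebra ℂ g) := trivial
        rw [← htop] at this
        exact this
      have := sub_mem h1 (hf1 r hr)
      simpa using this
    · change f (S x) ∈ ⁅R, R⁆
      rw [hfS]; exact hSR' _ hx
    · change f (x - f x) ∈ ⁅R, R⁆
      have := neg_mem (hf1 _ (hfR x))
      simpa using this
    · have : π (f x) = 0 := LieHom.mem_ker.1 (hfR x)
      rw [map_sub, this, sub_zero]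
  · refine ⟨k, hk, fun x hx y => ?_, fun x => ?_⟩
    · have hx : ∀ y, ⁅x, f⁆ y ∈ ⁅R, R⁆ := hx
      convert sub_mem (hSR' _ (hx y)) (hx (S y)) using 1
      rw [LieHom.lie_apply, LieHom.lie_apply, LieHom.lie_apply, map_sub, hSder x (f y), ← hfS,
        ← hfS, hSder x y, map_add]
      abel
    · obtain ⟨r, hr, hxr⟩ := hf x
      have hπr : π r = 0 := LieHom.mem_ker.1 hr
      refine ⟨x + r, fun y => ?_, by rw [map_add, hπr, add_zero]⟩
      have h1 := hf1 ⁅r, y⁆ (lie_mem_left ℂ g R r y hr)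
      have h2 := LieSubmodule.lie_mem_lie hr (hfR y)
      convert add_mem (sub_mem (hxr y) h1) h2 using 1
      have h3 : ⁅r, f⁆ y = ⁅r, f y⁆ - f ⁅r, y⁆ := rfl
      rw [add_lie, LinearMap.add_apply, h3]
      abel

/-- A Levi subalgebra stable under a given semisimple derivation. -/
theorem exists_stable_levi {s : Type*} [LieRing s] [LieAlgebra ℂ s]
    [FiniteDimensional ℂ s] [LieAlgebra.IsKilling ℂ s] (n : ℕ) :
    ∀ (g : Type u) [LieRing g] [LieAlgebra ℂ g] [FiniteDimensional ℂ g], finrank ℂ g = n →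
    ∀ (π : g →ₗ⁅ℂ⁆ s) (_ : Function.Surjective π) (_ : LieAlgebra.IsSolvable π.ker)
      {S : End ℂ g} (_ : IsLieDer S) (_ : S.IsSemisimple) (_ : ∀ x ∈ π.ker, S x ∈ π.ker),
    ∃ b : LieSubalgebra ℂ g, (∀ x ∈ b, S x ∈ b) ∧ (∀ x ∈ b, π x = 0 → x = 0) ∧
      ∀ x, ∃ y ∈ b, π y = π x := by
  induction n using Nat.strong_induction_on with
  | _ n ih =>
  intro g _ _ _ hn π hπ hsolv S hSder hSss hSR
  by_cases hker : π.ker = ⊥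
  · refine ⟨⊤, fun _ _ => trivial, fun x _ hx => ?_, fun x => ⟨x, trivial, rfl⟩⟩
    have : x ∈ π.ker := LieHom.mem_ker.2 hx
    rw [hker] at this
    simpa using this
  obtain ⟨k, hk, hkS, hkπ⟩ := exists_proper_stable_subalgebra π hπ hker hSder hSss hSR
  have hlt : finrank ℂ k < n := by
    rw [← hn]
    refine Submodule.finrank_lt (s := k.toSubmodule) fun h => hk ?_
    rwa [← LieSubalgebra.toSubmodule_eq_top]
  let π' : k →ₗ⁅ℂ⁆ s := π.comp k.incl
  let ι : π'.ker →ₗ⁅ℂ⁆ π.ker :=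
    { toFun := fun x => ⟨x.1.1, LieHom.mem_ker.2 (LieHom.mem_ker.1 x.2)⟩
      map_add' := fun _ _ => rfl
      map_smul' := fun _ _ => rfl
      map_lie' := rfl }
  have hsolv' : LieAlgebra.IsSolvable π'.ker := by
    refine Function.Injective.lieAlgebra_isSolvable (f := ι) fun x y hxy => ?_
    exact Subtype.ext (Subtype.ext (congrArg (fun z : π.ker => (z : g)) hxy))
  obtain ⟨b, hbS, hb0, hb⟩ := ih _ hlt k rfl π'
    (fun x => by
      obtain ⟨y, rfl⟩ := hπ x
      obtain ⟨z, hz, hzy⟩ := hkπ y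
      exact ⟨⟨z, hz⟩, hzy⟩) hsolv' (S := S.restrict hkS)
    (fun x y => Subtype.ext (hSder x y)) (hSss.restrict _)
    (fun x hx => LieHom.mem_ker.2 (LieHom.mem_ker.1 (hSR x.1 (LieHom.mem_ker.2
      (LieHom.mem_ker.1 hx)))))
  refine ⟨b.map k.incl, ?_, ?_, fun x => ?_⟩
  · rintro _ ⟨x, hx, rfl⟩
    exact ⟨_, hbS x hx, rfl⟩
  · rintro _ ⟨x, hx, rfl⟩ h0
    have := hb0 x hx h0
    simp [this]
  · obtain ⟨y, hy, hyx⟩ := hkπ x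
    obtain ⟨z, hz, hzy⟩ := hb ⟨y, hy⟩
    exact ⟨z, ⟨z, hz, rfl⟩, hzy.trans hyx⟩

end Levi

section InnerPart

attribute [local instance] LieRing.ofAssociativeRing

/-- The quotient of a Lie algebra by its radical is semisimple. -/
theorem isKilling_quotient_radical (g : Type*) [LieRing g] [LieAlgebra ℂ g]
    [FiniteDimensional ℂ g] : LieAlgebra.IsKilling ℂ (g ⧸ LieAlgebra.radical ℂ g) := by
  let r := LieAlgebra.radical ℂ g
  let J := LieAlgebra.radical ℂ (g ⧸ r)
  let π : g →ₗ⁅ℂ⁆ g ⧸ r :=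
    { (LieSubmodule.Quotient.mk' r : g →ₗ[ℂ] g ⧸ r) with map_lie' := rfl }
  have hπ : ∀ x, π x = 0 ↔ x ∈ r := fun x => LieSubmodule.Quotient.mk_eq_zero r
  let K : LieIdeal ℂ g := J.comap π
  obtain ⟨k, hk⟩ := LieAlgebra.IsSolvable.solvable ℂ J
  rw [LieIdeal.derivedSeries_eq_bot_iff] at hk
  obtain ⟨l, hl⟩ := LieAlgebra.IsSolvable.solvable ℂ r
  rw [LieIdeal.derivedSeries_eq_bot_iff] at hl
  have hmap : ∀ k, LieAlgebra.derivedSeriesOfIdeal ℂ g k K ≤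
      (LieAlgebra.derivedSeriesOfIdeal ℂ (g ⧸ r) k J).comap π := by
    intro k
    induction k with
    | zero => exact le_rfl
    | succ k ih =>
      rw [LieAlgebra.derivedSeriesOfIdeal_succ, LieAlgebra.derivedSeriesOfIdeal_succ]
      exact (LieSubmodule.mono_lie ih ih).trans (LieIdeal.comap_bracket_le π)
  have hK : LieAlgebra.IsSolvable K := by
    refine LieAlgebra.IsSolvable.mk (R := ℂ) (k := l + k)
      ((LieIdeal.derivedSeries_eq_bot_iff K _).2 ?_)
    rw [LieAlgebra.derivedSeriesOfIdeal_add, eq_bot_iff, ← hl]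
    refine LieAlgebra.derivedSeriesOfIdeal_le (fun x hx => ?_) le_rfl
    have h1 := hmap k hx
    rw [hk] at h1
    exact (hπ x).1 (by simpa using h1)
  rw [LieAlgebra.LieIdeal.solvable_iff_le_radical] at hK
  have : LieAlgebra.HasTrivialRadical ℂ (g ⧸ r) := by
    refine ⟨eq_bot_iff.2 fun x hx => ?_⟩
    obtain ⟨y, rfl⟩ := LieSubmodule.Quotient.surjective_mk' r x
    have : y ∈ r := hK hx
    rw [(LieSubmodule.Quotient.mk_eq_zero r).2 this]
    exact zero_mem _
  infer_instance

/-- A linear functional on a semisimple Lie algebra vanishing on brackets is zero. -/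
theorem functional_eq_zero_of_apply_lie_eq_zero {s : Type*} [LieRing s] [LieAlgebra ℂ s]
    [FiniteDimensional ℂ s] [LieAlgebra.IsKilling ℂ s] (l : s →ₗ[ℂ] ℂ)
    (hl : ∀ x y : s, l ⁅x, y⁆ = 0) : l = 0 := by
  have hB := LieAlgebra.IsKilling.killingForm_nondegenerate ℂ s
  obtain ⟨x, rfl⟩ := (LinearMap.BilinForm.toDual (killingForm ℂ s) hB).surjective l
  have hx : x ∈ LieAlgebra.radical ℂ s := mem_radical_of_killingForm_lie_eq_zero fun y z => by
    rw [← LinearMap.BilinForm.toDual_def hB]; exact hl y z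
  rw [LieAlgebra.HasTrivialRadical.radical_eq_bot] at hx
  have : x = 0 := by simpa using hx
  rw [this, map_zero]

/-- Any semisimple derivation becomes, after subtracting a suitable inner derivation commuting with
it, a semisimple derivation trivial on a Levi subalgebra. -/
theorem IsLieDer.exists_inner_part {g : Type u} [LieRing g] [LieAlgebra ℂ g]
    [FiniteDimensional ℂ g] {S : End ℂ g} (hS : IsLieDer S) (hss : S.IsSemisimple) :
    ∃ σ : g, (S - LieAlgebra.ad ℂ g σ).IsSemisimple ∧ S σ = 0 ∧
      (∀ x, ∃ r ∈ LieAlgebra.radical ℂ g,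
        (S - LieAlgebra.ad ℂ g σ) x = (S - LieAlgebra.ad ℂ g σ) r) ∧
      ∀ l : g →ₗ[ℂ] ℂ, (∀ x y : g, l ⁅x, y⁆ = 0) → l σ = 0 := by
  let r := LieAlgebra.radical ℂ g
  have := isKilling_quotient_radical g
  let π : g →ₗ⁅ℂ⁆ g ⧸ r :=
    { (LieSubmodule.Quotient.mk' r : g →ₗ[ℂ] g ⧸ r) with map_lie' := rfl }
  have hπ : ∀ x, π x = 0 ↔ x ∈ r := fun x => LieSubmodule.Quotient.mk_eq_zero r
  have hsurj : Function.Surjective π := LieSubmodule.Quotient.surjective_mk' r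
  have hker : π.ker = r := by
    ext x; rw [LieHom.mem_ker, hπ]
  have hsolv : LieAlgebra.IsSolvable π.ker := by rw [hker]; infer_instance
  obtain ⟨b, hbS, hb0, hb⟩ := exists_stable_levi _ g rfl π hsurj hsolv hS hss
    (by rw [hker]; exact fun x hx => hS.map_radical hx)
  let πb : b →ₗ⁅ℂ⁆ g ⧸ r := π.comp b.incl
  have hbij : Function.Bijective πb := by
    refine ⟨(injective_iff_map_eq_zero πb).2 fun x hx => Subtype.ext (hb0 x x.2 hx), fun q => ?_⟩
    obtain ⟨x, rfl⟩ := hsurj q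
    obtain ⟨y, hy, hyx⟩ := hb x
    exact ⟨⟨y, hy⟩, hyx⟩
  have hbK : LieAlgebra.IsKilling ℂ b :=
    LieAlgebra.isKilling_of_equiv (LieEquiv.ofBijective πb hbij).symm
  let Sb : LieDerivation ℂ b b := ⟨S.restrict hbS, fun x y => by
    refine Subtype.ext ?_
    have h : S ⁅(x : g), (y : g)⁆ = ⁅(x : g), S y⁆ - ⁅(y : g), S x⁆ := by
      rw [hS, ← lie_skew (S x)]; abel
    exact h⟩
  obtain ⟨σ, hσ⟩ := LieDerivation.IsKilling.exists_eq_ad Sb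
  have hσ' : ∀ y : b, ⁅σ, y⁆ = S.restrict hbS y := fun y => by
    have := LieDerivation.congr_fun hσ y
    rwa [LieDerivation.ad_apply_apply] at this
  have hσS : ∀ y ∈ b, ⁅(σ : g), y⁆ = S y := fun y hy => congrArg Subtype.val (hσ' ⟨y, hy⟩)
  have hSσ : S σ = 0 := by rw [← hσS σ σ.2, lie_self]
  have hadb : (LieAlgebra.ad ℂ b σ).IsSemisimple := by
    have : LieAlgebra.ad ℂ b σ = S.restrict hbS := LinearMap.ext hσ'
    rw [this]; exact hss.restrict _
  have had : (LieAlgebra.ad ℂ g σ).IsSemisimple :=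
    isSemisimple_toEnd_of_isSemisimple_ad (s := b) (V := g) hadb
  have hcomm : Commute S (LieAlgebra.ad ℂ g σ) := by
    ext y
    simp only [End.mul_apply, LieAlgebra.ad_apply]
    rw [hS, hSσ, zero_lie, zero_add]
  refine ⟨σ, End.IsSemisimple.sub_of_commute hcomm hss had, hSσ, fun x => ?_, fun l hl => ?_⟩
  · obtain ⟨y, hy, hyx⟩ := hb x
    refine ⟨x - y, (hπ _).1 (by rw [map_sub, hyx, sub_self]), ?_⟩
    rw [map_sub _ x y, LinearMap.sub_apply _ _ y, LieAlgebra.ad_apply, hσS y hy, sub_self, sub_zero]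
  · have := functional_eq_zero_of_apply_lie_eq_zero (s := b) (l ∘ₗ b.toSubmodule.subtype)
      fun x y => hl x y
    exact LinearMap.congr_fun this σ

end InnerPart

/-- A nonzero semisimple endomorphism has a power, of exponent at least two, with nonzero trace. -/
theorem exists_trace_pow_ne_zero {E : Type*} [AddCommGroup E] [Module ℂ E] [FiniteDimensional ℂ E]
    {D : End ℂ E} (hD : D.IsSemisimple) (hD0 : D ≠ 0) :
    ∃ k, LinearMap.trace ℂ E (D ^ (k + 2)) ≠ 0 := by
  by_contra! h
  obtain ⟨q, hq⟩ : ∃ q : ℂ[X], D = D ^ 2 * aeval D q := by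
    set m := minpoly ℂ D with hm
    obtain ⟨i, hi, hassoc⟩ := (dvd_prime_pow prime_X 2).1
      (EuclideanDomain.gcd_dvd_left (X ^ 2 : ℂ[X]) m)
    have hi1 : i ≤ 1 := by
      by_contra hi2
      obtain rfl : i = 2 := by omega
      have : (X * X : ℂ[X]) ∣ m := by
        rw [← pow_two]; exact hassoc.symm.dvd.trans (EuclideanDomain.gcd_dvd_right _ _)
      exact Polynomial.not_isUnit_X (hD.minpoly_squarefree _ this)
    obtain ⟨c, hc⟩ : EuclideanDomain.gcd (X ^ 2 : ℂ[X]) m ∣ X :=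
      hassoc.dvd.trans ((pow_dvd_pow _ hi1).trans (by simp))
    rw [EuclideanDomain.gcd_eq_gcd_ab] at hc
    refine ⟨EuclideanDomain.gcdA (X ^ 2) m * c, ?_⟩
    have := congrArg (aeval D) hc
    simpa [hm, minpoly.aeval, mul_assoc] using this
  have htr : ∀ p : ℂ[X], LinearMap.trace ℂ E (D ^ 2 * aeval D p) = 0 := by
    intro p
    induction p using Polynomial.induction_on' with
    | add p q hp hq => rw [map_add, mul_add, map_add, hp, hq, add_zero]
    | monomial n a =>
      rw [aeval_monomial, Algebra.algebraMap_eq_smul_one, smul_mul_assoc, one_mul, mul_smul_comm,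
        ← pow_add, map_smul, add_comm, h, smul_zero]
  have hcomm : Commute D (aeval D q) := by
    simpa using (Commute.all (X : ℂ[X]) q).map (aeval D)
  have he : IsIdempotentElem (D * aeval D q) := by
    rw [IsIdempotentElem, mul_assoc, ← mul_assoc (aeval D q), ← hcomm.eq, ← mul_assoc,
      ← mul_assoc, ← pow_two, ← hq]
  have he0 : LinearMap.trace ℂ E (D * aeval D q) = 0 := by
    rw [← he.eq, mul_assoc, ← mul_assoc (aeval D q), ← hcomm.eq, mul_assoc, ← mul_assoc, ← pow_two,
      ← map_mul]
    exact htr _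
  have h0 := LinearMap.IsIdempotentElem.eq_zero_of_trace_eq_zero he he0
  apply hD0
  rw [hq, pow_two, mul_assoc, h0, mul_zero]

section TraceFunctional

attribute [local instance] LieRing.ofAssociativeRing

/-- A functional vanishing on brackets vanishes on the image of the semisimple part of `ad X`. -/
theorem functional_semisimple_part_apply_eq_zero {g : Type*} [LieRing g] [LieAlgebra ℂ g]
    [FiniteDimensional ℂ g] {X : g} {S N : End ℂ g} (hS : S.IsSemisimple) (hN : IsNilpotent N)
    (hSN : Commute S N) (hX : LieAlgebra.ad ℂ g X = S + N) {l : g →ₗ[ℂ] ℂ}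
    (hl : ∀ x y : g, l ⁅x, y⁆ = 0) (x : g) : l (S x) = 0 := by
  refine (semisimple_part_intertwines (SB := 0) (NB := 0) (f := l) hS hN hSN
    End.isSemisimple_zero IsNilpotent.zero (Commute.refl 0) (fun x => ?_) x).trans rfl
  have := LinearMap.congr_fun hX x
  rw [LinearMap.add_apply] at this
  rw [← this, LieAlgebra.ad_apply, hl]; simp

/-- The semisimple part of `ad X` is inner, or there is an operator `T` such that the functional
`x ↦ trace (T * ad x)` vanishes on brackets, but not at `X`. -/
theorem exists_trace_functional {g : Type u} [LieRing g] [LieAlgebra ℂ g] [FiniteDimensional ℂ g]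
    {X : g} {S N : End ℂ g} (hS : S.IsSemisimple) (hN : IsNilpotent N) (hSN : Commute S N)
    (hX : LieAlgebra.ad ℂ g X = S + N) :
    (∃ z, S = LieAlgebra.ad ℂ g z) ∨ ∃ T : End ℂ g, Commute T S ∧
      (∀ x y : g, LinearMap.trace ℂ g (T * LieAlgebra.ad ℂ g ⁅x, y⁆) = 0) ∧
      LinearMap.trace ℂ g (T * LieAlgebra.ad ℂ g X) ≠ 0 ∧
      LinearMap.trace ℂ g (T * LieAlgebra.ad ℂ g X) = LinearMap.trace ℂ g (T * S) ∧
      (∀ x, LinearMap.trace ℂ g (T * LieAlgebra.ad ℂ g (T x)) = 0) ∧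
      ∀ x, ∃ x₀, Commute T (LieAlgebra.ad ℂ g x₀) ∧
        ∀ l : g →ₗ[ℂ] ℂ, (∀ x y : g, l ⁅x, y⁆ = 0) → l x = l x₀ := by
  have hSder : IsLieDer S := IsLieDer.semisimple_part hS hN hSN (hX ▸ isLieDer_ad X)
  have hNder : IsLieDer N := by
    rw [show N = LieAlgebra.ad ℂ g X - S by rw [hX, add_sub_cancel_left]]
    exact (isLieDer_ad X).sub hSder
  obtain ⟨σ, hD, hSσ, hrad, hσ⟩ := hSder.exists_inner_part hS
  set D := S - LieAlgebra.ad ℂ g σ with hDdef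
  by_cases hD0 : D = 0
  · exact Or.inl ⟨σ, sub_eq_zero.1 hD0⟩
  right
  have hDder : IsLieDer D := hSder.sub (isLieDer_ad σ)
  have hlD : ∀ l : g →ₗ[ℂ] ℂ, (∀ x y : g, l ⁅x, y⁆ = 0) → ∀ x, l (D x) = 0 := fun l hl x => by
    rw [hDdef, LinearMap.sub_apply, map_sub,
      functional_semisimple_part_apply_eq_zero hS hN hSN hX hl, LieAlgebra.ad_apply, hl, sub_zero]
  have hDad : ∀ x, D x = 0 → Commute D (LieAlgebra.ad ℂ g x) := fun x hx => by
    rw [Commute, SemiconjBy, ← sub_eq_zero, hDder.commutator_ad, hx, map_zero]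
  have hDS : Commute D S := by
    refine (Commute.refl S).sub_left (Commute.symm ?_)
    rw [Commute, SemiconjBy, ← sub_eq_zero, hSder.commutator_ad, hSσ, map_zero]
  have hdec : ∀ x, ∃ x₀, D x₀ = 0 ∧ ∃ r ∈ LieAlgebra.radical ℂ g, x = x₀ + D r := fun x => by
    obtain ⟨a, -, b, -, ha, hab⟩ := exists_eq_add_apply_of_isSemisimple hD ⊤
      (fun _ _ => Submodule.mem_top) (Submodule.mem_top (x := x))
    obtain ⟨r, hr, hbr⟩ := hrad b
    exact ⟨a, ha, r, hr, by rw [hab, hbr]⟩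
  obtain ⟨k, hk⟩ := exists_trace_pow_ne_zero hD hD0
  have hlie : ∀ x y : g, LinearMap.trace ℂ g (D ^ (k + 1) * LieAlgebra.ad ℂ g ⁅x, y⁆) = 0 := by
    intro x y
    have hstab : ∀ U : Submodule ℂ g, (∀ E, IsLieDer E → ∀ v ∈ U, E v ∈ U) →
        ∀ v ∈ U, (D ^ (k + 1)) v ∈ U := fun U hU v hv =>
      Module.End.pow_apply_mem_of_forall_mem (k + 1) (hU D hDder) v hv
    obtain ⟨x₀, hx₀, r, hr, rfl⟩ := hdec x
    have e : ∀ a b : g, LieAlgebra.ad ℂ g ⁅a, b⁆ = LieAlgebra.ad ℂ g a * LieAlgebra.ad ℂ g b -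
      LieAlgebra.ad ℂ g b * LieAlgebra.ad ℂ g a := fun a b => LieHom.map_lie _ a b
    rw [add_lie, map_add, mul_add, map_add, e, e, mul_sub, mul_sub, map_sub, map_sub]
    have h1 : LinearMap.trace ℂ g (D ^ (k + 1) * (LieAlgebra.ad ℂ g x₀ * LieAlgebra.ad ℂ g y)) =
        LinearMap.trace ℂ g (D ^ (k + 1) * (LieAlgebra.ad ℂ g y * LieAlgebra.ad ℂ g x₀)) := by
      rw [← mul_assoc, ((hDad x₀ hx₀).pow_left (k + 1)).eq, mul_assoc, LinearMap.trace_mul_comm,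
        mul_assoc]
    have h2 : LinearMap.trace ℂ g (D ^ (k + 1) *
        (LieAlgebra.ad ℂ g (D r) * LieAlgebra.ad ℂ g y)) = 0 := by
      rw [← mul_assoc, LinearMap.trace_mul_comm, ← mul_assoc]
      exact trace_mul_ad_eq_zero hDder hr _ fun U hU v hv =>
        hU _ (isLieDer_ad y) _ (hstab U hU v hv)
    have h3 : LinearMap.trace ℂ g (D ^ (k + 1) *
        (LieAlgebra.ad ℂ g y * LieAlgebra.ad ℂ g (D r))) = 0 := by
      rw [← mul_assoc]
      exact trace_mul_ad_eq_zero hDder hr _ fun U hU v hv =>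
        hstab U hU _ (hU _ (isLieDer_ad y) _ hv)
    rw [h1, h2, h3, sub_self, sub_self, add_zero]
  let θ : g →ₗ[ℂ] ℂ := LinearMap.trace ℂ g ∘ₗ LinearMap.mulLeft ℂ (D ^ (k + 1)) ∘ₗ
    (LieAlgebra.ad ℂ g : g →ₗ[ℂ] End ℂ g)
  have hNtr : LinearMap.trace ℂ g (D ^ (k + 1) * N) = 0 := by
    obtain ⟨r, hr, hXr⟩ := hrad X
    refine trace_pow_mul_eq_zero_of_commutator_eq_ad hDder hDder hr hNder hN ?_ (k + 1)
    rw [← hXr, ← hDder.commutator_ad X, hX, mul_add, add_mul, hDS.eq]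
    abel
  have hXS : LinearMap.trace ℂ g (D ^ (k + 1) * LieAlgebra.ad ℂ g X) =
      LinearMap.trace ℂ g (D ^ (k + 1) * S) := by
    rw [hX, mul_add, map_add, hNtr, add_zero]
  refine ⟨D ^ (k + 1), hDS.pow_left _, hlie, ?_, hXS, fun x => ?_, fun x => ?_⟩
  · have hθσ : LinearMap.trace ℂ g (D ^ (k + 1) * LieAlgebra.ad ℂ g σ) = 0 := hσ θ hlie
    rw [hXS, show S = D + LieAlgebra.ad ℂ g σ by rw [hDdef, sub_add_cancel], mul_add, map_add,
      hθσ, add_zero, ← pow_succ]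
    exact hk
  · have e : (D ^ (k + 1)) x = D ((D ^ k) x) := by rw [pow_succ', End.mul_apply]
    rw [e]
    exact hlD θ hlie _
  · obtain ⟨x₀, hx₀, r, -, rfl⟩ := hdec x
    exact ⟨x₀, (hDad x₀ hx₀).pow_left _, fun l hl => by rw [map_add, hlD l hl, add_zero]⟩

end TraceFunctional

/-- If `Φ` maps onto a quotient `D / A` modulo the line spanned by `v`, and kills `v`, then its
kernel is spanned by `v` modulo `A`. -/
theorem exists_eq_smul_add_of_apply_eq_zero {E : Type*} [AddCommGroup E] [Module ℂ E]
    [FiniteDimensional ℂ E] {Φ : End ℂ E} {A D : Submodule ℂ E} (hA : ∀ x ∈ A, Φ x ∈ A)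
    (hD : ∀ x ∈ D, Φ x ∈ D) {v : E} (hv : v ∈ D) (hΦv : Φ v = 0)
    (hsurj : ∀ x ∈ D, ∃ a ∈ D, ∃ q : ℂ, ∃ b ∈ A, x = Φ a + q • v + b)
    {w : E} (hw : w ∈ D) (hΦw : Φ w = 0) : ∃ c : ℂ, ∃ b ∈ A, w = c • v + b := by
  let A' := A.submoduleOf D
  let Ψ : End ℂ (D ⧸ A') := A'.mapQ A' (Φ.restrict hD) fun x hx => hA _ hx
  let v' : D ⧸ A' := A'.mkQ ⟨v, hv⟩
  have hΨ : ∀ x : D, Ψ (A'.mkQ x) = A'.mkQ (Φ.restrict hD x) := fun x => rfl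
  have hker : ∀ x (hx : x ∈ D), Φ x = 0 → A'.mkQ ⟨x, hx⟩ ∈ LinearMap.ker Ψ := fun x hx h => by
    rw [LinearMap.mem_ker, hΨ, show Φ.restrict hD ⟨x, hx⟩ = 0 from Subtype.ext h, map_zero]
  have hle : Submodule.span ℂ {v'} ≤ LinearMap.ker Ψ := by
    rw [Submodule.span_singleton_le_iff_mem]; exact hker v hv hΦv
  have htop : LinearMap.range Ψ ⊔ Submodule.span ℂ {v'} = ⊤ := by
    refine eq_top_iff.2 fun x _ => ?_
    obtain ⟨⟨x, hx⟩, rfl⟩ := A'.mkQ_surjective x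
    obtain ⟨a, ha, q, b, hb, hab⟩ := hsurj x hx
    have hbD : b ∈ D := by
      rw [show b = x - Φ a - q • v by rw [hab]; abel]
      exact sub_mem (sub_mem hx (hD a ha)) (D.smul_mem q hv)
    have : (⟨x, hx⟩ : D) = Φ.restrict hD ⟨a, ha⟩ + q • ⟨v, hv⟩ + ⟨b, hbD⟩ := Subtype.ext hab
    rw [this, map_add, map_add, map_smul, ← hΨ,
      show A'.mkQ ⟨b, hbD⟩ = 0 from (Submodule.Quotient.mk_eq_zero A').2 hb, add_zero]
    exact Submodule.add_mem_sup ⟨_, rfl⟩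
      (Submodule.smul_mem _ _ (Submodule.mem_span_singleton_self _))
  have heq := Submodule.eq_of_le_of_finrank_le hle (by
    have h1 := Submodule.finrank_add_le_finrank_add_finrank (LinearMap.range Ψ)
      (Submodule.span ℂ {v'})
    rw [htop, finrank_top, ← Ψ.finrank_range_add_finrank_ker] at h1
    omega)
  obtain ⟨c, hc⟩ := Submodule.mem_span_singleton.1 (heq ▸ hker w hw hΦw)
  refine ⟨c, w - c • v, ?_, by abel⟩
  rw [← map_smul, ← sub_eq_zero, ← map_sub] at hc
  have : c • v - w ∈ A := (Submodule.Quotient.mk_eq_zero A').1 hc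
  rw [← neg_sub]; exact neg_mem this

section Transverse

variable {g : Type*} [LieRing g] [LieAlgebra ℂ g]

/-- The projection onto the kernel of `l` along `X` (when `l X = 1`). -/
def transverseProj (l : g →ₗ[ℂ] ℂ) (X : g) : End ℂ g := 1 - l.smulRight X

theorem transverseProj_apply (l : g →ₗ[ℂ] ℂ) (X x : g) : transverseProj l X x = x - l x • X := rfl

theorem transverseProj_of_apply_eq_zero {l : g →ₗ[ℂ] ℂ} {X x : g} (h : l x = 0) :
    transverseProj l X x = x := by rw [transverseProj_apply, h, zero_smul, sub_zero]

theorem transverseProj_self {l : g →ₗ[ℂ] ℂ} {X : g} (hX : l X = 1) :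
    transverseProj l X X = 0 := by rw [transverseProj_apply, hX, one_smul, sub_self]

theorem apply_transverseProj {l : g →ₗ[ℂ] ℂ} {X : g} (hX : l X = 1) (x : g) :
    l (transverseProj l X x) = 0 := by
  rw [transverseProj_apply, map_sub, map_smul, hX, smul_eq_mul, mul_one, sub_self]

theorem ext_transverse {l : g →ₗ[ℂ] ℂ} {X : g} (hX : l X = 1) {d e : End ℂ g}
    (h : d X = e X) (h' : ∀ u, l u = 0 → d u = e u) : d = e := by
  ext x
  have e1 : x = transverseProj l X x + l x • X := by rw [transverseProj_apply, sub_add_cancel]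
  rw [e1, map_add, map_add, map_smul, map_smul, h, h' _ (apply_transverseProj hX x)]

/-- Endomorphisms killing `X`, with values in the kernel of `l`, and restricting to a derivation of
it. -/
def transverseDer (l : g →ₗ[ℂ] ℂ) (X : g) : Submodule ℂ (End ℂ g) where
  carrier := {d | d X = 0 ∧ (∀ x, l (d x) = 0) ∧
    ∀ u v, l u = 0 → l v = 0 → d ⁅u, v⁆ = ⁅d u, v⁆ + ⁅u, d v⁆}
  add_mem' := fun {d e} hd he => by
    refine ⟨by simp [hd.1, he.1], fun x => by simp [hd.2.1, he.2.1], fun u v hu hv => ?_⟩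
    simp only [LinearMap.add_apply, hd.2.2 u v hu hv, he.2.2 u v hu hv, add_lie, lie_add]
    abel
  zero_mem' := by simp
  smul_mem' := fun c d hd => by
    refine ⟨by simp [hd.1], fun x => by simp [hd.2.1], fun u v hu hv => ?_⟩
    simp only [LinearMap.smul_apply, hd.2.2 u v hu hv, smul_lie, lie_smul, smul_add]

theorem mem_transverseDer {l : g →ₗ[ℂ] ℂ} {X : g} {d : End ℂ g} : d ∈ transverseDer l X ↔
    d X = 0 ∧ (∀ x, l (d x) = 0) ∧
      ∀ u v, l u = 0 → l v = 0 → d ⁅u, v⁆ = ⁅d u, v⁆ + ⁅u, d v⁆ := Iff.rfl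

theorem IsLieDer.mem_transverseDer {l : g →ₗ[ℂ] ℂ} {X : g} {d : End ℂ g} (hd : IsLieDer d)
    (hX : d X = 0) (hl : ∀ x, l (d x) = 0) : d ∈ transverseDer l X :=
  ⟨hX, hl, fun u v _ _ => hd u v⟩

attribute [local instance] LieRing.ofAssociativeRing

theorem commutator_mem_transverseDer {l : g →ₗ[ℂ] ℂ} {X : g} {d e : End ℂ g}
    (hd : d ∈ transverseDer l X) (he : e ∈ transverseDer l X) :
    d * e - e * d ∈ transverseDer l X := by
  rw [mem_transverseDer] at *
  refine ⟨?_, fun x => ?_, fun u v hu hv => ?_⟩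
  · simp [hd.1, he.1]
  · simp [hd.2.1, he.2.1]
  · simp only [LinearMap.sub_apply, End.mul_apply, hd.2.2 u v hu hv, he.2.2 u v hu hv, map_add,
      hd.2.2 _ _ (he.2.1 u) hv, hd.2.2 _ _ hu (he.2.1 v), he.2.2 _ _ (hd.2.1 u) hv,
      he.2.2 _ _ hu (hd.2.1 v), sub_lie, lie_sub]
    abel

/-- The inner derivation of the kernel of `l` given by `y`, extended by zero along `X`. -/
def transverseAd (l : g →ₗ[ℂ] ℂ) (X : g) : g →ₗ[ℂ] End ℂ g :=
  (LinearMap.mulRight ℂ (transverseProj l X)) ∘ₗ (LieAlgebra.ad ℂ g : g →ₗ[ℂ] End ℂ g)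

theorem transverseAd_eq (l : g →ₗ[ℂ] ℂ) (X y : g) :
    transverseAd l X y = LieAlgebra.ad ℂ g y * transverseProj l X := rfl

theorem transverseAd_apply (l : g →ₗ[ℂ] ℂ) (X y x : g) :
    transverseAd l X y x = ⁅y, transverseProj l X x⁆ := rfl

theorem transverseAd_apply_of_eq_zero {l : g →ₗ[ℂ] ℂ} {X x : g} (y : g) (h : l x = 0) :
    transverseAd l X y x = ⁅y, x⁆ := by
  rw [transverseAd_apply, transverseProj_of_apply_eq_zero h]

theorem transverseAd_apply_self {l : g →ₗ[ℂ] ℂ} {X : g} (hX : l X = 1) (y : g) :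
    transverseAd l X y X = 0 := by
  rw [transverseAd_apply, transverseProj_self hX, lie_zero]

theorem commutator_transverseAd {l : g →ₗ[ℂ] ℂ} {X : g} (hX : l X = 1)
    {d : End ℂ g} (hd : d ∈ transverseDer l X) {y : g} (hy : l y = 0) :
    d * transverseAd l X y - transverseAd l X y * d = transverseAd l X (d y) := by
  refine ext_transverse hX ?_ fun u hu => ?_
  · simp [transverseAd_apply_self hX, hd.1]
  · simp [transverseAd_apply_of_eq_zero _ hu, transverseAd_apply_of_eq_zero _ (hd.2.1 u),
      hd.2.2 y u hy hu]

/-- Elements of `transverseDer` give rise to linear deformations of the bracket. -/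
theorem jacobi_of_mem_transverseDer {l : g →ₗ[ℂ] ℂ} {X : g} (hX : l X = 1)
    (hl : ∀ x y : g, l ⁅x, y⁆ = 0) {d : End ℂ g} (hd : d ∈ transverseDer l X) (t : ℂ)
    {m : g → g → g} (hm : ∀ x y, m x y = ⁅x, y⁆ + t • (l x • d y - l y • d x)) (x y z : g) :
    m (m x y) z + m (m y z) x + m (m z x) y = 0 := by
  obtain ⟨hd1, hd2, hd3⟩ := hd
  have K : ∀ x y, d ⁅x, y⁆ = l x • (d ⁅X, y⁆ - ⁅X, d y⁆) - l y • (d ⁅X, x⁆ - ⁅X, d x⁆) +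
      ⁅d x, y⁆ + ⁅x, d y⁆ := by
    intro x y
    have h := hd3 (x - l x • X) (y - l y • X) (by simp [hX]) (by simp [hX])
    have e1 : ⁅x, X⁆ = -⁅X, x⁆ := (lie_skew _ _).symm
    have e2 : ⁅d x, X⁆ = -⁅X, d x⁆ := (lie_skew _ _).symm
    simp only [lie_sub, sub_lie, lie_smul, smul_lie, map_sub, map_smul, hd1, lie_self, e1, e2,
      smul_zero, sub_zero, map_neg] at h
    rw [← sub_eq_zero] at h ⊢
    rw [← h]
    module
  have J : ⁅⁅x, y⁆, z⁆ + ⁅⁅y, z⁆, x⁆ + ⁅⁅z, x⁆, y⁆ = 0 := by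
    have := lie_jacobi x y z
    rw [← lie_skew ⁅x, y⁆, ← lie_skew ⁅y, z⁆, ← lie_skew ⁅z, x⁆, ← neg_add, ← neg_add, neg_eq_zero,
      ← this]
    abel
  have s1 : ⁅x, d y⁆ = -⁅d y, x⁆ := (lie_skew _ _).symm
  have s2 : ⁅y, d z⁆ = -⁅d z, y⁆ := (lie_skew _ _).symm
  have s3 : ⁅z, d x⁆ = -⁅d x, z⁆ := (lie_skew _ _).symm
  simp only [hm, map_add, map_sub, map_smul, hl, hd2, add_lie, sub_lie, smul_lie, K x y, K y z,
    K z x, s1, s2, s3, smul_zero, zero_smul, sub_zero, add_zero]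
  refine Eq.trans ?_ J
  module

end Transverse

section LinearlyRigid

variable {g : Type u} [LieRing g] [LieAlgebra ℂ g]

attribute [local instance] LieRing.ofAssociativeRing

/-- Every linear deformation of the bracket of `g` is infinitesimally trivial. -/
def IsLinearlyRigid (g : Type*) [LieRing g] [LieAlgebra ℂ g] : Prop :=
  ∀ φ : g →ₗ[ℂ] g →ₗ[ℂ] g, (∀ x, φ x x = 0) →
    (∀ (t : ℂ) (m : g → g → g), (∀ x y, m x y = ⁅x, y⁆ + t • φ x y) →
      ∀ x y z, m (m x y) z + m (m y z) x + m (m z x) y = 0) →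
    ∃ a : End ℂ g, ∀ x y, φ x y = a ⁅x, y⁆ - ⁅a x, y⁆ - ⁅x, a y⁆

theorem IsLinearlyRigid.exists_eq_commutator [FiniteDimensional ℂ g] (hg : IsLinearlyRigid g)
    {l : g →ₗ[ℂ] ℂ} {X : g} (hX : l X = 1) (hl : ∀ x y : g, l ⁅x, y⁆ = 0)
    {T : End ℂ g} (hT : ∀ x, LinearMap.trace ℂ g (T * LieAlgebra.ad ℂ g x) =
      LinearMap.trace ℂ g (T * LieAlgebra.ad ℂ g X) * l x)
    (hTX : LinearMap.trace ℂ g (T * LieAlgebra.ad ℂ g X) ≠ 0) (hlT : ∀ x, l (T x) = 0)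
    (hdec : ∀ x, ∃ x₀, Commute T (LieAlgebra.ad ℂ g x₀) ∧
      ∀ f : g →ₗ[ℂ] ℂ, (∀ x y : g, f ⁅x, y⁆ = 0) → f x = f x₀)
    {d : End ℂ g} (hd : d ∈ transverseDer l X) :
    ∃ a ∈ transverseDer l X, ∃ q : ℂ, ∃ x₀, l x₀ = 0 ∧
      d = (a * LieAlgebra.ad ℂ g X - LieAlgebra.ad ℂ g X * a) + q • LieAlgebra.ad ℂ g X +
        transverseAd l X x₀ := by
  obtain ⟨a, ha⟩ := hg
    (((LinearMap.lsmul ℂ g).flip.compl₂ l |>.flip.compl₂ d) -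
      ((LinearMap.lsmul ℂ g).flip.compl₂ l |>.flip.compl₂ d).flip)
    (fun x => by simp) (fun t m hm => jacobi_of_mem_transverseDer hX hl hd t (m := m) fun x y => by
      rw [hm]; rfl)
  replace ha : ∀ x y, l x • d y - l y • d x = a ⁅x, y⁆ - ⁅a x, y⁆ - ⁅x, a y⁆ := ha
  have ha0 : ∀ x y, l x = 0 → l y = 0 → a ⁅x, y⁆ = ⁅a x, y⁆ + ⁅x, a y⁆ := fun x y hx hy => by
    have := ha x y
    rw [hx, hy, zero_smul, zero_smul, sub_zero, eq_comm, sub_sub, sub_eq_zero] at this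
    exact this
  have hTπ : ∀ u : End ℂ g, LinearMap.trace ℂ g (T * (u * transverseProj l X)) =
      LinearMap.trace ℂ g (T * u) := fun u => by
    rw [← mul_assoc, LinearMap.trace_mul_comm, ← mul_assoc]
    congr 2
    ext x
    exact transverseProj_of_apply_eq_zero (hlT x)
  have hla : ∀ x, l x = 0 → l (a x) = 0 := by
    intro x hx
    obtain ⟨w, hw, hw'⟩ := hdec x
    have hlw : l w = 0 := by rw [← hw' l hl, hx]
    have e : l (a x) = l (a w) := hw' (l ∘ₗ a) fun y z => by
      have : a ⁅y, z⁆ = l y • d z - l z • d y + ⁅a y, z⁆ + ⁅y, a z⁆ := by rw [ha]; abel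
      simp [this, hl, hd.2.1]
    rw [e]
    refine (mul_eq_zero.1 ((hT (a w)).symm.trans ?_)).resolve_left hTX
    have e1 : LieAlgebra.ad ℂ g (a w) * transverseProj l X =
        (a * LieAlgebra.ad ℂ g w - LieAlgebra.ad ℂ g w * a) * transverseProj l X := by
      ext y
      simp only [End.mul_apply, LinearMap.sub_apply, LieAlgebra.ad_apply]
      rw [ha0 _ _ hlw (apply_transverseProj hX y), add_sub_cancel_right]
    rw [← hTπ, e1, hTπ, mul_sub, map_sub, sub_eq_zero, ← mul_assoc T _ a, hw.eq, mul_assoc,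
      LinearMap.trace_mul_comm ℂ (LieAlgebra.ad ℂ g w), mul_assoc]
  refine ⟨a * transverseProj l X, ⟨?_, fun x => hla _ (apply_transverseProj hX x), ?_⟩, -l (a X),
    -(a X - l (a X) • X), by simp [hX], ext_transverse hX ?_ fun u hu => ?_⟩
  · simp [transverseProj_self hX]
  · intro u v hu hv
    simp only [End.mul_apply, transverseProj_of_apply_eq_zero hu,
      transverseProj_of_apply_eq_zero hv, transverseProj_of_apply_eq_zero (hl u v), ha0 u v hu hv]
  · simp [hd.1, transverseProj_self hX, transverseAd_apply_self hX]
  · have := ha X u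
    rw [hX, hu, one_smul, zero_smul, sub_zero] at this
    simp only [LinearMap.add_apply, LinearMap.sub_apply, LinearMap.smul_apply, End.mul_apply,
      LieAlgebra.ad_apply, transverseProj_of_apply_eq_zero hu,
      transverseProj_of_apply_eq_zero (hl X u), transverseAd_apply_of_eq_zero _ hu, this, neg_lie,
      sub_lie, smul_lie]
    module

/-- In a linearly rigid Lie algebra, the semisimple part of an inner derivation is inner. -/
theorem IsLinearlyRigid.exists_semisimple_part_eq_ad [FiniteDimensional ℂ g]
    (hg : IsLinearlyRigid g) {X : g} {S N : End ℂ g} (hS : S.IsSemisimple) (hN : IsNilpotent N)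
    (hSN : Commute S N) (hXS : LieAlgebra.ad ℂ g X = S + N) : ∃ z, S = LieAlgebra.ad ℂ g z := by
  obtain h | ⟨T, hTS, hTlie, hTX, hTXS, hTT, hdec⟩ := exists_trace_functional hS hN hSN hXS
  · exact h
  have hSder : IsLieDer S := IsLieDer.semisimple_part hS hN hSN (hXS ▸ isLieDer_ad X)
  have hSX : S X = 0 := semisimple_part_apply_eq_zero hS hN hSN (by
    rw [← LinearMap.add_apply, ← hXS, LieAlgebra.ad_apply, lie_self])
  set C := LinearMap.trace ℂ g (T * LieAlgebra.ad ℂ g X) with hC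
  let l : g →ₗ[ℂ] ℂ := C⁻¹ • (LinearMap.trace ℂ g ∘ₗ LinearMap.mulLeft ℂ T ∘ₗ
    (LieAlgebra.ad ℂ g : g →ₗ[ℂ] End ℂ g))
  have hl_apply : ∀ x, l x = C⁻¹ * LinearMap.trace ℂ g (T * LieAlgebra.ad ℂ g x) := fun _ => rfl
  have hX : l X = 1 := by rw [hl_apply, ← hC, inv_mul_cancel₀ hTX]
  have hl : ∀ x y : g, l ⁅x, y⁆ = 0 := fun x y => by rw [hl_apply, hTlie, mul_zero]
  have hlT : ∀ x, l (T x) = 0 := fun x => by rw [hl_apply, hTT, mul_zero]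
  have hT : ∀ x, LinearMap.trace ℂ g (T * LieAlgebra.ad ℂ g x) = C * l x := fun x => by
    rw [hl_apply, mul_inv_cancel_left₀ hTX]
  have hlS : ∀ x, l (S x) = 0 := fun x =>
    functional_semisimple_part_apply_eq_zero hS hN hSN hXS hl x
  have hSmem : S ∈ transverseDer l X := hSder.mem_transverseDer hSX hlS
  have hXmem : LieAlgebra.ad ℂ g X ∈ transverseDer l X :=
    (isLieDer_ad X).mem_transverseDer (lie_self X) (hl X)
  have hcomm : Commute S (LieAlgebra.ad ℂ g X) := by
    rw [hXS]; exact (Commute.refl S).add_right hSN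
  let Φ : End ℂ (End ℂ g) :=
    LinearMap.mulRight ℂ (LieAlgebra.ad ℂ g X) - LinearMap.mulLeft ℂ (LieAlgebra.ad ℂ g X)
  have hΦ : ∀ d, Φ d = d * LieAlgebra.ad ℂ g X - LieAlgebra.ad ℂ g X * d := fun _ => rfl
  obtain ⟨c, _, ⟨y, hy, rfl⟩, hSy⟩ := exists_eq_smul_add_of_apply_eq_zero (Φ := Φ)
    (A := (LinearMap.ker l).map (transverseAd l X)) (D := transverseDer l X)
    (v := LieAlgebra.ad ℂ g X) (w := S)
    (by
      rintro _ ⟨y, hy, rfl⟩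
      refine ⟨-⁅X, y⁆, by simp [hl], ?_⟩
      have := commutator_transverseAd hX hXmem (y := y) hy
      rw [hΦ, map_neg, ← LieAlgebra.ad_apply ℂ, ← this, neg_sub])
    (fun d hd => commutator_mem_transverseDer hd hXmem) hXmem (by rw [hΦ, sub_self])
    (fun d hd => by
      obtain ⟨a, ha, q, x₀, hx₀, h⟩ := hg.exists_eq_commutator hX hl hT hTX hlT hdec hd
      exact ⟨a, ha, q, _, ⟨x₀, hx₀, rfl⟩, h⟩)
    hSmem (by rw [hΦ, hcomm.eq, sub_self])
  replace hy : l y = 0 := hy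
  have hZ : ∀ u, l u = 0 → ⁅S y, u⁆ = 0 := fun u hu => by
    have h1 : transverseAd l X (S y) = 0 := by
      rw [← commutator_transverseAd hX hSmem hy, ← sub_eq_iff_eq_add'.2 hSy, mul_sub, sub_mul,
        mul_smul_comm, smul_mul_assoc, hcomm.eq, sub_self]
    rw [← transverseAd_apply_of_eq_zero (X := X) _ hu, h1, LinearMap.zero_apply]
  let Z : Submodule ℂ g :=
    { carrier := {z | l z = 0 ∧ ∀ u, l u = 0 → ⁅z, u⁆ = 0}
      add_mem' := fun {a b} ha hb => ⟨by rw [map_add, ha.1, hb.1, add_zero], fun u hu => by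
        rw [add_lie, ha.2 u hu, hb.2 u hu, add_zero]⟩
      zero_mem' := by simp
      smul_mem' := fun c a ha => ⟨by rw [map_smul, ha.1, smul_zero], fun u hu => by
        rw [smul_lie, ha.2 u hu, smul_zero]⟩ }
  obtain ⟨z₀, -, z, hz, hz₀, hSyz⟩ := exists_eq_add_apply_of_isSemisimple hS Z
    (fun z hz => ⟨hlS z, fun u hu => by
      rw [← sub_eq_iff_eq_add.2 (hSder z u), hz.2 u hu, hz.2 _ (hlS u), map_zero, sub_zero]⟩)
    (f := S y) ⟨hlS y, hZ⟩
  have hSy0 : S (y - z) = 0 := apply_eq_zero_of_isSemisimple hS (by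
    rw [map_sub, hSyz, add_sub_cancel_right, hz₀])
  have hyz : transverseAd l X (y - z) = transverseAd l X y := by
    have : transverseAd l X z = 0 := ext_transverse hX (by simp [transverseAd_apply_self hX])
      fun u hu => by rw [transverseAd_apply_of_eq_zero _ hu, hz.2 u hu, LinearMap.zero_apply]
    rw [map_sub, this, sub_zero]
  rw [← hyz] at hSy
  have hlyz : l (y - z) = 0 := by rw [map_sub, hy, hz.1, sub_zero]
  have hc : c = 1 := by
    have h1 : LinearMap.trace ℂ g (T * transverseAd l X (y - z)) = 0 := by
      rw [transverseAd_eq, ← mul_assoc, LinearMap.trace_mul_comm, ← mul_assoc]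
      have : transverseProj l X * T = T :=
        LinearMap.ext fun x => transverseProj_of_apply_eq_zero (hlT x)
      rw [this, hT, hlyz, mul_zero]
    rw [hSy, mul_add, map_add, h1, add_zero, mul_smul_comm, map_smul, ← hC, smul_eq_mul] at hTXS
    exact (mul_right_cancel₀ hTX (by rw [one_mul]; exact hTXS)).symm
  rw [hc, one_smul] at hSy
  refine ⟨X + (y - z), ?_⟩
  have hXyz : ⁅X, y - z⁆ = 0 := by
    rw [hSy, LinearMap.add_apply, transverseAd_apply_of_eq_zero _ hlyz, lie_self, add_zero] at hSy0
    exact hSy0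
  rw [map_add, hSy]
  congr 1
  refine ext_transverse hX ?_ fun u hu => transverseAd_apply_of_eq_zero _ hu
  rw [transverseAd_apply_self hX, LieAlgebra.ad_apply, ← lie_skew, hXyz, neg_zero]

end LinearlyRigid

section Orbit

open Topology

variable {V : Type*} [NormedAddCommGroup V] [NormedSpace ℂ V]

/-- The bilinear map `(x, y) ↦ p (ν (q x) (q y))`. -/
noncomputable def conjBil (p q : V →L[ℂ] V) (ν : V →L[ℂ] V →L[ℂ] V) : V →L[ℂ] V →L[ℂ] V :=
  (ContinuousLinearMap.compL ℂ V V V p).comp (ν.bilinearComp q q)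

@[simp]
theorem conjBil_apply (p q : V →L[ℂ] V) (ν : V →L[ℂ] V →L[ℂ] V) (x y : V) :
    conjBil p q ν x y = p (ν (q x) (q y)) := rfl

theorem Continuous.conjBil {Z : Type*} [TopologicalSpace Z] {p q : Z → V →L[ℂ] V}
    {ν : Z → V →L[ℂ] V →L[ℂ] V} (hp : Continuous p) (hq : Continuous q) (hν : Continuous ν) :
    Continuous fun z => conjBil (p z) (q z) (ν z) := by
  have hflip : Continuous (ContinuousLinearMap.flip : (V →L[ℂ] V →L[ℂ] V) → _) :=
    (ContinuousLinearMap.flipₗᵢ ℂ V V V).continuous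
  exact ((ContinuousLinearMap.compL ℂ V V V).continuous.comp hp).clm_comp
    (hflip.comp ((hflip.comp (hν.clm_comp hq)).clm_comp hq))

theorem isClosed_setOf_isLieBracket : IsClosed {ν : V →L[ℂ] V →L[ℂ] V | IsLieBracket ν} := by
  simp only [IsLieBracket, IsAltBil, Set.ofPred_and, Set.ofPred_forall]
  refine IsClosed.inter (isClosed_iInter fun x => isClosed_eq (by fun_prop) continuous_const)
    (isClosed_iInter fun x => isClosed_iInter fun y => isClosed_iInter fun z =>
      isClosed_eq (by fun_prop) continuous_const)

theorem IsLieBracket.conjBil {μ : V →L[ℂ] V →L[ℂ] V} (hμ : IsLieBracket μ) (u : (V →L[ℂ] V)ˣ) :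
    IsLieBracket (conjBil (u : V →L[ℂ] V) (↑u⁻¹ : V →L[ℂ] V) μ) := by
  have h : ∀ x, (↑u⁻¹ : V →L[ℂ] V) ((u : V →L[ℂ] V) x) = x := fun x => by
    rw [← mul_apply_eq_comp, u.inv_mul, one_apply_eq_self]
  refine ⟨fun x => by rw [conjBil_apply, hμ.1, map_zero], fun x y z => ?_⟩
  simp only [conjBil_apply, h, ← map_add, hμ.2, map_zero]

/-- If the orbit of a Lie bracket `μ` is open, all Lie brackets close to `μ` are obtained from `μ`
by automorphisms close to the identity. -/
theorem eventually_exists_unit_of_isOpen_transportOrbit [FiniteDimensional ℂ V]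
    {μ : V →L[ℂ] V →L[ℂ] V} (hμ : IsLieBracket μ)
    (hopen : IsOpen {ν : {ν : V →L[ℂ] V →L[ℂ] V // IsLieBracket ν} |
      (ν : V →L[ℂ] V →L[ℂ] V) ∈ transportOrbit μ}) {U : Set (V →L[ℂ] V)} (hU : U ∈ 𝓝 1) :
    ∀ᶠ ν in 𝓝 μ, IsLieBracket ν → ∃ u : (V →L[ℂ] V)ˣ, (u : V →L[ℂ] V) ∈ U ∧
      ∀ x y, ν ((u : V →L[ℂ] V) x) ((u : V →L[ℂ] V) y) = (u : V →L[ℂ] V) (μ x y) := by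
  let L := {ν : V →L[ℂ] V →L[ℂ] V // IsLieBracket ν}
  let act : MulAction (V →L[ℂ] V)ˣ L :=
    { smul := fun u ν => ⟨conjBil (u : V →L[ℂ] V) (↑u⁻¹ : V →L[ℂ] V) ν.1, ν.2.conjBil u⟩
      one_smul := fun ν => rfl
      mul_smul := fun u v ν => Subtype.ext (by
        ext x y
        change conjBil _ _ ν.1 x y = conjBil _ _ (conjBil _ _ ν.1) x y
        simp) }
  have hcs : ContinuousSMul (V →L[ℂ] V)ˣ L :=
    ⟨Continuous.subtype_mk ((Units.continuous_val.comp continuous_fst).conjBil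
      (Units.continuous_val.comp (continuous_inv.comp continuous_fst))
      (continuous_subtype_val.comp continuous_snd)) _⟩
  let μ' : L := ⟨μ, hμ⟩
  let O := MulAction.orbit (V →L[ℂ] V)ˣ μ'
  have hO : O = {ν : L | (ν : V →L[ℂ] V →L[ℂ] V) ∈ transportOrbit μ} := by
    ext ν
    constructor
    · rintro ⟨u, rfl⟩
      exact ⟨ContinuousLinearEquiv.unitsEquiv ℂ V u⁻¹, fun x y => rfl⟩
    · rintro ⟨f, hf⟩
      refine ⟨((ContinuousLinearEquiv.unitsEquiv ℂ V).symm f)⁻¹, Subtype.ext ?_⟩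
      ext x y
      exact (hf x y).symm
  have hOopen : IsOpen O := hO ▸ hopen
  have : ProperSpace (V →L[ℂ] V) := FiniteDimensional.proper ℂ _
  have : LocallyCompactSpace (V →L[ℂ] V →L[ℂ] V) :=
    .of_finiteDimensional_of_complete ℂ _
  have : LocallyCompactSpace L :=
    (isClosed_setOf_isLieBracket (V := V)).isClosedEmbedding_subtypeVal.locallyCompactSpace
  have : LocallyCompactSpace O := hOopen.locallyCompactSpace
  have : LocallyCompactSpace (V →L[ℂ] V)ˣ := Units.isOpenEmbedding_val.locallyCompactSpace
  have : SecondCountableTopology (V →L[ℂ] V)ˣ :=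
    Units.isOpenEmbedding_val.isEmbedding.secondCountableTopology
  have hcont : ContinuousSMul (V →L[ℂ] V)ˣ O :=
    ⟨Continuous.subtype_mk (continuous_fst.smul (continuous_subtype_val.comp continuous_snd)) _⟩
  have hmem : μ' ∈ O := MulAction.mem_orbit_self μ'
  have hU' : (Units.val ⁻¹' U : Set (V →L[ℂ] V)ˣ) ∈ 𝓝 1 :=
    Units.continuous_val.continuousAt.preimage_mem_nhds hU
  have key := smul_singleton_mem_nhds_of_sigmaCompact hU' (⟨μ', hmem⟩ : O)
  have key' := hOopen.isOpenEmbedding_subtypeVal.image_mem_nhds.2 key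
  obtain ⟨W, hW, hWU⟩ := (Filter.mem_comap.1 (by rwa [nhds_induced] at key') :
    ∃ W ∈ 𝓝 μ, Subtype.val ⁻¹' W ⊆ _)
  filter_upwards [hW] with ν hνW hν
  obtain ⟨w, hw, hwν⟩ := @hWU ⟨ν, hν⟩ hνW
  obtain ⟨u, hu, _, rfl, huw⟩ := Set.mem_smul.1 hw
  have huν : conjBil (u : V →L[ℂ] V) (↑u⁻¹ : V →L[ℂ] V) μ = ν :=
    congrArg Subtype.val ((congrArg Subtype.val huw).trans hwν)
  have h : ∀ x, (↑u⁻¹ : V →L[ℂ] V) ((u : V →L[ℂ] V) x) = x := fun x => by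
    rw [← mul_apply_eq_comp, u.inv_mul, one_apply_eq_self]
  refine ⟨u, hu, fun x y => ?_⟩
  rw [← huν, conjBil_apply, h, h]

end Orbit

section Exponential

open NormedSpace

variable {V : Type*} [NormedAddCommGroup V] [NormedSpace ℂ V] [CompleteSpace V]

/-- The exponential of a derivation is multiplicative. -/
theorem exp_apply_bilin_of_derivation {μ : V →L[ℂ] V →L[ℂ] V} {d : V →L[ℂ] V}
    (hd : ∀ x y, d (μ x y) = μ (d x) y + μ x (d y)) (x y : V) :
    exp d (μ x y) = μ (exp d x) (exp d y) := by
  have hexp : ∀ (e : V →L[ℂ] V) (t : ℂ) (v : V),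
      HasDerivAt (fun s : ℂ => exp (s • e) v) (e (exp (t • e) v)) t := fun e t v =>
    by simpa using (hasDerivAt_exp_smul_const' e t).clm_apply (hasDerivAt_const t v)
  have hcomm : ∀ t : ℂ, Commute (exp (t • -d)) d := fun t =>
    (((Commute.refl d).neg_left).smul_left t).exp_left
  have hder : ∀ t : ℂ, HasDerivAt
      (fun s : ℂ => exp (s • -d) (μ (exp (s • d) x) (exp (s • d) y))) 0 t := by
    intro t
    have h := (hasDerivAt_exp_smul_const' (𝕂 := ℂ) (-d) t).clm_apply
      ((μ.hasFDerivAt.comp_hasDerivAt t (hexp d t x)).clm_apply (hexp d t y))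
    refine h.congr_deriv ?_
    have := DFunLike.congr_fun (hcomm t).eq (μ (exp (t • d) x) (exp (t • d) y))
    simp only [mul_apply_eq_comp, hd, map_add] at this
    simp only [smul_neg] at this
    simp [this]
  have hconst := is_const_of_deriv_eq_zero (fun t => (hder t).differentiableAt)
    (fun t => (hder t).deriv) 1 0
  simp only [one_smul, zero_smul, exp_zero, one_apply_eq_self] at hconst
  let _ : NormedAlgebra ℚ (V →L[ℂ] V) := .restrictScalars ℚ ℂ _
  rw [← hconst, ← mul_apply_eq_comp, ← exp_add_of_commute (Commute.neg_right rfl)]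
  simp

end Exponential

section Tangent

variable {E F : Type*} [NormedAddCommGroup E] [NormedSpace ℂ E]
  [NormedAddCommGroup F] [NormedSpace ℂ F]

/-- A continuous linear map between finite-dimensional spaces has a generalized inverse. -/
theorem ContinuousLinearMap.exists_comp_comp_eq_self [FiniteDimensional ℂ E]
    [FiniteDimensional ℂ F] (B : E →L[ℂ] F) : ∃ R : F →L[ℂ] E, ∀ x, B (R (B x)) = B x := by
  obtain ⟨s, hs⟩ := (B : E →ₗ[ℂ] F).rangeRestrict.exists_rightInverse_of_surjective
    (LinearMap.range_rangeRestrict _)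
  obtain ⟨r, hr⟩ := LinearMap.exists_extend s
  refine ⟨LinearMap.toContinuousLinearMap r, fun x => ?_⟩
  have h := LinearMap.congr_fun hs ((B : E →ₗ[ℂ] F).rangeRestrict x)
  have h' := LinearMap.congr_fun hr ((B : E →ₗ[ℂ] F).rangeRestrict x)
  have h'' : r (B x) = s ((B : E →ₗ[ℂ] F).rangeRestrict x) := h'
  rw [LinearMap.coe_toContinuousLinearMap', h'']
  exact congrArg Subtype.val h

/-- If arbitrarily small `m` satisfy `B m = t • φ` up to terms of second order, then `φ` lies in
the image of `B`. -/
theorem ContinuousLinearMap.eq_apply_of_approx {B : E →L[ℂ] F} {R : F →L[ℂ] E}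
    (hBR : ∀ x, B (R (B x)) = B x) {φ : F} {K : ℝ} (hK : 0 ≤ K)
    (h : ∀ η > 0, ∃ t : ℂ, t ≠ 0 ∧ ∃ m : E, ‖m‖ < η ∧ R (B m) = m ∧ ∃ r s : F,
      B m = r + t • (φ + s) ∧ ‖r‖ ≤ K * ‖m‖ ^ 2 ∧ ‖s‖ ≤ K * ‖m‖) :
    φ = B (R φ) := by
  rw [← sub_eq_zero, ← norm_eq_zero]
  set P : F →L[ℂ] F := ContinuousLinearMap.id ℂ F - B.comp R with hP
  have hPa : ∀ y, P y = y - B (R y) := fun y => rfl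
  rw [← hPa]
  set C : ℝ := 2 * ‖R‖ * (‖φ‖ + K) with hC
  have hC0 : 0 ≤ C := by positivity
  set D : ℝ := ‖P‖ * K * (C + 1) with hD
  have hD0 : 0 ≤ D := by positivity
  refine le_antisymm (le_of_forall_pos_le_add fun ε hε => ?_) (norm_nonneg _)
  rw [zero_add]
  obtain ⟨t, ht, m, hm, hRm, r, s, hB, hr, hs⟩ := h (min 1 (min (1 / (2 * (‖R‖ * K + 1)))
    (ε / (D + 1)))) (by positivity)
  rw [lt_min_iff, lt_min_iff, lt_div_iff₀ (by positivity), lt_div_iff₀ (by positivity)] at hm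
  obtain ⟨hm1, hm2, hm3⟩ := hm
  have ht' : 0 < ‖t‖ := norm_pos_iff.2 ht
  have hm0 := norm_nonneg m
  have e1 : ‖m‖ ≤ ‖R‖ * (K * ‖m‖ ^ 2 + ‖t‖ * (‖φ‖ + K * ‖m‖)) := by
    calc ‖m‖ = ‖R (r + t • (φ + s))‖ := by rw [← hB, hRm]
      _ ≤ ‖R‖ * ‖r + t • (φ + s)‖ := R.le_opNorm _
      _ ≤ ‖R‖ * (K * ‖m‖ ^ 2 + ‖t‖ * (‖φ‖ + K * ‖m‖)) := by
        gcongr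
        refine (norm_add_le _ _).trans (add_le_add hr ?_)
        rw [norm_smul]
        gcongr
        exact (norm_add_le _ _).trans (by gcongr)
  have e2 : ‖m‖ ≤ C * ‖t‖ := by
    have a1 : ‖R‖ * K * ‖m‖ ^ 2 ≤ ‖m‖ / 2 := by nlinarith
    have a2 : ‖R‖ * ‖t‖ * (K * ‖m‖) ≤ ‖R‖ * ‖t‖ * K := by
      gcongr
      nlinarith
    rw [hC]
    nlinarith
  have e3 : P r + t • (P φ + P s) = 0 := by
    rw [← map_add, ← map_smul, ← map_add, ← hB, hPa, hBR, sub_self]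
  have e4 : ‖t‖ * ‖P φ‖ ≤ ‖t‖ * (D * ‖m‖) := by
    have : t • P φ = -(P r + t • P s) := by
      rw [smul_add] at e3
      rw [eq_neg_iff_add_eq_zero, ← e3]
      abel
    rw [← norm_smul, this, norm_neg]
    calc ‖P r + t • P s‖ ≤ ‖P‖ * (K * ‖m‖ ^ 2) + ‖t‖ * (‖P‖ * (K * ‖m‖)) := by
          refine (norm_add_le _ _).trans (add_le_add (P.le_opNorm_of_le hr) ?_)
          rw [norm_smul]
          gcongr
          exact P.le_opNorm_of_le hs
      _ ≤ ‖P‖ * (K * (‖m‖ * (C * ‖t‖))) + ‖t‖ * (‖P‖ * (K * ‖m‖)) := by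
          rw [pow_two]
          gcongr
      _ = ‖t‖ * (D * ‖m‖) := by rw [hD]; ring
  have e5 := le_of_mul_le_mul_left e4 ht'
  nlinarith

end Tangent

section Coboundary

open Topology NormedSpace

/-- Elements of a Banach algebra close to `1` factor as `(1 + P a) * exp (b - P b)`. -/
theorem one_add_mul_exp_mem_nhds_one {A : Type*} [NormedRing A] [NormedAlgebra ℂ A]
    [CompleteSpace A] (P : A →L[ℂ] A) {η : ℝ} (hη : 0 < η) :
    {u : A | ∃ a b, ‖P a‖ < η ∧ u = (1 + P a) * exp (b - P b)} ∈ 𝓝 1 := by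
  let f : A × A → A := fun p => (1 + P p.1) * exp (p.2 - P p.2)
  let f' : A × A →L[ℂ] A := P.comp (.fst ℂ A A) +
    (ContinuousLinearMap.id ℂ A - P).comp (.snd ℂ A A)
  have h1 : HasStrictFDerivAt (fun p : A × A => 1 + P p.1) (P.comp (.fst ℂ A A)) 0 :=
    ((P.comp (.fst ℂ A A)).hasStrictFDerivAt).const_add 1
  have h2 : HasStrictFDerivAt (fun p : A × A => exp (p.2 - P p.2))
      ((ContinuousLinearMap.id ℂ A - P).comp (.snd ℂ A A)) 0 := by
    have h3 : HasStrictFDerivAt (exp : A → A) (1 : A →L[ℂ] A)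
        (((ContinuousLinearMap.id ℂ A - P).comp (.snd ℂ A A)) (0 : A × A)) := by
      rw [map_zero]
      exact hasStrictFDerivAt_exp_zero
    exact h3.comp 0 ((ContinuousLinearMap.id ℂ A - P).comp (.snd ℂ A A)).hasStrictFDerivAt
  have hf : HasStrictFDerivAt f f' 0 := by
    refine (h1.mul' h2).congr_fderiv ?_
    ext p <;> simp [f']
  have hsurj : f'.range = ⊤ := LinearMap.range_eq_top.2 fun c => ⟨(c, c), by simp [f']⟩
  have hmap := hf.map_nhds_eq_of_surj hsurj
  have hf0 : f 0 = 1 := by simp [f]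
  rw [hf0] at hmap
  rw [← hmap, Filter.mem_map]
  have hcont : Continuous fun p : A × A => ‖P p.1‖ := by fun_prop
  filter_upwards [hcont.continuousAt.eventually_lt (continuousAt_const (y := η)) (by simpa)]
    with p hp
  exact ⟨p.1, p.2, hp, rfl⟩

variable {V : Type*} [NormedAddCommGroup V] [NormedSpace ℂ V]

/-- The linear map sending `m` to `(x, y) ↦ m (μ x y) - μ (m x) y - μ x (m y)`. -/
noncomputable def bilCoboundary (μ : V →L[ℂ] V →L[ℂ] V) :
    (V →L[ℂ] V) →ₗ[ℂ] V →L[ℂ] V →L[ℂ] V where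
  toFun m := (ContinuousLinearMap.compL ℂ V V V m).comp μ - μ.comp m - (μ.flip.comp m).flip
  map_add' m m' := by
    ext x y
    simp
    abel
  map_smul' c m := by
    ext x y
    simp [smul_sub]

@[simp]
theorem bilCoboundary_apply (μ : V →L[ℂ] V →L[ℂ] V) (m : V →L[ℂ] V) (x y : V) :
    bilCoboundary μ m x y = m (μ x y) - μ (m x) y - μ x (m y) := rfl

theorem norm_bilinearComp_le (ν : V →L[ℂ] V →L[ℂ] V) (m : V →L[ℂ] V) :
    ‖ν.bilinearComp m m‖ ≤ ‖ν‖ * ‖m‖ ^ 2 := by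
  refine ContinuousLinearMap.opNorm_le_bound₂ _ (by positivity) fun x y => ?_
  calc ‖ν (m x) (m y)‖ ≤ ‖ν‖ * ‖m x‖ * ‖m y‖ := ν.le_opNorm₂ _ _
    _ ≤ ‖ν‖ * (‖m‖ * ‖x‖) * (‖m‖ * ‖y‖) := by gcongr <;> exact m.le_opNorm _
    _ = _ := by ring

theorem norm_bilinearComp_one_add_sub_le (ν : V →L[ℂ] V →L[ℂ] V) {m : V →L[ℂ] V}
    (hm : ‖m‖ ≤ 1) : ‖ν.bilinearComp (1 + m) (1 + m) - ν‖ ≤ 3 * ‖ν‖ * ‖m‖ := by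
  refine ContinuousLinearMap.opNorm_le_bound₂ _ (by positivity) fun x y => ?_
  have h : (ν.bilinearComp (1 + m) (1 + m) - ν : V →L[ℂ] V →L[ℂ] V) x y =
      ν (m x) y + ν x (m y) + ν (m x) (m y) := by
    change ν ((1 + m) x) ((1 + m) y) - ν x y = _
    simp only [add_apply, one_apply_eq_self, map_add]
    abel
  rw [h]
  have hx := m.le_opNorm x
  have hy := m.le_opNorm y
  calc _ ≤ ‖ν (m x) y‖ + ‖ν x (m y)‖ + ‖ν (m x) (m y)‖ := norm_add₃_le
    _ ≤ ‖ν‖ * ‖m x‖ * ‖y‖ + ‖ν‖ * ‖x‖ * ‖m y‖ + ‖ν‖ * ‖m x‖ * ‖m y‖ := by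
      gcongr <;> exact ν.le_opNorm₂ _ _
    _ ≤ ‖ν‖ * (‖m‖ * ‖x‖) * ‖y‖ + ‖ν‖ * ‖x‖ * (‖m‖ * ‖y‖) +
        ‖ν‖ * (‖m‖ * ‖x‖) * (1 * ‖y‖) := by
      gcongr
      exact hy.trans (by gcongr)
    _ = _ := by ring

/-- A linear direction of deformation of a Lie bracket with open orbit is a coboundary. -/
theorem exists_eq_bilCoboundary_of_isOpen_transportOrbit [FiniteDimensional ℂ V]
    {μ : V →L[ℂ] V →L[ℂ] V} (hμ : IsLieBracket μ)
    (hopen : IsOpen {ν : {ν : V →L[ℂ] V →L[ℂ] V // IsLieBracket ν} |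
      (ν : V →L[ℂ] V →L[ℂ] V) ∈ transportOrbit μ}) {φ : V →L[ℂ] V →L[ℂ] V}
    (hφ : ∀ t : ℂ, IsLieBracket (μ + t • φ)) : ∃ a : V →L[ℂ] V, φ = bilCoboundary μ a := by
  have : CompleteSpace V := FiniteDimensional.complete ℂ V
  let B : (V →L[ℂ] V) →L[ℂ] V →L[ℂ] V →L[ℂ] V :=
    LinearMap.toContinuousLinearMap (bilCoboundary μ)
  obtain ⟨R, hBR⟩ := ContinuousLinearMap.exists_comp_comp_eq_self
    (E := V →L[ℂ] V) (F := V →L[ℂ] V →L[ℂ] V) B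
  refine ⟨R φ, ContinuousLinearMap.eq_apply_of_approx
    (E := V →L[ℂ] V) (F := V →L[ℂ] V →L[ℂ] V) hBR (K := ‖μ‖ + 3 * ‖φ‖) (by positivity)
    fun η hη => ?_⟩
  have key := eventually_exists_unit_of_isOpen_transportOrbit hμ hopen
    (one_add_mul_exp_mem_nhds_one (R.comp B) (lt_min hη one_pos))
  have htend : Filter.Tendsto (fun t : ℂ => μ + t • φ) (𝓝[≠] 0) (𝓝 μ) := by
    refine Filter.Tendsto.mono_left ?_ nhdsWithin_le_nhds
    have : Continuous fun t : ℂ => μ + t • φ := by fun_prop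
    have h0 : μ + (0 : ℂ) • φ = μ := by
      ext x y
      simp
    simpa only [h0] using this.tendsto 0
  obtain ⟨t, ht, ht0⟩ := ((htend.eventually key).and self_mem_nhdsWithin).exists
  obtain ⟨u, ⟨a, b, hab, hu⟩, huν⟩ := ht (hφ t)
  set m : V →L[ℂ] V := R (B a) with hm
  set d : V →L[ℂ] V := b - R (B b) with hd
  have hdder : ∀ x y, d (μ x y) = μ (d x) y + μ x (d y) := fun x y => by
    have h0 : bilCoboundary μ d = 0 := by
      change B d = 0
      rw [hd, map_sub, hBR, sub_self]
    have h1 := DFunLike.congr_fun (DFunLike.congr_fun h0 x) y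
    rw [bilCoboundary_apply, sub_sub] at h1
    exact sub_eq_zero.1 h1
  have hu' : ∀ x, (u : V →L[ℂ] V) x = (1 + m) (exp d x) := fun x => by rw [hu]; rfl
  let _ : NormedAlgebra ℚ (V →L[ℂ] V) := .restrictScalars ℚ ℂ _
  have hinv : ∀ x, exp d (exp (-d) x) = x := fun x => by
    rw [← mul_apply_eq_comp, ← exp_add_of_commute (Commute.neg_right rfl)]
    simp
  have hconj : ∀ x y, (μ + t • φ) ((1 + m) x) ((1 + m) y) = (1 + m) (μ x y) := fun x y => by
    have h := huν (exp (-d) x) (exp (-d) y)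
    rwa [hu', hu', hu', exp_apply_bilin_of_derivation hdder, hinv, hinv] at h
  have hab' : ‖m‖ < min η 1 := hab
  obtain ⟨hmη, hm1⟩ := lt_min_iff.1 hab'
  refine ⟨t, ht0, m, hmη, by rw [hm, hBR], μ.bilinearComp m m,
    φ.bilinearComp (1 + m) (1 + m) - φ, ?_, ?_, ?_⟩
  · ext x y
    change m (μ x y) - μ (m x) y - μ x (m y) = μ (m x) (m y) + t • (φ x y +
      (φ ((1 + m) x) ((1 + m) y) - φ x y))
    have h := hconj x y
    rw [add_sub_cancel]
    simp only [add_apply, one_apply_eq_self, map_add, smul_apply, smul_add] at h ⊢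
    rw [← sub_eq_zero] at h ⊢
    rw [← neg_eq_zero, ← h]
    abel
  · exact (norm_bilinearComp_le μ m).trans (by gcongr; linarith [norm_nonneg φ])
  · exact (norm_bilinearComp_one_add_sub_le φ hm1.le).trans
      (by gcongr; linarith [norm_nonneg μ])

end Coboundary

section LieStructure

variable {V : Type*} [NormedAddCommGroup V] [NormedSpace ℂ V] {μ : V →L[ℂ] V →L[ℂ] V}

theorem IsAltBil.apply_eq_neg (hμ : IsAltBil μ) (x y : V) : μ x y = -μ y x := by
  have h := hμ (x + y)
  simp only [map_add, add_apply, hμ x, hμ y, zero_add, add_zero] at h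
  exact eq_neg_of_add_eq_zero_left ((add_comm _ _).trans h)

/-- The Lie ring structure given by a Lie bracket. -/
@[reducible]
noncomputable def IsLieBracket.lieRing (hμ : IsLieBracket μ) : LieRing V where
  bracket x y := μ x y
  add_lie x y z := by simp
  lie_add x y z := map_add (μ x) y z
  lie_self x := hμ.1 x
  leibniz_lie x y z := by
    change μ x (μ y z) = μ (μ x y) z + μ y (μ x z)
    have h := hμ.2 x y z
    rw [hμ.1.apply_eq_neg (μ y z) x, hμ.1.apply_eq_neg (μ z x) y, hμ.1.apply_eq_neg z x,
      map_neg, neg_neg, ← sub_eq_add_neg, sub_add_eq_add_sub, sub_eq_zero] at h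
    exact h.symm

/-- The Lie algebra structure given by a Lie bracket. -/
@[reducible]
noncomputable def IsLieBracket.lieAlgebra (hμ : IsLieBracket μ) :
    letI := hμ.lieRing
    LieAlgebra ℂ V :=
  letI := hμ.lieRing
  { (inferInstance : Module ℂ V) with
    lie_smul := fun t x y => map_smul (μ x) t y }

end LieStructure

/-- If `μ` is a rigid Lie bracket on a finite-dimensional complex vector space `V`,
then for every `X ∈ V` the semisimple and nilpotent parts of the Jordan–Chevalley
decomposition of `ad_μ X = μ X` are themselves inner derivations:
`Ad_μ = {ad_μ X : X ∈ V}` contains the Jordan parts of each of its elements. -/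
theorem jordan_parts_inner_of_rigid
    (V : Type*) [NormedAddCommGroup V] [NormedSpace ℂ V] [FiniteDimensional ℂ V]
    (μ : V →L[ℂ] V →L[ℂ] V) (hLie : IsLieBracket μ)
    (hrigid : IsOpen {ν : {ν : V →L[ℂ] V →L[ℂ] V // IsLieBracket ν} |
        (ν : V →L[ℂ] V →L[ℂ] V) ∈ transportOrbit μ})
    (X : V) (S N : V →L[ℂ] V)
    (hsum : μ X = S + N)
    (hS : Module.End.IsSemisimple (S : V →ₗ[ℂ] V))
    (hN : IsNilpotent N)
    (hSN : Commute S N) :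
    (∃ Xs : V, S = μ Xs) ∧ (∃ Xn : V, N = μ Xn) := by
  suffices h : ∃ z, S = μ z by
    obtain ⟨z, hz⟩ := h
    exact ⟨⟨z, hz⟩, X - z, by rw [map_sub, hsum, ← hz, add_sub_cancel_left]⟩
  let _ := hLie.lieRing
  let _ := hLie.lieAlgebra
  have hrig : IsLinearlyRigid V := by
    intro φ hφ hJ
    let φ' : V →L[ℂ] V →L[ℂ] V := LinearMap.toContinuousLinearMap
      ((LinearMap.toContinuousLinearMap : (V →ₗ[ℂ] V) ≃ₗ[ℂ] V →L[ℂ] V).toLinearMap ∘ₗ φ)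
    obtain ⟨a, ha⟩ := exists_eq_bilCoboundary_of_isOpen_transportOrbit hLie hrigid (φ := φ')
      fun t => ⟨fun x => by
          change μ x x + t • φ x x = 0
          rw [hLie.1, hφ, smul_zero, add_zero],
        hJ t (fun x y => (μ + t • φ') x y) fun x y => rfl⟩
    exact ⟨a, fun x y => DFunLike.congr_fun (DFunLike.congr_fun ha x) y⟩
  have hN' : IsNilpotent (N : V →ₗ[ℂ] V) := by
    obtain ⟨k, hk⟩ := hN
    refine ⟨k, LinearMap.ext fun x => ?_⟩
    rw [← ContinuousLinearMap.toLinearMap_pow, hk]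
    rfl
  have hSN' : Commute (S : V →ₗ[ℂ] V) (N : V →ₗ[ℂ] V) :=
    LinearMap.ext fun x => DFunLike.congr_fun hSN.eq x
  obtain ⟨z, hz⟩ := hrig.exists_semisimple_part_eq_ad (X := X) hS hN' hSN'
    (LinearMap.ext fun y => DFunLike.congr_fun hsum y)
  exact ⟨z, ContinuousLinearMap.ext fun y => LinearMap.congr_fun hz y⟩
end

section
/- Let g be a finite-dimensional complex Lie algebra and D : g → g a derivation (D[X,Y] = [DX,Y] + [X,DY]). If D = D_s + D_n is the Jordan–Chevalley decomposition of D as an endomorphism of the underlying vector space, then D_s and D_n are also derivations of g. -/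
section

variable {K L : Type*} [CommRing K] [LieRing L] [LieAlgebra K L]

/-- If `D = S + N` is a derivation with `S` and `N` commuting, and `x`, `y` are eigenvectors of `S`
killed by powers of `N`, then `⁅x, y⁆` is killed by a power of `D - (a + b)`. -/
lemma pow_sub_smul_lie_eq_zero {D S N : Module.End K L}
    (hD : ∀ x y : L, D ⁅x, y⁆ = ⁅D x, y⁆ + ⁅x, D y⁆) (hsum : D = S + N) (hSN : Commute S N)
    {a b : K} (i j : ℕ) {x y : L} (hx : S x = a • x) (hy : S y = b • y)
    (hNx : (N ^ i) x = 0) (hNy : (N ^ j) y = 0) :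
    ((D - (a + b) • 1) ^ (i + j)) ⁅x, y⁆ = 0 := by
  have hcomm (z : L) : S (N z) = N (S z) := LinearMap.congr_fun hSN z
  induction hn : i + j generalizing i j x y with
  | zero =>
    obtain rfl : i = 0 := by omega
    have hx0 : x = 0 := by simpa using hNx
    simp [hx0]
  | succ n ih =>
    have hstep : (D - (a + b) • 1) ⁅x, y⁆ = ⁅N x, y⁆ + ⁅x, N y⁆ := by
      rw [LinearMap.sub_apply, hD, hsum]
      simp only [LinearMap.smul_apply, Module.End.one_apply, LinearMap.add_apply, hx, hy,
        add_lie, lie_add, smul_lie, lie_smul, add_smul]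
      abel
    rw [pow_succ, Module.End.mul_apply, hstep, map_add]
    have hleft : ((D - (a + b) • 1) ^ n) ⁅N x, y⁆ = 0 := by
      cases i with
      | zero =>
        have hx0 : x = 0 := by simpa using hNx
        simp [hx0]
      | succ i =>
        refine ih i j (by rw [hcomm, hx, map_smul]) hy ?_ hNy (by omega)
        rwa [pow_succ, Module.End.mul_apply] at hNx
    have hright : ((D - (a + b) • 1) ^ n) ⁅x, N y⁆ = 0 := by
      cases j with
      | zero =>
        have hy0 : y = 0 := by simpa using hNy
        simp [hy0]
      | succ j =>
        refine ih i j hx (by rw [hcomm, hy, map_smul]) hNx ?_ (by omega)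
        rwa [pow_succ, Module.End.mul_apply] at hNy
    rw [hleft, hright, add_zero]

end

/-- Let `g` be a finite-dimensional complex Lie algebra and `D : g → g` a derivation.
If `D = S + N` is the Jordan–Chevalley decomposition of `D` (with `S` semisimple,
`N` nilpotent and `S`, `N` commuting) as an endomorphism of the underlying vector
space, then `S` and `N` are also derivations of `g`. -/
theorem jordan_parts_of_derivation_are_derivations
    (L : Type*) [LieRing L] [LieAlgebra ℂ L] [Module.Finite ℂ L]
    (D S N : Module.End ℂ L)
    (hD : ∀ x y : L, D ⁅x, y⁆ = ⁅D x, y⁆ + ⁅x, D y⁆)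
    (hsum : D = S + N)
    (hS : S.IsSemisimple)
    (hN : IsNilpotent N)
    (hSN : Commute S N) :
    (∀ x y : L, S ⁅x, y⁆ = ⁅S x, y⁆ + ⁅x, S y⁆) ∧
    (∀ x y : L, N ⁅x, y⁆ = ⁅N x, y⁆ + ⁅x, N y⁆) := by
  have hDS : Commute D S := hsum ▸ (Commute.refl S).add_left hSN.symm
  have heig (a b : ℂ) (x y : L) (hx : S x = a • x) (hy : S y = b • y) :
      S ⁅x, y⁆ = (a + b) • ⁅x, y⁆ := by
    obtain ⟨k, hk⟩ := hN
    refine Module.End.apply_eq_of_mem_of_comm_of_isFinitelySemisimple_of_isNil (f := D)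
      ((Module.End.mem_maxGenEigenspace _ _ _).mpr ⟨k + k,
        pow_sub_smul_lie_eq_zero hD hsum hSN k k hx hy (by simp [hk]) (by simp [hk])⟩)
      hDS hS.isFinitelySemisimple ⟨k, ?_⟩
    rw [hsum, add_sub_cancel_left, hk]
  have hmem (x : L) : x ∈ ⨆ a : ℂ, Module.End.eigenspace S a := by
    simp [hS.iSup_eigenspace_eq_top]
  have hSder (x y : L) : S ⁅x, y⁆ = ⁅S x, y⁆ + ⁅x, S y⁆ := by
    induction hmem x using Submodule.iSup_induction' with
    | zero => simp
    | add x₁ x₂ _ _ h₁ h₂ =>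
      simp only [add_lie, map_add, h₁, h₂]
      abel
    | mem a x hx =>
      induction hmem y using Submodule.iSup_induction' with
      | zero => simp
      | add y₁ y₂ _ _ h₁ h₂ =>
        simp only [lie_add, map_add, h₁, h₂]
        abel
      | mem b y hy =>
        rw [Module.End.mem_eigenspace_iff] at hx hy
        rw [heig a b x y hx hy, hx, hy, smul_lie, lie_smul, add_smul]
  refine ⟨hSder, fun x y ↦ ?_⟩
  obtain rfl : N = D - S := by rw [hsum, add_sub_cancel_left]
  simp only [LinearMap.sub_apply, hD, hSder, sub_lie, lie_sub]
  abel
end
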